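/- Let d ≥ 5, and adopt the shell setup: Q_{4N} ⊆ D ⊆ Z^d, 16 ≤ n < n+m ≤ N with m ≤ n/8, L the loop erasure of simple random walk from 0 stopped at its first exit from D, α the initial segment of L up to its first hit of ∂_i Q_n with endpoint x₀, β the segment of L from x₀ up to its first hit of ∂_i Q(x₀,m), and A the box Q(x₀ + (m/2)e₁, m/4) (suitably rotated if x₀ is not on the face H_n). Then there exists a constant c₀ = c₀(d) > 0 such that P( H_A(β) ≥ c₀ m² | α ) ≥ c₀ for every realization of α. -/

import Mathlib

set_option linter.all false
open MeasureTheory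
open scoped ENNReal Classical

namespace USFPaper

/-- Vertices of the nearest-neighbour integer lattice `ℤ^d`. -/
abbrev V (d : ℕ) := Fin d → ℤ

variable {d : ℕ}

/-- Nearest-neighbour adjacency in `ℤ^d`. -/
def adj (x y : V d) : Prop := (∑ i, |x i - y i|) = 1

/-- The cube `Q(x,r) = { y : ‖x - y‖_∞ ≤ r }`. -/
def cube (x : V d) (r : ℕ) : Set (V d) := { y | ∀ i, |y i - x i| ≤ (r : ℤ) }

/-- Inner boundary `∂ᵢA` of a set `A`. -/
def innerBdry (A : Set (V d)) : Set (V d) := { x | x ∈ A ∧ ∃ y, adj x y ∧ y ∉ A }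

/-- Euclidean distance on `ℤ^d`. -/
noncomputable def eudist (x y : V d) : ℝ := Real.sqrt (∑ i, ((x i : ℝ) - (y i : ℝ)) ^ 2)

/-- The `k`-th coordinate unit vector. -/
def unitVec (k : ℕ) : V d := fun i => if (i : ℕ) = k then 1 else 0

/-- `μ` is the law of simple random walk on `ℤ^d` started at `x`, as a probability
measure on path space: every nearest-neighbour cylinder of length `n` starting at `x`
has probability `(2d)⁻ⁿ`. -/
def IsSRWLaw (μ : Measure (ℕ → V d)) (x : V d) : Prop :=
  IsProbabilityMeasure μ ∧
  ∀ (n : ℕ) (γ : ℕ → V d), γ 0 = x → (∀ i < n, adj (γ i) (γ (i + 1))) →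
    μ { ω | ∀ i ≤ n, ω i = γ i } = (2 * (d : ℝ≥0∞))⁻¹ ^ n

/-- First exit time `τ_A` from `A`, valued in `ℕ∞` (`⊤` if the path never leaves `A`). -/
noncomputable def exitTimeE (A : Set (V d)) (ω : ℕ → V d) : ENat :=
  if h : ∃ j, ω j ∉ A then (Nat.find h : ENat) else ⊤

/-- First hitting time `T_A` of `A`, valued in `ℕ∞`. -/
noncomputable def hitTimeE (A : Set (V d)) (ω : ℕ → V d) : ENat :=
  if h : ∃ j, ω j ∈ A then (Nat.find h : ENat) else ⊤

/-- First positive hitting time `T⁺_A` of `A`, valued in `ℕ∞`. -/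
noncomputable def hitTimePosE (A : Set (V d)) (ω : ℕ → V d) : ENat :=
  if h : ∃ j, 1 ≤ j ∧ ω j ∈ A then (Nat.find h : ENat) else ⊤

/-- First exit time from `A` as a natural number (junk value `0` if the path never exits). -/
noncomputable def exitTime (A : Set (V d)) (ω : ℕ → V d) : ℕ := (exitTimeE A ω).toNat

/-- Index of the first hit of `A` (junk value `0` if `A` is never hit). -/
noncomputable def hitIdx (A : Set (V d)) (γ : ℕ → V d) : ℕ := (hitTimeE A γ).toNat

/-- First index `≥ t` at which the path lies in `A` (junk value `t`). -/
noncomputable def hitIdxFrom (A : Set (V d)) (t : ℕ) (γ : ℕ → V d) : ℕ :=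
  if h : ∃ j, t ≤ j ∧ γ j ∈ A then Nat.find h else t

/-- The path frozen at its first exit from `D`. -/
noncomputable def stopAt (D : Set (V d)) (ω : ℕ → V d) : ℕ → V d :=
  fun j => if (j : ENat) ≤ exitTimeE D ω then ω j else ω (exitTime D ω)

/-- Time of the last visit of the path to the point `ω t`, at or after time `t`
(junk value if there are infinitely many such visits). -/
noncomputable def lastVisit (ω : ℕ → V d) (t : ℕ) : ℕ := sSup { j | t ≤ j ∧ ω j = ω t }

/-- The times of the chronological loop erasure (last-exit decomposition). -/
noncomputable def leTime (ω : ℕ → V d) : ℕ → ℕ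
  | 0 => lastVisit ω 0
  | k + 1 => lastVisit ω (leTime ω k + 1)

/-- Chronological loop erasure of an (infinite, transient) path. -/
noncomputable def infLoopErase (ω : ℕ → V d) : ℕ → V d := fun k => ω (leTime ω k)

/-- The loop erasure `L` of the walk stopped at its first exit from `D`. -/
noncomputable def lerw (D : Set (V d)) (ω : ℕ → V d) : ℕ → V d := infLoopErase (stopAt D ω)

/-- The event `T_A > τ_D`: the walk does not visit `A` at any time up to (and
including) its first exit from `D`; if it never exits `D`, it never visits `A`. -/
def avoidBeforeExit (D A : Set (V d)) (ω : ℕ → V d) : Prop :=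
  ∀ j : ℕ, (j : ENat) ≤ exitTimeE D ω → ω j ∉ A

/-- The event `T⁺_A > τ_D` (visits of `A` at positive times only). -/
def avoidBeforeExitPos (D A : Set (V d)) (ω : ℕ → V d) : Prop :=
  ∀ j : ℕ, 1 ≤ j → (j : ENat) ≤ exitTimeE D ω → ω j ∉ A

/-- The right-hand face (in the first coordinate direction) of the cube `Q(x₀,m)`. -/
def rightFace (x₀ : V d) (m : ℕ) : Set (V d) :=
  { y | y ∈ cube x₀ m ∧ ∀ i : Fin d, (i : ℕ) = 0 → y i = x₀ i + (m : ℤ) }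

/-- The unit vector pointing towards the face of the cube `Q(0,n)` on which `x₀`
lies (the first coordinate realising `|x₀ i| = n`; junk value `0` if there is none). -/
noncomputable def faceDir (x₀ : V d) (n : ℕ) : V d :=
  if h : ∃ i : Fin d, |x₀ i| = (n : ℤ) then
    fun j => if j = Classical.choose h then (if 0 ≤ x₀ (Classical.choose h) then 1 else -1) else 0
  else 0

/-- The point `x₁ = x₀ + (m/2) e₁` (with `e₁` replaced by the unit vector pointing
towards the face of `Q(0,n)` containing `x₀`). -/
noncomputable def x1pt (x₀ : V d) (n m : ℕ) : V d := x₀ + ((m / 2 : ℕ) : ℤ) • faceDir x₀ n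

/-- The box `A = Q(x₁, m/4)`. -/
noncomputable def boxA (x₀ : V d) (n m : ℕ) : Set (V d) := cube (x1pt x₀ n m) (m / 4)

/-- A second unit direction, orthogonal to `faceDir x₀ n`, reflected according to the
sign of the corresponding coordinate of `x₀` (junk value `0` in degenerate cases). -/
noncomputable def sideDir (x₀ : V d) (n : ℕ) : V d :=
  if h : ∃ i : Fin d, |x₀ i| = (n : ℤ) then
    (if h2 : ∃ j : Fin d, j ≠ Classical.choose h then
      fun t => if t = Classical.choose h2 then (if x₀ (Classical.choose h2) ≤ 0 then 1 else -1) else 0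
    else 0)
  else 0

/-- The point `x₂ = x₁ + m e₂` (suitably rotated/reflected). -/
noncomputable def x2pt (x₀ : V d) (n m : ℕ) : V d := x1pt x₀ n m + (m : ℤ) • sideDir x₀ n

/-- `α`: the initial segment of the loop erasure `L = lerw D ω` up to its first hit
of `∂ᵢ Q(0,n)`, as a list. -/
noncomputable def alphaList (D : Set (V d)) (n : ℕ) (ω : ℕ → V d) : List (V d) :=
  (List.range (hitIdx (innerBdry (cube 0 n)) (lerw D ω) + 1)).map (lerw D ω)

/-- The endpoint `x₀` of a finite path (junk value `0` for the empty path). -/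
def endPt (a : List (V d)) : V d := (a.getLast?).getD 0

/-- `β`: the segment of the loop erasure `L = lerw D ω` from its first hit `x₀` of
`∂ᵢ Q(0,n)` up to its first subsequent hit of `∂ᵢ Q(x₀,m)`, as a list. -/
noncomputable def betaList (D : Set (V d)) (n m : ℕ) (ω : ℕ → V d) : List (V d) :=
  let γ := lerw D ω
  let k₁ := hitIdx (innerBdry (cube 0 n)) γ
  let k₂ := hitIdxFrom (innerBdry (cube (γ k₁) m)) k₁ γ
  (List.range (k₂ - k₁ + 1)).map fun i => γ (k₁ + i)

/-- `H_A(γ)`: the number of points of the path `γ` lying in the set `A`. -/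
noncomputable def hitCount (A : Set (V d)) (l : List (V d)) : ℕ :=
  (l.map fun v => if v ∈ A then 1 else 0).sum

def ev (i : Fin d) : V d := Pi.single i 1

noncomputable def PP (f : V d → ℝ) (x : V d) : ℝ :=
  (∑ i, (f (x + ev i) + f (x - ev i))) / (2 * d)

noncomputable def nsq (x : V d) : ℝ := ∑ i, ((x i : ℤ) : ℝ) ^ 2

lemma PP_mono_at {f g : V d → ℝ} {x : V d}
    (h : ∀ i, f (x + ev i) ≤ g (x + ev i) ∧ f (x - ev i) ≤ g (x - ev i)) : PP f x ≤ PP g x := by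
  unfold PP
  gcongr with i hi
  · exact (h i).1
  · exact (h i).2

lemma PP_mono {f g : V d → ℝ} (h : ∀ x, f x ≤ g x) (x : V d) : PP f x ≤ PP g x :=
  PP_mono_at fun i => ⟨h _, h _⟩

lemma PP_add (f g : V d → ℝ) (x : V d) : PP (fun y => f y + g y) x = PP f x + PP g x := by
  unfold PP
  rw [← add_div, ← Finset.sum_add_distrib]
  congr 1
  exact Finset.sum_congr rfl fun i _ => by ring

lemma PP_sub (f g : V d → ℝ) (x : V d) : PP (fun y => f y - g y) x = PP f x - PP g x := by
  unfold PP
  rw [← sub_div, ← Finset.sum_sub_distrib]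
  congr 1
  exact Finset.sum_congr rfl fun i _ => by ring

lemma PP_smul (c : ℝ) (f : V d → ℝ) (x : V d) : PP (fun y => c * f y) x = c * PP f x := by
  unfold PP
  rw [mul_div_assoc', Finset.mul_sum]
  congr 1
  exact Finset.sum_congr rfl fun i _ => by ring

lemma PP_const (hd : 5 ≤ d) (c : ℝ) (x : V d) : PP (fun _ => c) x = c := by
  unfold PP
  have : (0:ℝ) < d := by exact_mod_cast (by omega : 0 < d)
  simp
  field_simp
  ring

lemma PP_nonneg {f : V d → ℝ} (h : ∀ x, 0 ≤ f x) (x : V d) : 0 ≤ PP f x := by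
  unfold PP
  exact div_nonneg (Finset.sum_nonneg fun i _ => add_nonneg (h _) (h _)) (by positivity)

lemma PP_ge_nbr (hd : 5 ≤ d) {f : V d → ℝ} (h : ∀ x, 0 ≤ f x) (x : V d) (i : Fin d) :
    f (x + ev i) ≤ 2 * d * PP f x ∧ f (x - ev i) ≤ 2 * d * PP f x := by
  have h0 : (0:ℝ) < d := by exact_mod_cast (by omega : 0 < d)
  have h1 : 2 * d * PP f x = ∑ i, (f (x + ev i) + f (x - ev i)) := by
    unfold PP; field_simp
  have h2 := Finset.single_le_sum (f := fun i => f (x + ev i) + f (x - ev i))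
    (fun i _ => add_nonneg (h _) (h _)) (Finset.mem_univ i)
  rw [h1]
  have := h (x + ev i); have := h (x - ev i)
  constructor <;> linarith

lemma ev_apply (i j : Fin d) : ev i j = if j = i then 1 else 0 := by
  simp [ev, Pi.single_apply]

lemma nsq_nonneg (x : V d) : 0 ≤ nsq x := Finset.sum_nonneg fun i _ => sq_nonneg _

lemma sq_le_nsq (x : V d) (i : Fin d) : ((x i : ℤ) : ℝ) ^ 2 ≤ nsq x :=
  Finset.single_le_sum (f := fun i => ((x i : ℤ) : ℝ) ^ 2) (fun i _ => sq_nonneg _) (Finset.mem_univ i)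

lemma nsq_add_smul (x : V d) (i : Fin d) (c : ℤ) :
    nsq (x + c • ev i) = nsq x + 2 * c * x i + c ^ 2 := by
  unfold nsq
  have : ∀ j, (((x + c • ev i) j : ℤ) : ℝ) ^ 2 = ((x j : ℤ) : ℝ) ^ 2 +
      (if j = i then 2 * (c:ℝ) * x i + c ^ 2 else 0) := by
    intro j
    by_cases h : j = i
    · subst h; simp [ev_apply]; ring
    · simp [ev_apply, h]
  simp only [this, Finset.sum_add_distrib, Finset.sum_ite_eq', Finset.mem_univ, if_true]
  ring

lemma nsq_add_ev (x : V d) (i : Fin d) : nsq (x + ev i) = nsq x + 2 * x i + 1 := by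
  have := nsq_add_smul x i 1
  simpa using this

lemma nsq_sub_ev (x : V d) (i : Fin d) : nsq (x - ev i) = nsq x - 2 * x i + 1 := by
  have := nsq_add_smul x i (-1)
  simp at this
  rw [sub_eq_add_neg, this]; ring

lemma PP_nsq (hd : 5 ≤ d) (w x : V d) : PP (fun y => nsq (y - w)) x = nsq (x - w) + 1 := by
  have h0 : (0:ℝ) < d := by exact_mod_cast (by omega : 0 < d)
  unfold PP
  have : ∀ i, nsq (x + ev i - w) + nsq (x - ev i - w) = 2 * (nsq (x - w) + 1) := by
    intro i
    rw [show x + ev i - w = (x - w) + ev i by abel, show x - ev i - w = (x - w) - ev i by abel,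
      nsq_add_ev, nsq_sub_ev]; ring
  simp only [this]
  simp
  field_simp

lemma nsq_ball_finite (w : V d) (R : ℝ) : {x : V d | nsq (x - w) ≤ R}.Finite := by
  apply Set.Finite.subset (Set.finite_Icc (w - fun _ => ⌈R⌉) (w + fun _ => ⌈R⌉))
  intro x hx
  have key : ∀ i, |x i - w i| ≤ ⌈R⌉ := by
    intro i
    have h1 := (sq_le_nsq (x - w) i).trans hx
    have h2 : ((|x i - w i| : ℤ) : ℝ) ≤ R := by
      have h3 : ((|x i - w i| : ℤ) : ℝ) ≤ (((x - w) i : ℤ) : ℝ) ^ 2 := by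
        have : |x i - w i| ≤ (x i - w i) ^ 2 := by
          rw [← sq_abs]
          have := abs_nonneg (x i - w i)
          rcases Int.eq_ofNat_of_zero_le this with ⟨k, hk⟩
          rw [hk]; norm_cast; exact Nat.le_self_pow (by norm_num) k
        exact_mod_cast this
      exact h3.trans h1
    exact_mod_cast h2.trans (Int.le_ceil R)
  constructor
  · intro i; have := abs_le.1 (key i); simp; omega
  · intro i; have := abs_le.1 (key i); simp; omega

/-- maximum principle -/
lemma maxp (hd : 5 ≤ d) (U : Set (V d)) (hU : U.Finite) (f : V d → ℝ)
    (hsub : ∀ x ∈ U, f x ≤ PP f x)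
    (hb : ∀ x ∈ U, ∀ i, (x + ev i ∉ U → f (x + ev i) ≤ 0) ∧ (x - ev i ∉ U → f (x - ev i) ≤ 0)) :
    ∀ x ∈ U, f x ≤ 0 := by
  by_contra! hcon
  obtain ⟨x0, hx0, hpos⟩ := hcon
  obtain ⟨x1, hx1, hmax⟩ := Set.exists_max_image U f hU ⟨x0, hx0⟩
  set M := f x1 with hM
  have hMpos : 0 < M := lt_of_lt_of_le hpos (hmax x0 hx0)
  let i0 : Fin d := ⟨0, by omega⟩
  obtain ⟨x2, ⟨hx2, hx2M⟩, hmax2⟩ := Set.exists_max_image {x ∈ U | f x = M} (fun x => x i0)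
    (hU.subset fun x hx => hx.1) ⟨x1, hx1, rfl⟩
  have hle : ∀ y, (y ∈ U → f y ≤ M) := fun y hy => hmax y hy
  have hn : ∀ i, f (x2 + ev i) ≤ M ∧ f (x2 - ev i) ≤ M := by
    intro i
    constructor
    · by_cases h : x2 + ev i ∈ U
      · exact hle _ h
      · exact ((hb x2 hx2 i).1 h).trans hMpos.le
    · by_cases h : x2 - ev i ∈ U
      · exact hle _ h
      · exact ((hb x2 hx2 i).2 h).trans hMpos.le
  have hs : f (x2 + ev i0) < M := by
    by_contra hge
    have heq : f (x2 + ev i0) = M := le_antisymm (hn i0).1 (not_lt.1 hge)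
    have hin : x2 + ev i0 ∈ U := by
      by_contra h
      have := (hb x2 hx2 i0).1 h
      linarith
    have := hmax2 (x2 + ev i0) ⟨hin, heq⟩
    simp [ev_apply] at this
  have h1 := hsub x2 hx2
  have h0 : (0:ℝ) < d := by exact_mod_cast (by omega : 0 < d)
  have h2 : PP f x2 < M := by
    unfold PP
    rw [div_lt_iff₀ (by positivity)]
    calc _ < ∑ i : Fin d, (M + M) := by
          apply Finset.sum_lt_sum
          · intro i _; exact add_le_add (hn i).1 (hn i).2
          · exact ⟨i0, Finset.mem_univ _, add_lt_add_of_lt_of_le hs (hn i0).2⟩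
      _ = M * (2 * d) := by simp; ring
  linarith [hx2M]

noncomputable def nrm (x : V d) : ℝ := Real.sqrt (nsq x)

lemma nrm_nonneg (x : V d) : 0 ≤ nrm x := Real.sqrt_nonneg _

lemma nrm_eq (x : V d) : nrm x = ‖WithLp.toLp 2 (fun i => ((x i : ℤ) : ℝ))‖ := by
  rw [EuclideanSpace.norm_eq]
  simp [nrm, nsq]

lemma nrm_sq (x : V d) : nrm x ^ 2 = nsq x := Real.sq_sqrt (nsq_nonneg x)

lemma nrm_le_iff (x : V d) {r : ℝ} (hr : 0 ≤ r) : nrm x ≤ r ↔ nsq x ≤ r ^ 2 := by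
  unfold nrm; exact Real.sqrt_le_left hr

lemma nrm_add_le (x y : V d) : nrm (x + y) ≤ nrm x + nrm y := by
  simp only [nrm_eq]
  have : WithLp.toLp 2 (fun i => (((x + y) i : ℤ) : ℝ)) =
    WithLp.toLp 2 (fun i => ((x i : ℤ) : ℝ)) + WithLp.toLp 2 (fun i => ((y i : ℤ) : ℝ)) := by
    ext i; simp
  rw [this]; exact norm_add_le _ _

lemma nsq_neg (x : V d) : nsq (-x) = nsq x := by simp [nsq]
lemma nrm_neg (x : V d) : nrm (-x) = nrm x := by simp [nrm, nsq_neg]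
lemma nrm_sub_comm (x y : V d) : nrm (x - y) = nrm (y - x) := by rw [← nrm_neg, neg_sub]

lemma nrm_tri (x y z : V d) : nrm (x - z) ≤ nrm (x - y) + nrm (y - z) := by
  have := nrm_add_le (x - y) (y - z); simpa using this

lemma abs_le_nrm (x : V d) (i : Fin d) : |((x i : ℤ) : ℝ)| ≤ nrm x :=
  Real.abs_le_sqrt (sq_le_nsq x i)

lemma nrm_le_of_abs (hd : 5 ≤ d) (x : V d) {s : ℝ} (hs : 0 ≤ s) (h : ∀ i, |((x i : ℤ) : ℝ)| ≤ s) :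
    nrm x ≤ d * s := by
  have h0 : (1:ℝ) ≤ d := by exact_mod_cast (by omega : 1 ≤ d)
  rw [nrm_le_iff _ (by positivity)]
  calc nsq x ≤ ∑ i : Fin d, s ^ 2 := Finset.sum_le_sum fun i _ => by
        rw [← sq_abs]; exact pow_le_pow_left₀ (abs_nonneg _) (h i) 2
    _ = d * s ^ 2 := by simp
    _ ≤ (d * s) ^ 2 := by nlinarith [mul_nonneg (by linarith : (0:ℝ) ≤ d) (sq_nonneg s)]

lemma one_add_sq_le_cosh (t : ℝ) : 1 + t ^ 2 / 2 ≤ Real.cosh t := by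
  have h1 : Real.cosh t = 1 + 2 * Real.sinh (t / 2) ^ 2 := by
    have := Real.cosh_two_mul (t / 2)
    rw [mul_div_cancel₀ t (two_ne_zero)] at this
    rw [this, Real.cosh_sq]; ring
  have h2 : (t / 2) ^ 2 ≤ Real.sinh (t / 2) ^ 2 := by
    rw [← sq_abs (t / 2), ← sq_abs (Real.sinh (t / 2)), Real.abs_sinh]
    exact pow_le_pow_left₀ (abs_nonneg _) (Real.self_le_sinh_iff.2 (abs_nonneg _)) 2
  rw [h1]; nlinarith

/-- Gaussian -/
noncomputable def gau (β : ℝ) (w x : V d) : ℝ := Real.exp (-β * nsq (x - w))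

lemma gau_pos (β : ℝ) (w x : V d) : 0 < gau β w x := Real.exp_pos _

lemma gau_le_one {β : ℝ} (hβ : 0 ≤ β) (w x : V d) : gau β w x ≤ 1 := by
  unfold gau; rw [Real.exp_le_one_iff]; nlinarith [nsq_nonneg (x - w)]

lemma PP_gau (hd : 5 ≤ d) (β : ℝ) (w x : V d) :
    PP (gau β w) x = gau β w x * Real.exp (-β) *
      ((∑ i, Real.cosh (2 * β * (((x - w) i : ℤ) : ℝ))) / d) := by
  have h0 : (0:ℝ) < d := by exact_mod_cast (by omega : 0 < d)
  unfold PP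
  have : ∀ i, gau β w (x + ev i) + gau β w (x - ev i) =
      2 * (gau β w x * Real.exp (-β)) * Real.cosh (2 * β * (((x - w) i : ℤ) : ℝ)) := by
    intro i
    unfold gau
    rw [show x + ev i - w = (x - w) + ev i by abel, show x - ev i - w = (x - w) - ev i by abel,
      nsq_add_ev, nsq_sub_ev, Real.cosh_eq]
    rw [show -β * (nsq (x - w) + 2 * (((x - w) i : ℤ) : ℝ) + 1) =
        -β * nsq (x - w) + -β + -(2 * β * (((x - w) i : ℤ) : ℝ)) by ring,
      show -β * (nsq (x - w) - 2 * (((x - w) i : ℤ) : ℝ) + 1) =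
        -β * nsq (x - w) + -β + (2 * β * (((x - w) i : ℤ) : ℝ)) by ring]
    simp only [Real.exp_add]
    ring
  simp only [this, ← Finset.mul_sum]
  field_simp

lemma gau_super (hd : 5 ≤ d) {β : ℝ} (hβ : 0 ≤ β) (w x : V d) :
    gau β w x - PP (gau β w) x ≤ β := by
  have h0 : (0:ℝ) < d := by exact_mod_cast (by omega : 0 < d)
  rw [PP_gau hd]
  have h1 : (1:ℝ) ≤ (∑ i, Real.cosh (2 * β * (((x - w) i : ℤ) : ℝ))) / d := by
    rw [le_div_iff₀ h0]
    calc (1:ℝ) * d = ∑ i : Fin d, (1:ℝ) := by simp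
      _ ≤ _ := Finset.sum_le_sum fun i _ => Real.one_le_cosh _
  have h2 := Real.add_one_le_exp (-β)
  have h3 := gau_pos β w x
  have h4 := gau_le_one hβ w x
  have h5 := Real.exp_pos (-β)
  have h6 : gau β w x * Real.exp (-β) * 1 ≤ gau β w x * Real.exp (-β) *
      ((∑ i, Real.cosh (2 * β * (((x - w) i : ℤ) : ℝ))) / d) := by gcongr
  nlinarith

lemma gau_sub (hd : 5 ≤ d) {β : ℝ} (hβ : 0 < β) (hβ2 : β ≤ 1 / 2) (w x : V d)
    (hx : d / β ≤ nsq (x - w)) : gau β w x ≤ PP (gau β w) x := by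
  have h0 : (0:ℝ) < d := by exact_mod_cast (by omega : 0 < d)
  rw [PP_gau hd]
  have h1 : 1 + 2 * β ≤ (∑ i, Real.cosh (2 * β * (((x - w) i : ℤ) : ℝ))) / d := by
    rw [le_div_iff₀ h0]
    calc (1 + 2 * β) * d ≤ d + 2 * β ^ 2 * nsq (x - w) := by
          have : d ≤ nsq (x - w) * β := by rwa [div_le_iff₀ hβ] at hx
          nlinarith
      _ = ∑ i : Fin d, (1 + (2 * β * (((x - w) i : ℤ) : ℝ)) ^ 2 / 2) := by
          rw [Finset.sum_add_distrib]; simp [nsq, Finset.mul_sum]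
          exact Finset.sum_congr rfl fun i _ => by ring
      _ ≤ _ := Finset.sum_le_sum fun i _ => one_add_sq_le_cosh _
  have h2 := Real.add_one_le_exp (-β)
  have h3 := gau_pos β w x
  have h5 := Real.exp_pos (-β)
  have h6 : (1 - β) * (1 + 2 * β) ≤ Real.exp (-β) *
      ((∑ i, Real.cosh (2 * β * (((x - w) i : ℤ) : ℝ))) / d) := by
    apply mul_le_mul (by linarith) h1 (by linarith) h5.le
  have h7 : 1 ≤ (1 - β) * (1 + 2 * β) := by nlinarith
  rw [mul_assoc]
  nlinarith

lemma gauss_lower (hd : 5 ≤ d) {β : ℝ} (hβ : 0 < β) (hβ2 : β ≤ 1 / 2) (w : V d) (S m0 : ℝ)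
    (hm0 : 0 ≤ m0) (f : V d → ℝ) (hf : ∀ x, 0 ≤ f x)
    (hsup : ∀ x, nsq (x - w) < S → PP f x ≤ f x)
    (hin : ∀ x, nsq (x - w) ≤ d / β → m0 ≤ f x) (x : V d) (hx : nsq (x - w) < S) :
    m0 * (Real.exp (-β * nsq (x - w)) - Real.exp (-β * S)) ≤ f x := by
  by_cases hin' : nsq (x - w) ≤ d / β
  · refine le_trans ?_ (hin x hin')
    have h1 := gau_le_one hβ.le w x
    have h2 := Real.exp_pos (-β * S)
    unfold gau at h1
    nlinarith
  · have := maxp hd {x | nsq (x - w) < S ∧ d / β < nsq (x - w)}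
      ((nsq_ball_finite w S).subset fun x hx => hx.1.le)
      (fun x => m0 * (gau β w x - Real.exp (-β * S)) - f x) ?_ ?_ x ⟨hx, not_le.1 hin'⟩
    · unfold gau at this; linarith
    · intro x hx
      have h1 := gau_sub hd hβ hβ2 w x hx.2.le
      have h2 := hsup x hx.1
      rw [PP_sub, PP_smul, PP_sub, PP_const hd]
      have := mul_le_mul_of_nonneg_left h1 hm0
      nlinarith
    · have key : ∀ y, ¬ (nsq (y - w) < S ∧ d / β < nsq (y - w)) →
          m0 * (gau β w y - Real.exp (-β * S)) - f y ≤ 0 := by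
        intro y hy
        by_cases h : nsq (y - w) < S
        · have h1 := hin y (by by_contra hh; exact hy ⟨h, not_le.1 hh⟩)
          have h2 := gau_le_one hβ.le w y
          have h3 := Real.exp_pos (-β * S)
          nlinarith
        · have : gau β w y ≤ Real.exp (-β * S) := by
            unfold gau; apply Real.exp_le_exp.2; nlinarith
          nlinarith [hf y]
      intro x hx i
      exact ⟨key _, key _⟩

/-- reflection of the coordinate `i` : `z_i ↦ c - z_i` -/
def rf (i : Fin d) (c : ℤ) (z : V d) : V d := Function.update z i (c - z i)

lemma rf_same (i : Fin d) (c : ℤ) (z : V d) : rf i c z i = c - z i := by simp [rf]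
lemma rf_ne {i j : Fin d} (h : j ≠ i) (c : ℤ) (z : V d) : rf i c z j = z j := by simp [rf, h]

lemma rf_rf (i : Fin d) (c : ℤ) (z : V d) : rf i c (rf i c z) = z := by
  ext j; by_cases h : j = i
  · subst h; simp [rf]
  · simp [rf, h]

lemma rf_add_same (i : Fin d) (c : ℤ) (z : V d) : rf i c (z + ev i) = rf i c z - ev i := by
  ext j; by_cases h : j = i
  · subst h; simp [rf, ev_apply]; ring
  · simp [rf, h, ev_apply]

lemma rf_sub_same (i : Fin d) (c : ℤ) (z : V d) : rf i c (z - ev i) = rf i c z + ev i := by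
  ext j; by_cases h : j = i
  · subst h; simp [rf, ev_apply]; ring
  · simp [rf, h, ev_apply]

lemma rf_add_ne {i k : Fin d} (hk : k ≠ i) (c : ℤ) (z : V d) : rf i c (z + ev k) = rf i c z + ev k := by
  ext j; by_cases h : j = i
  · subst h; simp [rf, ev_apply, hk.symm]
  · simp [rf, h, ev_apply]

lemma rf_sub_ne {i k : Fin d} (hk : k ≠ i) (c : ℤ) (z : V d) : rf i c (z - ev k) = rf i c z - ev k := by
  ext j; by_cases h : j = i
  · subst h; simp [rf, ev_apply, hk.symm]
  · simp [rf, h, ev_apply]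

lemma PP_rf (i : Fin d) (c : ℤ) (f : V d → ℝ) (z : V d) :
    PP (fun y => f (rf i c y)) z = PP f (rf i c z) := by
  unfold PP
  congr 1
  refine Finset.sum_congr rfl fun k _ => ?_
  beta_reduce
  by_cases h : k = i
  · subst h; rw [rf_add_same, rf_sub_same]; ring
  · rw [rf_add_ne h, rf_sub_ne h]

/-- one-sided gradient estimate -/
lemma grad_one (hd : 5 ≤ d) (f : V d → ℝ) (x : V d) (R : ℕ) (hR : 2 ≤ R) (M : ℝ)
    (hharm : ∀ z ∈ cube x R, f z = PP f z) (hb : ∀ z ∈ cube x R, 0 ≤ f z ∧ f z ≤ M) (i : Fin d) :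
    f x - f (x + ev i) ≤ d * M / R := by
  have h0 : (0:ℝ) < d := by exact_mod_cast (by omega : 0 < d)
  have hR0 : (0:ℝ) < R := by exact_mod_cast (by omega : 0 < R)
  have hxx : x ∈ cube x R := fun j => by simp
  have hM : 0 ≤ M := (hb x hxx).1.trans (hb x hxx).2
  set c : ℤ := 2 * x i + 1 with hc
  set ρ := rf i c with hρ
  set D : V d → ℝ := fun z => f z - f (ρ z) with hD
  set Dh : V d → ℝ := fun z => if z i ≤ x i then max (D z) 0 else 0 with hDh
  have hDhn : ∀ z, 0 ≤ Dh z := by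
    intro z; simp only [hDh]; split_ifs
    · exact le_max_right _ _
    · exact le_rfl
  set U : Set (V d) := {z | x i + 2 - R ≤ z i ∧ z i ≤ x i ∧ ∀ j, j ≠ i → |z j - x j| ≤ R - 1} with hU
  have hUc : ∀ z ∈ U, z ∈ cube x R ∧ ρ z ∈ cube x R := by
    intro z hz
    constructor
    · intro j
      by_cases h : j = i
      · subst h; rw [abs_le]; have := hz.1; have := hz.2.1; constructor <;> omega
      · have := hz.2.2 j h; omega
    · intro j
      by_cases h : j = i
      · subst h; rw [hρ, rf_same, abs_le]; have := hz.1; have := hz.2.1; constructor <;> omega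
      · rw [hρ, rf_ne h]; have := hz.2.2 j h; omega
  have hUfin : U.Finite := by
    apply Set.Finite.subset (Set.finite_Icc (x - fun _ => (R:ℤ)) (x + fun _ => (R:ℤ)))
    intro z hz
    have := (hUc z hz).1
    constructor
    · intro j; have := abs_le.1 (this j); simp; omega
    · intro j; have := abs_le.1 (this j); simp; omega
  -- barrier
  set Ψ : V d → ℝ := fun z => M * (d * ((x i + 1 - z i : ℤ) : ℝ) / R +
     ((nsq (z - x) - ((z i - x i : ℤ) : ℝ) ^ 2) - (d - 1) * ((x i + 1 - z i : ℤ) : ℝ) ^ 2) / R ^ 2) with hΨ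
  have hΨharm : ∀ z, PP Ψ z = Ψ z := by
    intro z
    have e1 : ∀ k : Fin d, Ψ (z + ev k) + Ψ (z - ev k) = 2 * Ψ z + M * (if k = i then -2 * ((d:ℝ) - 1) else 2) / R ^ 2 := by
      intro k
      simp only [hΨ]
      rw [show z + ev k - x = (z - x) + ev k by abel, show z - ev k - x = (z - x) - ev k by abel,
        nsq_add_ev, nsq_sub_ev]
      by_cases h : k = i
      · subst h; simp [ev_apply]; field_simp; ring
      · simp [ev_apply, h, Ne.symm h]; field_simp; ring
    unfold PP
    rw [Finset.sum_congr rfl fun k _ => e1 k, Finset.sum_add_distrib, ← Finset.sum_div, ← Finset.mul_sum Finset.univ (fun k => if k = i then -2 * ((d:ℝ) - 1) else 2) M]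
    have : ∑ k : Fin d, (if k = i then -2 * ((d:ℝ) - 1) else 2) = 0 := by
      rw [Finset.sum_congr rfl (fun k _ => show (if k = i then -2 * ((d:ℝ) - 1) else 2) = 2 + (if k = i then -2 * (d:ℝ) else 0) by
        split_ifs <;> ring)]
      rw [Finset.sum_add_distrib]; simp; ring
    rw [this]; simp; field_simp
  have hother : ∀ z, 0 ≤ nsq (z - x) - ((z i - x i : ℤ) : ℝ) ^ 2 := by
    intro z; have := sq_le_nsq (z - x) i; simp at this ⊢; linarith
  have hother2 : ∀ z j, j ≠ i → ((z j - x j : ℤ) : ℝ) ^ 2 ≤ nsq (z - x) - ((z i - x i : ℤ) : ℝ) ^ 2 := by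
    intro z j hj
    have : ∑ k ∈ ({j, i} : Finset (Fin d)), (((z - x) k : ℤ) : ℝ) ^ 2 ≤ nsq (z - x) :=
      Finset.sum_le_sum_of_subset_of_nonneg (Finset.subset_univ _) fun k _ _ => sq_nonneg _
    rw [Finset.sum_pair hj] at this
    simp at this ⊢; linarith
  -- boundary
  have hbd : ∀ z, z ∉ U → x i + 1 - R ≤ z i → z i ≤ x i + 1 → (∀ j, j ≠ i → |z j - x j| ≤ R) → Dh z ≤ Ψ z := by
    intro z hz h1 h2 h3
    set ψ : ℝ := ((x i + 1 - z i : ℤ) : ℝ) with hψ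
    have hψ0 : 0 ≤ ψ := by rw [hψ]; exact_mod_cast (by omega : (0:ℤ) ≤ x i + 1 - z i)
    have hψR : ψ ≤ R := by rw [hψ]; exact_mod_cast (by omega : x i + 1 - z i ≤ R)
    have hψ2 : ψ ^ 2 / R ^ 2 ≤ ψ / R := by
      rw [div_le_div_iff₀ (by positivity) (by positivity)]; nlinarith [mul_nonneg hψ0 hR0.le, mul_nonneg (mul_nonneg hψ0 hR0.le) (sub_nonneg.2 hψR)]
    have hd1 : (1:ℝ) ≤ d := by exact_mod_cast (by omega : 1 ≤ d)
    have hψR1 : ψ / R ≤ 1 := by rw [div_le_one hR0]; exact hψR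
    have hψR0 : 0 ≤ ψ / R := by positivity
    have hΨe : Ψ z = M * (d * (ψ / R) + (nsq (z - x) - ((z i - x i : ℤ) : ℝ) ^ 2) / R ^ 2 - (d - 1) * (ψ ^ 2 / R ^ 2)) := by
      simp only [hΨ]; rw [← hψ]; ring
    have hq0 : 0 ≤ (nsq (z - x) - ((z i - x i : ℤ) : ℝ) ^ 2) / R ^ 2 := div_nonneg (hother z) (by positivity)
    by_cases hz0 : z i = x i + 1
    · have : Dh z = 0 := by simp only [hDh]; rw [if_neg (by omega)]
      rw [this, hΨe]
      apply mul_nonneg hM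
      nlinarith [mul_le_mul_of_nonneg_left hψ2 (by linarith : (0:ℝ) ≤ d - 1)]
    · have hDM : Dh z ≤ M := by
        simp only [hDh]; rw [if_pos (by omega)]
        apply max_le _ hM
        have hz1 : z ∈ cube x R := by
          intro j
          by_cases h : j = i
          · subst h; rw [abs_le]; constructor <;> omega
          · exact h3 j h
        have hz2 : ρ z ∈ cube x R := by
          intro j
          by_cases h : j = i
          · subst h; rw [hρ, rf_same, abs_le]; constructor <;> omega
          · rw [hρ, rf_ne h]; exact h3 j h
        simp only [hD]
        linarith [(hb z hz1).2, (hb _ hz2).1]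
      refine hDM.trans ?_
      rw [hΨe]
      apply le_mul_of_one_le_right hM
      by_cases hzR : z i = x i + 1 - R
      · have : ψ = R := by rw [hψ, hzR]; push_cast; ring
        rw [this, div_self hR0.ne', div_self (by positivity)]; linarith
      · have : ∃ j, j ≠ i ∧ (R:ℤ) ≤ |z j - x j| := by
          by_contra! hcon
          exact hz ⟨by omega, by omega, fun j hj => by have := hcon j hj; omega⟩
        obtain ⟨j, hj, hjR⟩ := this
        have h4 := hother2 z j hj
        have h5 : (R:ℝ) ^ 2 ≤ ((z j - x j : ℤ) : ℝ) ^ 2 := by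
          rw [← sq_abs ((z j - x j : ℤ) : ℝ)]
          apply pow_le_pow_left₀ hR0.le; exact_mod_cast hjR
        have h6 : 1 ≤ (nsq (z - x) - ((z i - x i : ℤ) : ℝ) ^ 2) / R ^ 2 := by
          rw [one_le_div (by positivity)]; linarith
        nlinarith [mul_le_mul_of_nonneg_left hψ2 (by linarith : (0:ℝ) ≤ d - 1)]
  have hmain := maxp hd U hUfin (fun z => Dh z - Ψ z) ?_ ?_ x ?_
  · have hx1 : ρ x = x + ev i := by
      ext j; by_cases h : j = i
      · subst h; rw [hρ, rf_same]; simp [ev_apply]; omega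
      · rw [hρ, rf_ne h]; simp [ev_apply, h]
    have h1 : D x ≤ Dh x := by simp only [hDh]; rw [if_pos le_rfl]; exact le_max_left _ _
    have h2 : Ψ x ≤ d * M / R := by
      have hd1 : (1:ℝ) ≤ d := by exact_mod_cast (by omega : 1 ≤ d)
      simp only [hΨ]; simp [nsq]
      have : (1 - (d:ℝ)) / R ^ 2 ≤ 0 := div_nonpos_of_nonpos_of_nonneg (by linarith) (by positivity)
      have e : (d:ℝ) * M / R = M * (d / R) := by ring
      rw [e]; apply mul_le_mul_of_nonneg_left _ hM; linarith
    simp only [hD, hx1] at h1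
    linarith
  · intro z hz
    have hDharm : PP D z = D z := by
      rw [hD, PP_sub, PP_rf, ← hharm z (hUc z hz).1, ← hharm (rf i c z) (hUc z hz).2]
    rw [PP_sub, hΨharm]
    have : Dh z ≤ PP Dh z := by
      by_cases hneg : D z ≤ 0
      · have : Dh z = 0 := by
          simp only [hDh]; rw [if_pos hz.2.1, max_eq_right hneg]
        rw [this]; exact PP_nonneg hDhn z
      · have h1 : Dh z = D z := by
          simp only [hDh]; rw [if_pos hz.2.1, max_eq_left (not_le.1 hneg).le]
        rw [h1, ← hDharm]
        have hle : ∀ y, y i ≤ x i → D y ≤ Dh y := by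
          intro y hy; simp only [hDh]; rw [if_pos hy]; exact le_max_left _ _
        apply PP_mono_at
        intro k
        constructor
        · by_cases hk : (z + ev k) i ≤ x i
          · exact hle _ hk
          · have hki : k = i := by
              by_contra h
              apply hk; simp [ev_apply, Ne.symm h]; exact hz.2.1
            subst hki
            have hzi : z k = x k := by simp [ev_apply] at hk; have := hz.2.1; omega
            have : ρ z = z + ev k := by
              ext j; by_cases h : j = k
              · subst h; rw [hρ, rf_same]; simp [ev_apply]; omega
              · rw [hρ, rf_ne h]; simp [ev_apply, h]
            have e : D (z + ev k) = - D z := by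
              simp only [hD]
              have e2 : ρ (z + ev k) = z := by rw [← this, hρ, rf_rf]
              rw [e2, this]; ring
            rw [e]; have := hDhn (z + ev k); linarith [not_le.1 hneg]
        · apply hle
          have : (0:ℤ) ≤ ev k i := by rw [ev_apply]; split_ifs <;> norm_num
          have := hz.2.1
          simp; omega
    linarith
  · intro z hz k
    have hev : ∀ j, |(ev k : V d) j| ≤ 1 := by intro j; rw [ev_apply]; split_ifs <;> simp
    have a1 := hz.1
    have a2 := hz.2.1
    constructor
    · intro hn
      have := hbd _ hn ?_ ?_ ?_
      · linarith
      · have := abs_le.1 (hev i); simp; omega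
      · have := abs_le.1 (hev i); simp; omega
      · intro j hj; have := abs_le.1 (hev j); have b := abs_le.1 (hz.2.2 j hj); rw [abs_le]; simp; omega
    · intro hn
      have := hbd _ hn ?_ ?_ ?_
      · linarith
      · have := abs_le.1 (hev i); simp; omega
      · have : (0:ℤ) ≤ ev k i := by rw [ev_apply]; split_ifs <;> norm_num
        simp; omega
      · intro j hj; have := abs_le.1 (hev j); have b := abs_le.1 (hz.2.2 j hj); rw [abs_le]; simp; omega
  · exact ⟨by omega, le_rfl, fun j hj => by simp; omega⟩

lemma grad_est (hd : 5 ≤ d) (f : V d → ℝ) (x : V d) (R : ℕ) (hR : 2 ≤ R) (M : ℝ)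
    (hharm : ∀ z ∈ cube x R, f z = PP f z) (hb : ∀ z ∈ cube x R, 0 ≤ f z ∧ f z ≤ M) (i : Fin d) :
    |f x - f (x + ev i)| ≤ d * M / R := by
  rw [abs_le]
  constructor
  · have := grad_one hd (fun z => M - f z) x R hR M ?_ ?_ i
    · linarith
    · intro z hz; rw [PP_sub, PP_const hd, ← hharm z hz]
    · intro z hz; have := hb z hz; constructor <;> linarith
  · exact grad_one hd f x R hR M hharm hb i

def l1 (x : V d) : ℕ := ∑ i, (x i).natAbs

lemma l1_zero {x : V d} (h : l1 x = 0) : x = 0 := by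
  ext i
  have := (Finset.sum_eq_zero_iff.1 h) i (Finset.mem_univ i)
  simpa using this

lemma l1_add_ev {x : V d} {i : Fin d} (h : x i < 0) : l1 (x + ev i) + 1 = l1 x := by
  unfold l1
  rw [← Finset.add_sum_erase _ _ (Finset.mem_univ i),
    ← Finset.add_sum_erase Finset.univ (fun j => (x j).natAbs) (Finset.mem_univ i)]
  have : ∑ j ∈ Finset.univ.erase i, ((x + ev i) j).natAbs = ∑ j ∈ Finset.univ.erase i, (x j).natAbs :=
    Finset.sum_congr rfl fun j hj => by simp [ev_apply, Finset.ne_of_mem_erase hj]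
  rw [this]; simp [ev_apply]; omega

lemma l1_sub_ev {x : V d} {i : Fin d} (h : 0 < x i) : l1 (x - ev i) + 1 = l1 x := by
  unfold l1
  rw [← Finset.add_sum_erase _ _ (Finset.mem_univ i),
    ← Finset.add_sum_erase Finset.univ (fun j => (x j).natAbs) (Finset.mem_univ i)]
  have : ∑ j ∈ Finset.univ.erase i, ((x - ev i) j).natAbs = ∑ j ∈ Finset.univ.erase i, (x j).natAbs :=
    Finset.sum_congr rfl fun j hj => by simp [ev_apply, Finset.ne_of_mem_erase hj]
  rw [this]; simp [ev_apply]; omega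

/-- from `z ≠ x` one can step closer -/
lemma step_closer {x z : V d} {n : ℕ} (h : l1 (z - x) = n + 1) :
    ∃ i, (z i < x i ∧ l1 (z + ev i - x) = n) ∨ (x i < z i ∧ l1 (z - ev i - x) = n) := by
  have : ∃ i, (z - x) i ≠ 0 := by
    by_contra! hc
    have : l1 (z - x) = 0 := Finset.sum_eq_zero fun i _ => by simp [hc i]
    omega
  obtain ⟨i, hi⟩ := this
  refine ⟨i, ?_⟩
  rcases lt_or_gt_of_ne hi with h1 | h1
  · left; have := l1_add_ev h1
    refine ⟨by simpa using h1, ?_⟩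
    rw [show z + ev i - x = z - x + ev i by abel]; omega
  · right; have := l1_sub_ev h1
    refine ⟨by simpa using h1, ?_⟩
    rw [show z - ev i - x = z - x - ev i by abel]; omega

lemma trivial_harnack (hd : 5 ≤ d) (f : V d → ℝ) (hf : ∀ x, 0 ≤ f x) (x : V d) (n : ℕ) :
    ∀ z, l1 (z - x) = n → (∀ y, l1 (y - x) ≤ n → PP f y ≤ f y) → f x ≤ (2 * d) ^ n * f z := by
  induction n with
  | zero => intro z hz _; rw [sub_eq_zero.1 (l1_zero hz)]; simp
  | succ n ih =>
    intro z hz hs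
    obtain ⟨i, h | h⟩ := step_closer hz
    · have h1 := ih _ h.2 (fun y hy => hs y (by omega))
      have h2 := (PP_ge_nbr hd hf z i).1
      have h3 := hs z (by omega)
      calc f x ≤ (2 * d) ^ n * f (z + ev i) := h1
        _ ≤ (2 * d) ^ n * (2 * d * f z) := by gcongr; exact h2.trans (by gcongr)
        _ = _ := by ring
    · have h1 := ih _ h.2 (fun y hy => hs y (by omega))
      have h2 := (PP_ge_nbr hd hf z i).2
      have h3 := hs z (by omega)
      calc f x ≤ (2 * d) ^ n * f (z - ev i) := h1
        _ ≤ (2 * d) ^ n * (2 * d * f z) := by gcongr; exact h2.trans (by gcongr)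
        _ = _ := by ring

lemma l1_le_of_nrm (x : V d) : (l1 x : ℝ) ≤ d * nrm x := by
  unfold l1
  push_cast
  calc ∑ i, (((x i).natAbs : ℕ) : ℝ) ≤ ∑ i : Fin d, nrm x := Finset.sum_le_sum fun i _ => by
        have := abs_le_nrm x i
        rw [Nat.cast_natAbs]; simpa using this
    _ = _ := by simp

lemma abs_le_l1 (x : V d) (i : Fin d) : |x i| ≤ l1 x := by
  unfold l1
  have : (x i).natAbs ≤ ∑ i, (x i).natAbs :=
    Finset.single_le_sum (f := fun i => (x i).natAbs) (fun i _ => Nat.zero_le _) (Finset.mem_univ i)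
  rw [Int.abs_eq_natAbs]; exact_mod_cast this

lemma nrm_le_l1 (hd : 5 ≤ d) (x : V d) : nrm x ≤ d * l1 x := by
  apply nrm_le_of_abs hd x (by positivity)
  intro i; exact_mod_cast abs_le_l1 x i

lemma lip_cube (f : V d → ℝ) (x : V d) (s : ℕ) (δ : ℝ)
    (h : ∀ y ∈ cube x s, ∀ i, y + ev i ∈ cube x s → |f y - f (y + ev i)| ≤ δ) (n : ℕ) :
    ∀ z ∈ cube x s, l1 (z - x) = n → |f z - f x| ≤ n * δ := by
  induction n with
  | zero => intro z _ hz; rw [sub_eq_zero.1 (l1_zero hz)]; simp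
  | succ n ih =>
    intro z hz hn
    obtain ⟨i, hc | hc⟩ := step_closer hn
    · have hz' : z + ev i ∈ cube x s := by
        intro j
        have := abs_le.1 (hz j)
        by_cases hj : j = i
        · subst hj; simp [ev_apply, abs_le]; omega
        · simp [ev_apply, hj]; exact hz j
      have h1 := ih _ hz' hc.2
      have h2 := h z hz i hz'
      have h3 := abs_add_le (f z - f (z + ev i)) (f (z + ev i) - f x)
      simp at h3; push_cast; linarith
    · have hz' : z - ev i ∈ cube x s := by
        intro j
        have := abs_le.1 (hz j)
        by_cases hj : j = i
        · subst hj; simp [ev_apply, abs_le]; omega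
        · simp [ev_apply, hj]; exact hz j
      have h1 := ih _ hz' hc.2
      have h2 := h _ hz' i (by simpa using hz)
      rw [sub_add_cancel, abs_sub_comm] at h2
      have h3 := abs_add_le (f z - f (z - ev i)) (f (z - ev i) - f x)
      simp at h3; push_cast; linarith

noncomputable def cB (d : ℕ) : ℝ := (Real.exp (-(4 * d : ℝ)) - Real.exp (-(16 * d : ℝ)))⁻¹

lemma cB_pos (hd : 5 ≤ d) : 0 < cB d := by
  have h0 : (0:ℝ) < d := by exact_mod_cast (by omega : 0 < d)
  unfold cB; apply inv_pos.2; rw [sub_pos]; apply Real.exp_lt_exp.2; linarith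

lemma cB_ge (hd : 5 ≤ d) : 1 ≤ cB d := by
  have h0 : (0:ℝ) < d := by exact_mod_cast (by omega : 0 < d)
  have h1 : 0 < Real.exp (-(4 * d : ℝ)) - Real.exp (-(16 * d : ℝ)) := by
    rw [sub_pos]; apply Real.exp_lt_exp.2; linarith
  unfold cB
  rw [one_le_inv₀ h1]
  have : Real.exp (-(4 * d : ℝ)) ≤ 1 := by rw [Real.exp_le_one_iff]; linarith
  have := Real.exp_pos (-(16 * d : ℝ))
  linarith

lemma doubling (hd : 5 ≤ d) (f : V d → ℝ) (hf : ∀ x, 0 ≤ f x) (w : V d) (s m0 : ℝ) (hs : 2 * d ≤ s ^ 2)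
    (hs0 : 0 < s) (hm0 : 0 ≤ m0) (hin : ∀ x, nrm (x - w) ≤ s → m0 ≤ f x)
    (hsup : ∀ x, nrm (x - w) ≤ 4 * s → PP f x ≤ f x) (x : V d) (hx : nrm (x - w) ≤ 2 * s) :
    m0 / cB d ≤ f x := by
  have h0 : (0:ℝ) < d := by exact_mod_cast (by omega : 0 < d)
  have hx' := (nrm_le_iff _ (by positivity)).1 hx
  have := gauss_lower hd (β := d / s ^ 2) (by positivity) ?_ w (16 * s ^ 2) m0 hm0 f hf ?_ ?_ x ?_
  · refine le_trans ?_ this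
    unfold cB
    rw [div_inv_eq_mul]
    gcongr
    · have : d / s ^ 2 * nsq (x - w) ≤ d / s ^ 2 * (2 * s) ^ 2 := by gcongr
      have e : d / s ^ 2 * (2 * s) ^ 2 = 4 * d := by field_simp; ring
      linarith
    · have e : d / s ^ 2 * (16 * s ^ 2) = 16 * d := by field_simp
      linarith
  · rw [div_le_iff₀ (by positivity)]; linarith
  · intro y hy; apply hsup; rw [nrm_le_iff _ (by positivity)]; linarith
  · intro y hy; apply hin; rw [nrm_le_iff _ hs0.le]
    rwa [div_div_cancel₀ h0.ne'] at hy
  · have : 0 < s ^ 2 := by positivity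
    linarith

lemma doubling_iter (hd : 5 ≤ d) (f : V d → ℝ) (hf : ∀ x, 0 ≤ f x) (w : V d) (s m0 : ℝ) (hs : 2 * d ≤ s ^ 2)
    (hs0 : 0 < s) (hm0 : 0 ≤ m0) (hin : ∀ x, nrm (x - w) ≤ s → m0 ≤ f x) (k : ℕ)
    (hsup : ∀ x, nrm (x - w) ≤ 2 * (2 ^ k * s) → PP f x ≤ f x) (x : V d) (hx : nrm (x - w) ≤ 2 ^ k * s) :
    m0 / cB d ^ k ≤ f x := by
  have hB := cB_pos hd
  induction k generalizing x with
  | zero => simpa using hin x (by simpa using hx)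
  | succ k ih =>
    have h1 : (1:ℝ) ≤ 2 ^ k := one_le_pow₀ (by norm_num)
    have := doubling hd f hf w (2 ^ k * s) (m0 / cB d ^ k) ?_ (by positivity) (by positivity) ?_ ?_ x ?_
    · refine le_trans (le_of_eq ?_) this
      rw [pow_succ, div_div]
    · have : (1:ℝ) ≤ (2 ^ k) ^ 2 := one_le_pow₀ h1
      rw [mul_pow]; nlinarith
    · intro y hy
      refine ih (fun z hz => hsup z (hz.trans ?_)) y hy
      rw [pow_succ]; nlinarith [mul_pos (by positivity : (0:ℝ) < 2 ^ k) hs0]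
    · intro y hy
      exact hsup y (hy.trans (le_of_eq (by rw [pow_succ]; ring)))
    · exact hx.trans (le_of_eq (by rw [pow_succ]; ring))

noncomputable def cC1 (d : ℕ) : ℝ := d * (2 * cB d * d ^ 2 + 2)

lemma harnack_core (hd : 5 ≤ d) (f : V d → ℝ) (hf : ∀ x, 0 ≤ f x) (y : V d) (r s C : ℝ) (K L : ℕ)
    (hs : 2 * d ≤ s ^ 2) (hs0 : 0 < s) (hK : 2 * r = 2 ^ K * s) (hr : s ≤ 2 * r) (hL : d * s ≤ L)
    (hC : 2 ≤ C) (hCL : (2 * d : ℝ) ^ L ≤ C)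
    (hharm : ∀ x, nrm (x - y) ≤ (6 + 2 * d ^ 2) * r → f x = PP f x) (k : ℕ) : k ≤ K →
    ∀ x, nrm (x - y) ≤ 2 * r - 2 * cC1 d * (2 ^ k * s) → f x ≤ C * cB d ^ (K - k) * f y := by
  have h0 : (0:ℝ) < d := by exact_mod_cast (by omega : 0 < d)
  have hd5 : (5:ℝ) ≤ d := by exact_mod_cast hd
  have hB := cB_pos hd
  have hB1 := cB_ge hd
  have hs1 : 1 ≤ s := by nlinarith
  have hr0 : 0 < r := by linarith
  have hC1 : 0 < cC1 d := by unfold cC1; positivity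
  have hdr : 0 ≤ (d:ℝ) ^ 2 * r := by positivity
  have hmin : ∀ (x : V d) (j : ℕ), j ≤ K → nrm (x - y) ≤ 2 * r → ∃ z, nrm (z - x) ≤ 2 ^ j * s ∧
      f z ≤ cB d ^ (K - j) * f y := by
    intro x j hj hx
    have hfin : {z : V d | nrm (z - x) ≤ 2 ^ j * s}.Finite := by
      apply (nsq_ball_finite x ((2 ^ j * s) ^ 2)).subset
      intro z hz; exact (nrm_le_iff _ (by positivity)).1 hz
    obtain ⟨z, hz, hzm⟩ := Set.exists_min_image _ f hfin ⟨x, by simp [nrm, nsq]; positivity⟩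
    refine ⟨z, hz, ?_⟩
    have h1j : (1:ℝ) ≤ 2 ^ j := one_le_pow₀ (by norm_num)
    have e : (2:ℝ) ^ (K - j) * (2 ^ j * s) = 2 * r := by
      rw [hK, ← mul_assoc, ← pow_add, Nat.sub_add_cancel hj]
    have := doubling_iter hd f hf x (2 ^ j * s) (f z) (by
      have : (1:ℝ) ≤ (2 ^ j) ^ 2 := one_le_pow₀ h1j
      rw [mul_pow]; nlinarith) (by positivity) (hf z) hzm (K - j) ?_ y ?_
    · rwa [div_le_iff₀ (by positivity), mul_comm] at this
    · intro u hu
      rw [e] at hu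
      refine (hharm u ?_).ge
      have := nrm_tri u x y
      linarith
    · rw [e, nrm_sub_comm]; exact hx
  induction k with
  | zero =>
    intro _ x hx
    simp only [pow_zero, one_mul, Nat.sub_zero] at hx ⊢
    have hC1s : 0 ≤ cC1 d * s := by positivity
    obtain ⟨z, hz, hzm⟩ := hmin x 0 (Nat.zero_le _) (by linarith)
    simp only [pow_zero, one_mul, Nat.sub_zero] at hz hzm
    have hl := l1_le_of_nrm (z - x)
    have hl2 : (l1 (z - x) : ℝ) ≤ d * s := hl.trans (by gcongr)
    have h1 := trivial_harnack hd f hf x _ z rfl (fun u hu => by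
      refine (hharm u ?_).ge
      have h2 := nrm_le_l1 hd (u - x)
      have h3 : (l1 (u - x) : ℝ) ≤ d * s := le_trans (by exact_mod_cast hu) hl2
      have h4 := nrm_tri u x y
      have h5 : d * (l1 (u - x) : ℝ) ≤ d * (d * (2 * r)) := by gcongr; exact h3.trans (by gcongr)
      nlinarith)
    have h6 : (2 * d : ℝ) ^ l1 (z - x) ≤ C := by
      refine le_trans (pow_le_pow_right₀ (by linarith) ?_) hCL
      exact_mod_cast hl2.trans hL
    calc f x ≤ _ := h1
      _ ≤ C * (cB d ^ K * f y) := by gcongr; exact hf z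
      _ = _ := by ring
  | succ k ih =>
    intro hk x hx
    have ih := ih (by omega)
    set s' : ℝ := 2 ^ (k + 1) * s with hs'
    have hss : s' = 2 * (2 ^ k * s) := by rw [hs', pow_succ]; ring
    have hs's : s ≤ s' := by
      have : (1:ℝ) ≤ 2 ^ (k+1) := one_le_pow₀ (by norm_num)
      rw [hs']; nlinarith
    have hs'1 : 1 ≤ s' := hs1.trans hs's
    have hs'0 : 0 < s' := by linarith
    have hC1s : 0 ≤ cC1 d * s' := by positivity
    obtain ⟨z, hz, hzm⟩ := hmin x (k + 1) hk (by linarith)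
    rw [← hs'] at hz
    set M := C * cB d ^ (K - k) * f y with hM
    set R' : ℕ := ⌈2 * cB d * d ^ 2 * s'⌉₊ with hR'
    set S : ℕ := ⌊s'⌋₊ with hS
    have hR'1 : 2 * cB d * d ^ 2 * s' ≤ R' := Nat.le_ceil _
    have hR'2 : (R':ℝ) ≤ 2 * cB d * d ^ 2 * s' + 1 := (Nat.ceil_lt_add_one (by positivity)).le
    have hSs : (S:ℝ) ≤ s' := Nat.floor_le hs'0.le
    have hbig : 50 ≤ 2 * cB d * d ^ 2 * s' := by
      have a1 : (25:ℝ) ≤ (d:ℝ) ^ 2 := by nlinarith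
      have a2 : (25:ℝ) ≤ cB d * d ^ 2 := by nlinarith
      nlinarith
    have hR'3 : 2 ≤ R' := by
      have : (2:ℝ) ≤ R' := by linarith
      exact_mod_cast this
    have hcubeN : ∀ u ∈ cube x (R' + S), nrm (u - y) ≤ 2 * r - 2 * cC1 d * (2 ^ k * s) := by
      intro u hu
      have h1 : nrm (u - x) ≤ d * ((R' + S : ℕ) : ℝ) := by
        apply nrm_le_of_abs hd _ (by positivity)
        intro i
        exact_mod_cast hu i
      have h2 : d * ((R' + S : ℕ) : ℝ) ≤ cC1 d * s' := by
        unfold cC1; rw [mul_assoc]; gcongr; push_cast; nlinarith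
      have h3 := nrm_tri u x y
      rw [hss] at h2 hx
      linarith
    have hMn : 0 ≤ M := by rw [hM]; have := hf y; positivity
    have hgrad : ∀ u ∈ cube x S, ∀ i, u + ev i ∈ cube x S → |f u - f (u + ev i)| ≤ d * M / R' := by
      intro u hu i _
      have hsub : ∀ w ∈ cube u R', w ∈ cube x (R' + S) := by
        intro w hw j
        have h1 := abs_le.1 (hu j); have h2 := abs_le.1 (hw j); rw [abs_le]; push_cast; omega
      refine grad_est hd f u R' hR'3 M (fun w hw => ?_) (fun w hw => ⟨hf w, ?_⟩) i
      · apply hharm; have := hcubeN w (hsub w hw)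
        have : 0 ≤ cC1 d * (2 ^ k * s) := by positivity
        linarith
      · exact ih w (hcubeN w (hsub w hw))
    have hzc : z ∈ cube x S := by
      intro i
      have h1 := (abs_le_nrm (z - x) i).trans hz
      have h2 : ((z i - x i).natAbs : ℝ) ≤ s' := by rw [Nat.cast_natAbs]; simpa using h1
      have h3 := Nat.le_floor h2
      rw [Int.abs_eq_natAbs]; exact_mod_cast h3
    have h1 := lip_cube f x S _ hgrad _ z hzc rfl
    have hl : (l1 (z - x) : ℝ) ≤ d * s' := (l1_le_of_nrm (z - x)).trans (by gcongr)
    have hR'0 : (0:ℝ) < R' := by linarith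
    have h2 : (l1 (z - x) : ℝ) * (d * M / R') ≤ M / (2 * cB d) := by
      calc (l1 (z - x) : ℝ) * (d * M / R') ≤ d * s' * (d * M / (2 * cB d * d ^ 2 * s')) := by gcongr
        _ = _ := by field_simp
    have h3 : M / (2 * cB d) = C / 2 * (cB d ^ (K - (k + 1)) * f y) := by
      rw [hM, show K - k = K - (k + 1) + 1 by omega, pow_succ]; field_simp
    have h4 := (abs_le.1 h1).1
    have h5 : 0 ≤ cB d ^ (K - (k + 1)) * f y := by have := hf y; positivity
    rw [mul_assoc]
    rw [h3] at h2
    have h6 := mul_nonneg (by linarith : (0:ℝ) ≤ C / 2 - 1) h5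
    clear_value M R' S s'
    generalize cB d ^ (K - (k + 1)) * f y = q at *
    linarith

theorem harnack (hd : 5 ≤ d) : ∃ C Λ : ℝ, 1 ≤ C ∧ 6 ≤ Λ ∧ ∀ f : V d → ℝ, (∀ x, 0 ≤ f x) →
    ∀ (y : V d) (r : ℝ), 1 ≤ r → (∀ x, nrm (x - y) ≤ Λ * r → f x = PP f x) →
    ∀ x, nrm (x - y) ≤ r → f x ≤ C * f y := by
  have h0 : (0:ℝ) < d := by exact_mod_cast (by omega : 0 < d)
  have hd5 : (5:ℝ) ≤ d := by exact_mod_cast hd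
  have hB := cB_pos hd
  have hB1 := cB_ge hd
  have hC1 : 0 < cC1 d := by unfold cC1; positivity
  obtain ⟨k0, hk0⟩ := pow_unbounded_of_one_lt (4 * cC1 d) (by norm_num : (1:ℝ) < 2)
  set s0 : ℝ := Real.sqrt (2 * d) with hs0
  have hs0p : 0 < s0 := Real.sqrt_pos.2 (by positivity)
  have hs0sq : s0 ^ 2 = 2 * d := Real.sq_sqrt (by positivity)
  set L : ℕ := ⌈d * (2 * s0)⌉₊ with hL
  set L2 : ℕ := ⌈d * (2 ^ k0 * (2 * s0))⌉₊ with hL2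
  refine ⟨(2 + (2 * d) ^ L) * cB d ^ k0 + (2 * d) ^ L2, 6 + 2 * d ^ 2, ?_, by nlinarith, ?_⟩
  · have h1 : 1 ≤ cB d ^ k0 := one_le_pow₀ hB1
    have h2 : (0:ℝ) ≤ (2 * d) ^ L2 := by positivity
    have h3 : (0:ℝ) ≤ (2 * d) ^ L := by positivity
    nlinarith
  · intro f hf y r hr hharm x hx
    have hy := hf y
    by_cases hsmall : r ≤ 2 ^ k0 * (2 * s0)
    · have hl : (l1 (y - x) : ℝ) ≤ d * r := (l1_le_of_nrm _).trans (by gcongr; rwa [nrm_sub_comm])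
      have h1 := trivial_harnack hd f hf x _ y rfl (fun u hu => by
        refine (hharm u ?_).ge
        have h2 := nrm_le_l1 hd (u - x)
        have h3 : (l1 (u - x) : ℝ) ≤ d * r := le_trans (by exact_mod_cast hu) hl
        have h4 := nrm_tri u x y
        have h5 : d * (l1 (u - x) : ℝ) ≤ d * (d * r) := by gcongr
        nlinarith)
      have h6 : (2 * d : ℝ) ^ l1 (y - x) ≤ (2 * d) ^ L2 := by
        apply pow_le_pow_right₀ (by linarith)
        have : (l1 (y - x) : ℝ) ≤ L2 := hl.trans (le_trans (by gcongr) (Nat.le_ceil _))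
        exact_mod_cast this
      refine h1.trans ?_
      gcongr
      have : (0:ℝ) ≤ (2 + (2 * d) ^ L) * cB d ^ k0 := by positivity
      linarith
    · push Not at hsmall
      have h2k : (1:ℝ) ≤ 2 ^ k0 := one_le_pow₀ (by norm_num)
      have hge : 1 ≤ 2 * r / s0 := by
        rw [one_le_div hs0p]; nlinarith
      obtain ⟨K, hK1, hK2⟩ := exists_nat_pow_near hge (by norm_num : (1:ℝ) < 2)
      rw [le_div_iff₀ hs0p] at hK1
      rw [div_lt_iff₀ hs0p] at hK2
      have hkK : k0 ≤ K := by
        by_contra hcon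
        have h3 : (2:ℝ) ^ (K + 1) ≤ 2 ^ k0 := pow_le_pow_right₀ (by norm_num) (by omega)
        nlinarith
      set s : ℝ := 2 * r / 2 ^ K with hs
      have hKs : 2 * r = 2 ^ K * s := by rw [hs]; field_simp
      have hss0 : s0 ≤ s := by rw [hs, le_div_iff₀ (by positivity)]; linarith
      have hss1 : s ≤ 2 * s0 := by
        rw [hs, div_le_iff₀ (by positivity)]; rw [pow_succ] at hK2; linarith
      have hsp : 0 < s := by linarith
      have hsr : s ≤ 2 * r := by
        rw [hKs]; exact le_mul_of_one_le_left hsp.le (one_le_pow₀ (by norm_num))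
      have := harnack_core hd f hf y r s (2 + (2 * d) ^ L) K L (by rw [← hs0sq]; gcongr) hsp hKs hsr
        (le_trans (by gcongr) (Nat.le_ceil _)) (by have : (0:ℝ) ≤ (2 * d) ^ L := by positivity
                                                   linarith) (by linarith) hharm (K - k0) (by omega) x ?_
      · rw [show K - (K - k0) = k0 by omega] at this
        refine this.trans ?_
        gcongr
        have : (0:ℝ) ≤ (2 * d) ^ L2 := by positivity
        linarith
      · have h5 : (2:ℝ) ^ k0 * (2 ^ (K - k0) * s) = 2 * r := by
          rw [hKs, ← mul_assoc, ← pow_add, Nat.add_sub_cancel' hkK]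
        have h6 : 0 < 2 ^ (K - k0) * s := by positivity
        nlinarith

lemma quart_lo {u q : ℝ} (hu : 0 < u) (hq : u ^ 4 = 1 + q) (h : |q| ≤ 0.02) : 0.99 ≤ u := by
  by_contra hc
  push Not at hc
  have : u ^ 4 < 0.99 ^ 4 := pow_lt_pow_left₀ hc hu.le (by norm_num)
  have := (abs_le.1 h).1
  norm_num at *; linarith

lemma poly1 {u : ℝ} (hu : 0.99 ≤ u) : 1 ≤ u * (1 - (u ^ 4 - 1) / 4 + 0.3 * (u ^ 4 - 1) ^ 2) := by
  have h : u * (1 - (u ^ 4 - 1) / 4 + 0.3 * (u ^ 4 - 1) ^ 2) - 1 = (u - 1) ^ 2 *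
    (3/10*u^7 + 3/5*u^6 + 9/10*u^5+6/5*u^4+13/20*u^3+1/10*u^2-9/20*u-1) := by ring
  have h2 : 0 ≤ (3/10*u^7 + 3/5*u^6 + 9/10*u^5+6/5*u^4+13/20*u^3+1/10*u^2-9/20*u-1) := by
    obtain ⟨s, hs, rfl⟩ : ∃ s : ℝ, 0 ≤ s ∧ u = 0.99 + s := ⟨u - 0.99, by linarith, by ring⟩
    ring_nf; positivity
  nlinarith [mul_nonneg (sq_nonneg (u - 1)) h2]

lemma poly5 {u : ℝ} (hu : 0.99 ≤ u) : 1 ≤ u ^ 5 * (1 - 5 / 4 * (u ^ 4 - 1) + 1.5 * (u ^ 4 - 1) ^ 2) := by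
  have h : u ^ 5 * (1 - 5 / 4 * (u ^ 4 - 1) + 1.5 * (u ^ 4 - 1) ^ 2) - 1 = (u - 1) ^ 2 *
    (3/2*u^11+3*u^10+9/2*u^9+6*u^8+13/4*u^7+1/2*u^6-9/4*u^5-5*u^4-4*u^3-3*u^2-2*u-1) := by ring
  have h2 : 0 ≤ (3/2*u^11+3*u^10+9/2*u^9+6*u^8+13/4*u^7+1/2*u^6-9/4*u^5-5*u^4-4*u^3-3*u^2-2*u-1) := by
    obtain ⟨s, hs, rfl⟩ : ∃ s : ℝ, 0 ≤ s ∧ u = 0.99 + s := ⟨u - 0.99, by linarith, by ring⟩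
    ring_nf; positivity
  nlinarith [mul_nonneg (sq_nonneg (u - 1)) h2]

lemma inv_up {a b q : ℝ} (ha : 0 < a) (hb : 0 < b) (hq : b ^ 4 = a ^ 4 * (1 + q)) (h : |q| ≤ 0.02) :
    1 / b ≤ 1 / a * (1 - q / 4 + 0.3 * q ^ 2) ∧ 1 / b ^ 5 ≤ 1 / a ^ 5 * (1 - 5 / 4 * q + 1.5 * q ^ 2) := by
  obtain ⟨u, hu, rfl⟩ : ∃ u : ℝ, 0 < u ∧ b = a * u := ⟨b / a, by positivity, by field_simp⟩
  have hq' : u ^ 4 = 1 + q := by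
    rw [mul_pow] at hq; exact mul_left_cancel₀ (by positivity) hq
  have hu9 := quart_lo hu hq' h
  have e : q = u ^ 4 - 1 := by linarith
  have h1 := poly1 hu9
  have h5 := poly5 hu9
  rw [e]
  constructor
  · rw [one_div_mul_eq_div, div_le_div_iff₀ (by positivity) ha]
    nlinarith
  · rw [one_div_mul_eq_div, div_le_div_iff₀ (by positivity) (by positivity), mul_pow]
    have := mul_le_mul_of_nonneg_left h5 (by positivity : 0 ≤ a ^ 5)
    linarith

lemma inv_lo {a b q : ℝ} (ha : 0 < a) (hb : 0 < b) (hq : b ^ 4 = a ^ 4 * (1 - q)) (hq0 : 0 ≤ q) (h : q ≤ 0.02) :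
    1 / a * (1 + q / 4) ≤ 1 / b ∧ 1 / a ^ 5 * (1 + 5 / 4 * q) ≤ 1 / b ^ 5 ∧ 1 / b ^ 5 ≤ 2 * (1 / a ^ 5) := by
  obtain ⟨u, hu, rfl⟩ : ∃ u : ℝ, 0 < u ∧ b = a * u := ⟨b / a, by positivity, by field_simp⟩
  have hq' : u ^ 4 = 1 + -q := by
    rw [mul_pow] at hq; exact mul_left_cancel₀ (by positivity) hq
  have hu9 := quart_lo hu hq' (by rw [abs_neg, abs_of_nonneg hq0]; exact h)
  have e : q = 1 - u ^ 4 := by linarith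
  rw [e]
  refine ⟨?_, ?_, ?_⟩
  · rw [one_div_mul_eq_div, div_le_div_iff₀ ha (by positivity)]
    have : 0 ≤ (u - 1) ^ 2 * (u ^ 3 + 2 * u ^ 2 + 3 * u + 4) := by positivity
    have h2 : u * (1 + (1 - u ^ 4) / 4) ≤ 1 := by nlinarith
    nlinarith
  · rw [one_div_mul_eq_div, div_le_div_iff₀ (by positivity) (by positivity), mul_pow]
    have : 0 ≤ (u - 1) ^ 2 * (5*u^7+10*u^6+15*u^5+20*u^4+16*u^3+12*u^2+8*u+4) := by positivity
    have h2 : u ^ 5 * (1 + 5 / 4 * (1 - u ^ 4)) ≤ 1 := by nlinarith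
    have := mul_le_mul_of_nonneg_left h2 (by positivity : 0 ≤ a ^ 5)
    linarith
  · rw [mul_one_div, div_le_div_iff₀ (by positivity) (by positivity), mul_pow]
    have h3 : (0.99:ℝ) ^ 5 ≤ u ^ 5 := pow_le_pow_left₀ (by norm_num) hu9 5
    have h2 : 1 ≤ 2 * u ^ 5 := by norm_num at h3; linarith
    have := mul_le_mul_of_nonneg_left h2 (by positivity : 0 ≤ a ^ 5)
    linarith

noncomputable def bq (x : V d) : ℝ := (nsq x + 10000) ^ (1 / 4 : ℝ)

lemma bq_pos (x : V d) : 0 < bq x := Real.rpow_pos_of_pos (by have := nsq_nonneg x; linarith) _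

lemma quart_pow {t : ℝ} (h : 0 ≤ t) : (t ^ (1 / 4 : ℝ)) ^ 4 = t := by
  rw [← Real.rpow_natCast, ← Real.rpow_mul h]; norm_num

lemma bq_pow (x : V d) : bq x ^ 4 = nsq x + 10000 := quart_pow (by have := nsq_nonneg x; linarith)

noncomputable def gF (x : V d) : ℝ := 1 / bq x
noncomputable def gG (x : V d) : ℝ := 1 / bq x ^ 5

lemma gF_pos (x : V d) : 0 < gF x := by have := bq_pos x; unfold gF; positivity
lemma gG_pos (x : V d) : 0 < gG x := by have := bq_pos x; unfold gG; positivity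

lemma barrier_main (hd : 5 ≤ d) (x : V d) :
    0.005 * gG x ≤ gF x - PP gF x ∧ 0 < gG x - PP gG x := by
  have h0 : (0:ℝ) < d := by exact_mod_cast (by omega : 0 < d)
  have hd5 : (5:ℝ) ≤ d := by exact_mod_cast hd
  have hn := nsq_nonneg x
  set A : ℝ := nsq x + 10001 with hA
  set a : ℝ := A ^ (1 / 4 : ℝ) with ha
  have hA0 : 0 < A := by linarith
  have ha0 : 0 < a := Real.rpow_pos_of_pos hA0 _
  have ha4 : a ^ 4 = A := quart_pow hA0.le
  set q : Fin d → ℝ := fun i => 2 * (x i : ℝ) / A with hq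
  have hqs : ∀ i, |q i| ≤ 0.02 := by
    intro i
    apply abs_le_of_sq_le_sq _ (by norm_num)
    have h1 := sq_le_nsq x i
    simp only [hq]
    rw [div_pow, div_le_iff₀ (by positivity)]
    nlinarith
  have hup : ∀ i, 1 / bq (x + ev i) ≤ 1 / a * (1 - q i / 4 + 0.3 * q i ^ 2) ∧
      1 / bq (x + ev i) ^ 5 ≤ 1 / a ^ 5 * (1 - 5 / 4 * q i + 1.5 * q i ^ 2) := by
    intro i
    refine inv_up ha0 (bq_pos _) ?_ (hqs i)
    rw [bq_pow, nsq_add_ev, ha4]; simp only [hq]; field_simp; ring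
  have hup2 : ∀ i, 1 / bq (x - ev i) ≤ 1 / a * (1 - (-q i) / 4 + 0.3 * (-q i) ^ 2) ∧
      1 / bq (x - ev i) ^ 5 ≤ 1 / a ^ 5 * (1 - 5 / 4 * (-q i) + 1.5 * (-q i) ^ 2) := by
    intro i
    refine inv_up ha0 (bq_pos _) ?_ (by rw [abs_neg]; exact hqs i)
    rw [bq_pow, nsq_sub_ev, ha4]; simp only [hq]; field_simp; ring
  have hsum : ∑ i, q i ^ 2 ≤ 4 / A := by
    have : ∑ i, q i ^ 2 = 4 * nsq x / A ^ 2 := by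
      simp only [hq, nsq, Finset.mul_sum, Finset.sum_div]
      exact Finset.sum_congr rfl fun i _ => by ring
    rw [this, div_le_div_iff₀ (by positivity) hA0]; nlinarith
  have hlo := inv_lo ha0 (bq_pos x) (q := 1 / A) (by rw [bq_pow, ha4]; field_simp; linarith) (by positivity)
    (by rw [div_le_iff₀ hA0]; linarith)
  have hsumd : (∑ i, q i ^ 2) / d ≤ 0.8 / A := by
    rw [div_le_div_iff₀ h0 hA0]
    rw [le_div_iff₀ hA0] at hsum; nlinarith
  have hPF : PP gF x ≤ 1 / a * (1 + 0.3 * ((∑ i, q i ^ 2) / d)) := by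
    unfold PP
    rw [div_le_iff₀ (by positivity)]
    calc ∑ i, (gF (x + ev i) + gF (x - ev i)) ≤ ∑ i, (1 / a * (2 + 0.6 * q i ^ 2)) :=
          Finset.sum_le_sum fun i _ => by
            have h1 := (hup i).1; have h2 := (hup2 i).1; unfold gF; linarith
      _ = _ := by rw [← Finset.mul_sum, Finset.sum_add_distrib, ← Finset.mul_sum]; simp; field_simp; ring
  have hPG : PP gG x ≤ 1 / a ^ 5 * (1 + 1.5 * ((∑ i, q i ^ 2) / d)) := by
    unfold PP
    rw [div_le_iff₀ (by positivity)]
    calc ∑ i, (gG (x + ev i) + gG (x - ev i)) ≤ ∑ i, (1 / a ^ 5 * (2 + 3 * q i ^ 2)) :=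
          Finset.sum_le_sum fun i _ => by
            have h1 := (hup i).2; have h2 := (hup2 i).2; unfold gG; linarith
      _ = _ := by rw [← Finset.mul_sum, Finset.sum_add_distrib, ← Finset.mul_sum]; simp; field_simp; ring
  constructor
  · have h1 : 0.01 * (1 / a ^ 5) ≤ gF x - PP gF x := by
      have e : 0.01 * (1 / a ^ 5) = 1 / a * (0.01 / A) := by rw [← ha4]; field_simp
      rw [e]
      have h3 : 1 / a * (1 + 0.3 * ((∑ i, q i ^ 2) / d)) ≤ 1 / a * (1 + 0.3 * (0.8 / A)) := by gcongr
      have h4 := hlo.1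
      have e2 : 1 / a * (1 + 1 / A / 4) = 1 / a * (1 + 0.3 * (0.8 / A)) + 1 / a * (0.01 / A) := by ring
      unfold gF at *; linarith
    have h2 := hlo.2.2
    unfold gG; linarith
  · have h3 : 1 / a ^ 5 * (1 + 1.5 * ((∑ i, q i ^ 2) / d)) ≤ 1 / a ^ 5 * (1 + 1.5 * (0.8 / A)) := by gcongr
    have h4 := hlo.2.1
    have e2 : 1 / a ^ 5 * (1 + 5 / 4 * (1 / A)) = 1 / a ^ 5 * (1 + 1.5 * (0.8 / A)) + 1 / a ^ 5 * (0.05 / A) := by ring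
    have : 0 < 1 / a ^ 5 * (0.05 / A) := by positivity
    unfold gG at *; linarith

lemma gG_ratio (x y : V d) (h : nsq y ≤ nsq x) : gG x / gG y ≤ (nsq y + 10000) / (nsq x + 10000) := by
  have hx := bq_pos x; have hy := bq_pos y
  have hxy : bq y ≤ bq x := by
    apply Real.rpow_le_rpow (by have := nsq_nonneg y; linarith) (by linarith) (by norm_num)
  rw [← bq_pow, ← bq_pow]
  unfold gG
  have e : 1 / bq x ^ 5 / (1 / bq y ^ 5) = bq y ^ 4 / bq x ^ 4 * (bq y / bq x) := by field_simp
  rw [e]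
  apply mul_le_of_le_one_right (by positivity)
  rw [div_le_one hx]; exact hxy

noncomputable def QC (C : Set (V d)) (f : V d → ℝ) (x : V d) : ℝ := PP (C.indicator f) x

lemma QC_mono {C : Set (V d)} {f g : V d → ℝ} (h : ∀ x ∈ C, f x ≤ g x) (x : V d) : QC C f x ≤ QC C g x :=
  PP_mono (fun y => Set.indicator_le_indicator' (h y)) x

lemma QC_le_PP {C : Set (V d)} {f g : V d → ℝ} (h : ∀ x ∈ C, f x ≤ g x) (hg : ∀ x, 0 ≤ g x) (x : V d) :
    QC C f x ≤ PP g x := by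
  apply PP_mono
  intro y
  by_cases hy : y ∈ C
  · rw [Set.indicator_of_mem hy]; exact h y hy
  · rw [Set.indicator_of_notMem hy]; exact hg y

lemma QC_add (C : Set (V d)) (f g : V d → ℝ) (x : V d) :
    QC C (fun y => f y + g y) x = QC C f x + QC C g x := by
  unfold QC
  rw [← PP_add]; congr 1
  ext y; by_cases hy : y ∈ C <;> simp [hy]

lemma QC_sub (C : Set (V d)) (f g : V d → ℝ) (x : V d) :
    QC C (fun y => f y - g y) x = QC C f x - QC C g x := by
  unfold QC
  rw [← PP_sub]; congr 1
  ext y; by_cases hy : y ∈ C <;> simp [hy]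

lemma QC_smul (C : Set (V d)) (c : ℝ) (f : V d → ℝ) (x : V d) :
    QC C (fun y => c * f y) x = c * QC C f x := by
  unfold QC
  rw [← PP_smul]; congr 1
  ext y; by_cases hy : y ∈ C <;> simp [hy]

lemma QC_zero (C : Set (V d)) (x : V d) : QC C (fun _ => 0) x = 0 := by
  have := QC_smul C 0 (fun _ => 0) x
  simpa using this

lemma QC_nonneg {C : Set (V d)} {f : V d → ℝ} (h : ∀ x, 0 ≤ f x) (x : V d) : 0 ≤ QC C f x :=
  PP_nonneg (fun y => Set.indicator_nonneg (fun z _ => h z) y) x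

lemma QC_univ (f : V d → ℝ) (x : V d) : QC Set.univ f x = PP f x := by simp [QC]

lemma QC_sum (C : Set (V d)) {ι : Type*} (s : Finset ι) (f : ι → V d → ℝ) (x : V d) :
    QC C (fun y => ∑ i ∈ s, f i y) x = ∑ i ∈ s, QC C (f i) x := by
  induction s using Finset.induction_on with
  | empty => simp [QC_zero]
  | insert a s ha ih =>
    simp only [Finset.sum_insert ha]
    rw [QC_add, ih]

/-- iterates -/
noncomputable def QI (C : Set (V d)) (t : ℕ) (f : V d → ℝ) : V d → ℝ := (QC C)^[t] f

lemma QI_zero (C : Set (V d)) (f : V d → ℝ) : QI C 0 f = f := rfl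
lemma QI_succ (C : Set (V d)) (t : ℕ) (f : V d → ℝ) : QI C (t + 1) f = QC C (QI C t f) :=
  Function.iterate_succ_apply' _ _ _
lemma QI_succ' (C : Set (V d)) (t : ℕ) (f : V d → ℝ) : QI C (t + 1) f = QI C t (QC C f) :=
  Function.iterate_succ_apply _ _ _
lemma QI_add_time (C : Set (V d)) (s t : ℕ) (f : V d → ℝ) : QI C (s + t) f = QI C s (QI C t f) :=
  Function.iterate_add_apply _ _ _ _

lemma QI_mono {C : Set (V d)} {f g : V d → ℝ} (h : ∀ x, f x ≤ g x) (t : ℕ) (x : V d) :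
    QI C t f x ≤ QI C t g x := by
  induction t generalizing x with
  | zero => exact h x
  | succ t ih => rw [QI_succ, QI_succ]; exact QC_mono (fun y _ => ih y) x

lemma QI_nonneg {C : Set (V d)} {f : V d → ℝ} (h : ∀ x, 0 ≤ f x) (t : ℕ) (x : V d) : 0 ≤ QI C t f x := by
  induction t generalizing x with
  | zero => exact h x
  | succ t ih => rw [QI_succ]; exact QC_nonneg ih x

lemma QI_add (C : Set (V d)) (f g : V d → ℝ) (t : ℕ) (x : V d) :
    QI C t (fun y => f y + g y) x = QI C t f x + QI C t g x := by
  induction t generalizing x with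
  | zero => rfl
  | succ t ih =>
    simp only [QI_succ]; rw [← QC_add]; congr 1; ext y; exact ih y

lemma QI_sub (C : Set (V d)) (f g : V d → ℝ) (t : ℕ) (x : V d) :
    QI C t (fun y => f y - g y) x = QI C t f x - QI C t g x := by
  induction t generalizing x with
  | zero => rfl
  | succ t ih =>
    simp only [QI_succ]; rw [← QC_sub]; congr 1; ext y; exact ih y

lemma QI_smul (C : Set (V d)) (c : ℝ) (f : V d → ℝ) (t : ℕ) (x : V d) :
    QI C t (fun y => c * f y) x = c * QI C t f x := by
  induction t generalizing x with
  | zero => rfl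
  | succ t ih =>
    simp only [QI_succ]; rw [← QC_smul]; congr 1; ext y; exact ih y

lemma QI_zero_fun (C : Set (V d)) (t : ℕ) (x : V d) : QI C t (fun _ => 0) x = 0 := by
  have := QI_smul C 0 (fun _ => 0) t x
  simpa using this

lemma QC_one_le (hd : 5 ≤ d) (C : Set (V d)) (x : V d) : QC C (fun _ => 1) x ≤ 1 := by
  have := QC_le_PP (C := C) (f := fun _ => 1) (g := fun _ => 1) (fun _ _ => le_rfl) (fun _ => zero_le_one) x
  rwa [PP_const hd] at this

lemma QI_one_le (hd : 5 ≤ d) (C : Set (V d)) (t : ℕ) (x : V d) : QI C t (fun _ => 1) x ≤ 1 := by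
  induction t generalizing x with
  | zero => exact le_rfl
  | succ t ih => rw [QI_succ]; exact (QC_mono (fun y _ => ih y) x).trans (QC_one_le hd C x)

lemma QI_one_anti (hd : 5 ≤ d) (C : Set (V d)) (t : ℕ) (x : V d) :
    QI C (t + 1) (fun _ => 1) x ≤ QI C t (fun _ => 1) x := by
  rw [QI_succ']; exact QI_mono (fun y => QC_one_le hd C y) t x

lemma QI_one_anti' (hd : 5 ≤ d) (C : Set (V d)) (x : V d) : Antitone fun t => QI C t (fun _ => 1) x :=
  antitone_nat_of_succ_le fun t => QI_one_anti hd C t x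

/-- Green-type bound -/
lemma sum_QI_le {C : Set (V d)} {h G : V d → ℝ} (hG : ∀ x ∈ C, 0 ≤ G x)
    (hh : ∀ x ∈ C, h x + QC C G x ≤ G x) (n : ℕ) : ∀ x ∈ C, ∑ k ∈ Finset.range n, QI C k h x ≤ G x := by
  induction n with
  | zero => intro x hx; simpa using hG x hx
  | succ n ih =>
    intro x hx
    rw [Finset.sum_range_succ']
    simp only [QI_succ, QI_zero]
    rw [← QC_sum]
    have := QC_mono ih x
    linarith [hh x hx]

/-- reverse Green-type bound -/
lemma le_sum_QI {C : Set (V d)} {h G : V d → ℝ}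
    (hh : ∀ x ∈ C, G x ≤ h x + QC C G x) (n : ℕ) :
    ∀ x ∈ C, G x ≤ ∑ k ∈ Finset.range n, QI C k h x + QI C n G x := by
  induction n with
  | zero => intro x hx; simp [QI_zero]
  | succ n ih =>
    intro x hx
    rw [Finset.sum_range_succ']
    simp only [QI_succ, QI_zero]
    rw [← QC_sum]
    have := QC_mono ih x
    rw [QC_add] at this
    linarith [hh x hx]

/-! return probabilities -/
noncomputable def dl (x : V d) : ℝ := if x = 0 then 1 else 0

lemma dl_nonneg (x : V d) : 0 ≤ dl x := by unfold dl; split_ifs <;> norm_num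

noncomputable def pk (k : ℕ) (x : V d) : ℝ := QI Set.univ k dl x

lemma pk_nonneg (k : ℕ) (x : V d) : 0 ≤ pk k x := QI_nonneg dl_nonneg k x

lemma pk_sum (hd : 5 ≤ d) (n : ℕ) (x : V d) :
    ∑ k ∈ Finset.range n, pk k x ≤ gG x / (gG (0 : V d) - PP gG (0 : V d)) := by
  have hc := (barrier_main hd (0 : V d)).2
  refine sum_QI_le (C := Set.univ) (G := fun x => gG x / (gG (0 : V d) - PP gG (0 : V d)))
    (fun x _ => div_nonneg (gG_pos x).le hc.le) ?_ n x (Set.mem_univ x)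
  intro x _
  rw [QC_univ]
  have e : PP (fun x => gG x / (gG (0 : V d) - PP gG (0 : V d))) x = PP gG x / (gG (0 : V d) - PP gG (0 : V d)) := by
    have := PP_smul ((gG (0 : V d) - PP gG (0 : V d))⁻¹) gG x
    simp only [div_eq_inv_mul]; exact this
  rw [e, ← le_sub_iff_add_le, ← sub_div, le_div_iff₀ hc]
  unfold dl
  split_ifs with h
  · subst h; simp
  · have := (barrier_main hd x).2; linarith

lemma pk_dsum (hd : 5 ≤ d) (n n' : ℕ) (x : V d) :
    ∑ k ∈ Finset.range n, ∑ j ∈ Finset.range n', pk (k + j) x ≤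
      gF x * (200 / (gG (0 : V d) - PP gG (0 : V d))) := by
  have hc := (barrier_main hd (0 : V d)).2
  set c := gG (0 : V d) - PP gG (0 : V d)
  have h1 : ∀ k, ∑ j ∈ Finset.range n', pk (k + j) x ≤ QI Set.univ k (fun y => c⁻¹ * gG y) x := by
    intro k
    have : ∑ j ∈ Finset.range n', pk (k + j) x = QI Set.univ k (fun y => ∑ j ∈ Finset.range n', pk j y) x := by
      simp only [pk, QI_add_time]
      generalize n' = N
      induction N with
      | zero => simp [QI_zero_fun]
      | succ N ih => simp only [Finset.sum_range_succ]; rw [ih, QI_add]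
    rw [this]
    apply QI_mono
    intro y
    have := pk_sum hd n' y
    rwa [div_eq_inv_mul] at this
  refine (Finset.sum_le_sum fun k _ => h1 k).trans ?_
  refine sum_QI_le (C := Set.univ) (h := fun y => c⁻¹ * gG y) (G := fun x => gF x * (200 / c)) (fun x _ => by have := gF_pos x; positivity) ?_ n x (Set.mem_univ x)
  intro x _
  have e : (fun x : V d => gF x * (200 / c)) = fun x => (200 / c) * gF x := by ext; ring
  rw [QC_univ, e, PP_smul]
  have := (barrier_main hd x).1
  have h2 : c⁻¹ * gG x = (200 / c) * (0.005 * gG x) := by field_simp; norm_num; ring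
  rw [h2]
  beta_reduce
  have : (200 / c) * (0.005 * gG x) ≤ (200 / c) * (gF x - PP gF x) := by gcongr
  linarith

lemma pk_tail (hd : 5 ≤ d) (x : V d) (ε : ℝ) (hε : 0 < ε) : ∃ K : ℕ, ∀ n n' : ℕ,
    ∑ k ∈ Finset.range n, ∑ j ∈ Finset.range n', pk (K + k + j) x ≤ ε := by
  have hs0 : Summable fun k => pk k x :=
    summable_of_sum_range_le (fun k => pk_nonneg k x) (fun n => pk_sum hd n x)
  have hs : ∀ i, Summable fun j => pk (i + j) x := by
    intro i
    have := (summable_nat_add_iff i).2 hs0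
    simpa [add_comm] using this
  have hr0 : ∀ i, 0 ≤ ∑' j, pk (i + j) x := fun i => tsum_nonneg fun j => pk_nonneg _ x
  have hr : Summable fun i => ∑' j, pk (i + j) x := by
    refine summable_of_sum_range_le hr0 (c := gF x * (200 / (gG (0 : V d) - PP gG (0 : V d)))) ?_
    intro n
    rw [← Summable.tsum_finsetSum fun i _ => hs i]
    refine Summable.tsum_le_of_sum_range_le (summable_sum fun i _ => hs i) fun n' => ?_
    rw [Finset.sum_comm]
    exact pk_dsum hd n n' x
  have ht := tendsto_sum_nat_add fun i => ∑' j, pk (i + j) x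
  obtain ⟨K, hK⟩ := (ht.eventually (gt_mem_nhds hε)).exists
  refine ⟨K, fun n n' => le_trans ?_ hK.le⟩
  have hrK : Summable fun i => ∑' j, pk (i + K + j) x := (summable_nat_add_iff K).2 hr
  refine le_trans (Finset.sum_le_sum fun k _ => ?_) (hrK.sum_le_tsum (Finset.range n) fun i _ => hr0 _)
  rw [add_comm K k]
  exact (hs (k + K)).sum_le_tsum (Finset.range n') fun i _ => pk_nonneg _ x

def ell (i : Fin d) (σ n : ℤ) (x : V d) : ℤ := σ * x i - n

lemma ell_add_ev (i : Fin d) (σ n : ℤ) (x : V d) (k : Fin d) :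
    ell i σ n (x + ev k) = ell i σ n x + (if k = i then σ else 0) := by
  unfold ell; by_cases h : k = i
  · subst h; simp [ev_apply]; ring
  · simp [ev_apply, h, Ne.symm h]

lemma ell_sub_ev (i : Fin d) (σ n : ℤ) (x : V d) (k : Fin d) :
    ell i σ n (x - ev k) = ell i σ n x - (if k = i then σ else 0) := by
  unfold ell; by_cases h : k = i
  · subst h; simp [ev_apply]; ring
  · simp [ev_apply, h, Ne.symm h]

lemma PP_ell (hd : 5 ≤ d) (i : Fin d) {σ n : ℤ} (hσ : σ = 1 ∨ σ = -1) (φ : ℤ → ℝ) (x : V d) :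
    PP (fun y => φ (ell i σ n y)) x = φ (ell i σ n x) +
      (φ (ell i σ n x + 1) + φ (ell i σ n x - 1) - 2 * φ (ell i σ n x)) / (2 * d) := by
  have h0 : (0:ℝ) < d := by exact_mod_cast (by omega : 0 < d)
  unfold PP
  have : ∀ k : Fin d, φ (ell i σ n (x + ev k)) + φ (ell i σ n (x - ev k)) = 2 * φ (ell i σ n x) +
      (if k = i then (φ (ell i σ n x + 1) + φ (ell i σ n x - 1) - 2 * φ (ell i σ n x)) else 0) := by
    intro k
    rw [ell_add_ev, ell_sub_ev]
    by_cases h : k = i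
    · rcases hσ with rfl | rfl
      · simp [h]
      · simp [h]; rw [← sub_eq_add_neg]; ring
    · simp [h]; ring
  simp only [this, Finset.sum_add_distrib]
  simp
  field_simp

/-- reflection across `ell = k` -/
def io (i : Fin d) (σ n k : ℤ) (x : V d) : V d := rf i (2 * σ * (n + k)) x

lemma ell_io (i : Fin d) {σ n : ℤ} (hσ : σ = 1 ∨ σ = -1) (k : ℤ) (x : V d) :
    ell i σ n (io i σ n k x) = 2 * k - ell i σ n x := by
  unfold ell io; rw [rf_same]
  rcases hσ with rfl | rfl <;> ring

lemma io_io (i : Fin d) (σ n k : ℤ) (x : V d) : io i σ n k (io i σ n k x) = x := rf_rf _ _ _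

lemma io_fix (i : Fin d) {σ n : ℤ} (hσ : σ = 1 ∨ σ = -1) (k : ℤ) (x : V d) (h : ell i σ n x = k) :
    io i σ n k x = x := by
  ext j
  by_cases hj : j = i
  · subst hj; unfold io; rw [rf_same]; unfold ell at h
    rcases hσ with rfl | rfl <;> linarith
  · unfold io; rw [rf_ne hj]

lemma refl_pos (hd : 5 ≤ d) (i : Fin d) {σ n : ℤ} (hσ : σ = 1 ∨ σ = -1) (C : Set (V d))
    (hC : ∀ x, 0 < ell i σ n x → x ∈ C) (G : V d → ℝ)
    (h1 : ∀ z, 0 ≤ ell i σ n z → 0 ≤ G z) (h2 : ∀ z, 0 ≤ G z + G (io i σ n 0 z)) (t : ℕ) :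
    (∀ z, 0 ≤ ell i σ n z → 0 ≤ QI C t G z) ∧ (∀ z, 0 ≤ QI C t G z + QI C t G (io i σ n 0 z)) := by
  induction t with
  | zero => exact ⟨h1, h2⟩
  | succ t ih =>
    obtain ⟨g1, g2⟩ := ih
    simp only [QI_succ]
    set g := QI C t G
    have k1 : ∀ z, 0 ≤ ell i σ n z → 0 ≤ C.indicator g z := by
      intro z hz; by_cases hc : z ∈ C
      · rw [Set.indicator_of_mem hc]; exact g1 z hz
      · rw [Set.indicator_of_notMem hc]
    have k2 : ∀ z, 0 < ell i σ n z → 0 ≤ C.indicator g z + C.indicator g (io i σ n 0 z) := by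
      intro z hz
      rw [Set.indicator_of_mem (hC z hz)]
      by_cases hc : io i σ n 0 z ∈ C
      · rw [Set.indicator_of_mem hc]; exact g2 z
      · rw [Set.indicator_of_notMem hc]; have := g1 z hz.le; linarith
    have k3 : ∀ z, 0 ≤ C.indicator g z + C.indicator g (io i σ n 0 z) := by
      intro z
      rcases lt_trichotomy (ell i σ n z) 0 with h | h | h
      · have := k2 (io i σ n 0 z) (by rw [ell_io i hσ]; omega)
        rw [io_io] at this; linarith
      · rw [io_fix i hσ 0 z h]; have := k1 z h.ge; linarith
      · exact k2 z h
    have k4 : ∀ z, 0 ≤ QC C g z + QC C g (io i σ n 0 z) := by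
      intro z
      unfold QC
      rw [io, ← PP_rf, ← PP_add]
      exact PP_nonneg k3 z
    refine ⟨fun z hz => ?_, k4⟩
    rcases hz.eq_or_lt with h | h
    · have := k4 z; rw [io_fix i hσ 0 z h.symm] at this; linarith
    · unfold QC
      have := PP_mono_at (f := fun _ => 0) (g := C.indicator g) (x := z) ?_
      · rwa [PP_const hd] at this
      · intro k
        constructor
        · apply k1; rw [ell_add_ev]; rcases hσ with rfl | rfl <;> split_ifs <;> omega
        · apply k1; rw [ell_sub_ev]; rcases hσ with rfl | rfl <;> split_ifs <;> omega

lemma QI_congr {C : Set (V d)} {f g : V d → ℝ} (h : ∀ x, f x = g x) (t : ℕ) (x : V d) :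
    QI C t f x = QI C t g x := by
  rw [show f = g from funext h]

noncomputable def hp (k : ℤ) : ℝ := if 0 < k then (k:ℝ) else 0

lemma hp_nonneg (k : ℤ) : 0 ≤ hp k := by
  unfold hp; split_ifs with h
  · exact_mod_cast h.le
  · exact le_rfl

lemma QC_eq_PP {C : Set (V d)} {f : V d → ℝ} (h : ∀ x, x ∉ C → f x = 0) (x : V d) : QC C f x = PP f x := by
  unfold QC; congr 1; ext y
  by_cases hy : y ∈ C
  · rw [Set.indicator_of_mem hy]
  · rw [Set.indicator_of_notMem hy, h y hy]

lemma QC_hp (hd : 5 ≤ d) (i : Fin d) {σ n : ℤ} (hσ : σ = 1 ∨ σ = -1) (C : Set (V d))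
    (hC : ∀ x, 0 < ell i σ n x → x ∈ C) (p : ℕ) (hp0 : p ≠ 0) (x : V d) :
    QC C (fun y => hp (ell i σ n y) ^ p) x = hp (ell i σ n x) ^ p +
      (hp (ell i σ n x + 1) ^ p + hp (ell i σ n x - 1) ^ p - 2 * hp (ell i σ n x) ^ p) / (2 * d) := by
  rw [QC_eq_PP, PP_ell hd i hσ (fun k => hp k ^ p)]
  intro y hy
  have : ¬ 0 < ell i σ n y := fun h => hy (hC y h)
  simp [hp, this, hp0]

lemma hp_cases (k : ℤ) : (1 ≤ k ∧ hp k = k ∧ hp (k+1) = k + 1 ∧ hp (k-1) = k - 1) ∨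
    (k = 0 ∧ hp k = 0 ∧ hp (k+1) = 1 ∧ hp (k-1) = 0) ∨ (k ≤ -1 ∧ hp k = 0 ∧ hp (k+1) = 0 ∧ hp (k-1) = 0) := by
  rcases lt_trichotomy k 0 with h | h | h
  · right; right
    refine ⟨by omega, ?_, ?_, ?_⟩ <;> unfold hp <;> rw [if_neg (by omega)]
  · right; left; subst h; simp [hp]
  · left
    refine ⟨by omega, ?_, ?_, ?_⟩ <;> unfold hp
    · rw [if_pos h]
    · rw [if_pos (by omega)]; push_cast; ring
    · by_cases h1 : k = 1
      · subst h1; simp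
      · rw [if_pos (by omega)]; push_cast; ring

theorem moment (hd : 5 ≤ d) (i : Fin d) {σ n : ℤ} (hσ : σ = 1 ∨ σ = -1) (C : Set (V d))
    (hC : ∀ x, 0 < ell i σ n x → x ∈ C) (x0 : V d) (hx0 : ell i σ n x0 = 0) (t : ℕ) (ht : 1 ≤ t)
    (τ : ℝ) (hτ : 8 * d * τ ≤ √(2 * t)) :
    ∑ r ∈ Finset.range t, QI C r (fun _ => 1) x0 ≤ 4 * d * t * QI C t (fun _ => 1) x0 ∧
    QI C t (fun _ => 1) x0 ≤ 16 * d * QI C t (fun y => if 0 < ell i σ n y ∧ τ ≤ ell i σ n y then 1 else 0) x0 := by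
  have hd0 : (5:ℝ) ≤ d := by exact_mod_cast hd
  set a : ℕ → ℝ := fun r => QI C r (fun _ => 1) x0 with ha
  set b : ℕ → ℝ := fun r => QI C r (fun y => hp (ell i σ n y) ^ 1) x0 with hb
  set e : ℕ → ℝ := fun r => QI C r (fun y => hp (ell i σ n y) ^ 2) x0 with he
  set e3 : ℕ → ℝ := fun r => QI C r (fun y => hp (ell i σ n y) ^ 3) x0 with he3
  set u : ℕ → ℝ := fun r => QI C r (fun y => if ell i σ n y = 0 then 1 else 0) x0 with hu
  have hp00 : hp 0 = 0 := by simp [hp]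
  have b0 : b 0 = 0 := by simp [hb, QI_zero, hx0, hp00]
  have e0 : e 0 = 0 := by simp [he, QI_zero, hx0, hp00]
  have e30 : e3 0 = 0 := by simp [he3, QI_zero, hx0, hp00]
  have anti : ∀ r, r ≤ t → a t ≤ a r := fun r hr => QI_one_anti' hd C x0 hr
  have bn : ∀ r, 0 ≤ b r := fun r => QI_nonneg (fun y => pow_nonneg (hp_nonneg _) 1) r x0
  have an : ∀ r, 0 ≤ a r := fun r => QI_nonneg (fun y => zero_le_one) r x0
  have un : ∀ r, 0 ≤ u r := fun r => QI_nonneg (fun y => by split_ifs <;> norm_num) r x0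
  have bs : ∀ r, b (r+1) = b r + (1/(2*d)) * u r := by
    intro r
    simp only [hb, hu]
    rw [QI_succ', ← QI_smul, ← QI_add]
    apply QI_congr; intro y
    rw [QC_hp hd i hσ C hC 1 one_ne_zero]
    rcases hp_cases (ell i σ n y) with ⟨h, h1, h2, h3⟩ | ⟨h, h1, h2, h3⟩ | ⟨h, h1, h2, h3⟩
    · rw [h1, h2, h3, if_neg (by omega)]; ring
    · rw [h1, h2, h3, if_pos h]; ring
    · rw [h1, h2, h3, if_neg (by omega)]; ring
  have e3s : ∀ r, e3 (r+1) = (e3 r + (3/d) * b r) + (1/(2*d)) * u r := by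
    intro r
    simp only [hb, hu, he3]
    rw [QI_succ', ← QI_smul, ← QI_smul, ← QI_add, ← QI_add]
    apply QI_congr; intro y
    rw [QC_hp hd i hσ C hC 3 (by norm_num)]
    rcases hp_cases (ell i σ n y) with ⟨h, h1, h2, h3⟩ | ⟨h, h1, h2, h3⟩ | ⟨h, h1, h2, h3⟩
    · rw [h1, h2, h3, if_neg (by omega)]; field_simp; ring
    · rw [h1, h2, h3, if_pos h]; ring
    · rw [h1, h2, h3, if_neg (by omega)]; ring
  have es : ∀ r, e r + (1/(2*d)) * a r ≤ e (r+1) := by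
    intro r
    have h1 : 0 ≤ QI C r (fun y => if 0 < ell i σ n y then (1:ℝ) else if ell i σ n y < 0 then -1 else 0) x0 := by
      apply (refl_pos hd i hσ C hC _ _ _ r).1 x0 hx0.ge
      · intro z hz; split_ifs <;> first | omega | norm_num
      · intro z; rw [ell_io i hσ]; split_ifs <;> first | omega | norm_num
    have h2 : e (r+1) = (e r + (1/(2*d)) * a r) + (1/(2*d)) * QI C r (fun y => if 0 < ell i σ n y then (1:ℝ) else if ell i σ n y < 0 then -1 else 0) x0 := by
      simp only [ha, he]
      rw [QI_succ', ← QI_smul, ← QI_smul, ← QI_add, ← QI_add]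
      apply QI_congr; intro y
      rw [QC_hp hd i hσ C hC 2 (by norm_num)]
      rcases hp_cases (ell i σ n y) with ⟨h, h1, h2, h3⟩ | ⟨h, h1, h2, h3⟩ | ⟨h, h1, h2, h3⟩
      · rw [h1, h2, h3, if_pos (by omega)]; field_simp; ring
      · rw [h1, h2, h3, if_neg (by omega), if_neg (by omega)]; ring
      · rw [h1, h2, h3, if_neg (by omega), if_pos (by omega)]; ring
    rw [h2]
    have : 0 ≤ (1/(2*(d:ℝ))) := by positivity
    nlinarith
  have hk : 0 < (1/(2*(d:ℝ))) := by positivity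
  have bmono : ∀ r, b r ≤ b (r+1) := by
    intro r; rw [bs]; have := mul_nonneg hk.le (un r); linarith
  have e3b : ∀ r : ℕ, e3 r ≤ (1 + r) * b r := by
    intro r
    induction r with
    | zero => rw [e30, b0]; simp
    | succ r ih =>
      have h3 : (3/(d:ℝ)) * b r ≤ 1 * b r :=
        mul_le_mul_of_nonneg_right (by rw [div_le_one (by linarith)]; linarith) (bn r)
      have := bs r
      have h4 := bmono r
      rw [e3s]; push_cast
      have h5 : (0:ℝ) ≤ r := Nat.cast_nonneg r
      nlinarith
  have esum : ∀ r : ℕ, (1/(2*d)) * ∑ k ∈ Finset.range r, a k ≤ e r := by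
    intro r
    induction r with
    | zero => rw [e0]; simp
    | succ r ih => rw [Finset.sum_range_succ, mul_add]; linarith [es r]
  have ht0 : (1:ℝ) ≤ t := by exact_mod_cast ht
  set s := √(2 * (t:ℝ)) with hs
  have hs2 : s ^ 2 = 2 * t := Real.sq_sqrt (by positivity)
  have hs0 : 0 < s := Real.sqrt_pos.2 (by positivity)
  have e1 : e t ≤ s * b t := by
    have h : 0 ≤ QI C t (fun y => hp (ell i σ n y) * (hp (ell i σ n y) - s)^2) x0 :=
      QI_nonneg (fun y => mul_nonneg (hp_nonneg _) (sq_nonneg _)) t x0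
    have h2 : QI C t (fun y => hp (ell i σ n y) * (hp (ell i σ n y) - s)^2) x0 = (e3 t - (2*s) * e t) + s^2 * b t := by
      simp only [hb, he3, he]
      rw [← QI_smul, ← QI_smul, ← QI_sub, ← QI_add]
      apply QI_congr; intro y; ring
    rw [h2] at h
    have h3 : e3 t ≤ s^2 * b t := (e3b t).trans (mul_le_mul_of_nonneg_right (by rw [hs2]; linarith) (bn t))
    have h4 : s * e t ≤ s * (s * b t) := by nlinarith
    exact le_of_mul_le_mul_left h4 hs0
  have b1 : b t ≤ s * a t := by
    have h : 0 ≤ QI C t (fun y => (hp (ell i σ n y) - s)^2) x0 :=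
      QI_nonneg (fun y => sq_nonneg _) t x0
    have h2 : QI C t (fun y => (hp (ell i σ n y) - s)^2) x0 = (e t - (2*s) * b t) + s^2 * a t := by
      simp only [hb, ha, he]
      rw [← QI_smul, ← QI_smul, ← QI_sub, ← QI_add]
      apply QI_congr; intro y; ring
    rw [h2] at h
    have h4 : s * b t ≤ s * (s * a t) := by nlinarith
    exact le_of_mul_le_mul_left h4 hs0
  have hst := esum t
  have e2 : e t ≤ 2 * t * a t := by
    have : s * b t ≤ s * (s * a t) := mul_le_mul_of_nonneg_left b1 hs0.le
    have h5 : s * (s * a t) = 2 * t * a t := by rw [← hs2]; ring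
    linarith
  have hdd : (d:ℝ) * (1/(2*d)) = 1/2 := by field_simp
  constructor
  · have : ∑ k ∈ Finset.range t, a k = 2 * d * ((1/(2*d)) * ∑ k ∈ Finset.range t, a k) := by field_simp
    rw [this]
    calc _ ≤ 2 * d * (2 * t * a t) := mul_le_mul_of_nonneg_left (hst.trans e2) (by positivity)
      _ = _ := by ring
  · have h1 : t * a t ≤ ∑ k ∈ Finset.range t, a k := by
      have := Finset.card_nsmul_le_sum (Finset.range t) a (a t) (fun r hr => anti r (Finset.mem_range.1 hr).le)
      simpa using this
    have h2 : t * a t ≤ 2 * d * (s * b t) := by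
      have : (1/(2*d)) * (t * a t) ≤ s * b t :=
        (mul_le_mul_of_nonneg_left h1 hk.le).trans (hst.trans e1)
      calc _ = 2 * d * ((1/(2*d)) * (t * a t)) := by field_simp
        _ ≤ _ := by gcongr
    have h3 : s * a t ≤ 4 * d * b t := by
      have : s * (s * a t) ≤ s * (4 * d * b t) := by
        have : s * (s * a t) = 2 * (t * a t) := by rw [← mul_assoc, ← sq, hs2]; ring
        rw [this]; linarith
      exact le_of_mul_le_mul_left this hs0
    set Y : V d → ℝ := fun y => if 0 < ell i σ n y ∧ τ ≤ ell i σ n y then 1 else 0 with hY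
    set k : V d → ℝ := fun y => Y y * hp (ell i σ n y) with hk'
    have h4 : b t ≤ (QI C t k x0) + (τ⊔0) * a t := by
      simp only [hb, ha]
      rw [← QI_smul, ← QI_add]
      apply QI_mono; intro y
      simp only [hk', hY]
      by_cases h : 0 < ell i σ n y ∧ τ ≤ ell i σ n y
      · rw [if_pos h]; have : 0 ≤ τ ⊔ 0 := le_max_right _ _
        linarith
      · rw [if_neg h]; simp only [zero_mul, pow_one, zero_add, mul_one]
        by_cases h' : 0 < ell i σ n y
        · push Not at h; have := h h'; unfold hp; rw [if_pos h']; exact this.le.trans (le_max_left _ _)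
        · unfold hp; rw [if_neg h']; exact le_max_right _ _
    have h5 : 8 * d * (τ⊔0) ≤ s := by
      rcases le_total τ 0 with h | h
      · rw [max_eq_right h]; simpa using hs0.le
      · rw [max_eq_left h]; exact hτ
    have h6 : (τ ⊔ 0) * a t ≤ b t / 2 := by
      have : 8 * d * (τ⊔0) * a t ≤ s * a t := mul_le_mul_of_nonneg_right h5 (an t)
      have h7 : (d:ℝ) * (8 * (τ ⊔ 0) * a t) ≤ d * (4 * b t) := by linarith
      have := le_of_mul_le_mul_left h7 (by linarith)
      linarith
    have h7 : b t / 2 ≤ QI C t k x0 := by linarith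
    have h8 : 0 ≤ QI C t (fun y => (2 * s * Y y - hp (ell i σ n y) * Y y)^2) x0 :=
      QI_nonneg (fun y => sq_nonneg _) t x0
    have h9 : QI C t (fun y => (2 * s * Y y - hp (ell i σ n y) * Y y)^2) x0 ≤
        ((4 * s^2) * QI C t Y x0 - (4 * s) * QI C t k x0) + e t := by
      simp only [he]
      rw [← QI_smul, ← QI_smul, ← QI_sub, ← QI_add]
      apply QI_mono; intro y
      simp only [hk', hY]
      split_ifs
      · nlinarith
      · simp; positivity
    have h10 : s * b t ≤ 4 * s^2 * QI C t Y x0 := by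
      have : 4 * s * (b t / 2) ≤ 4 * s * QI C t k x0 := by gcongr
      linarith
    have h11 : b t ≤ 4 * s * QI C t Y x0 := by
      have : s * b t ≤ s * (4 * s * QI C t Y x0) := by linarith
      exact le_of_mul_le_mul_left this hs0
    have h12 : s * a t ≤ s * (16 * d * QI C t Y x0) := by
      calc s * a t ≤ 4 * d * b t := h3
        _ ≤ 4 * d * (4 * s * QI C t Y x0) := by gcongr
        _ = _ := by ring
    exact le_of_mul_le_mul_left h12 hs0

noncomputable def XL (C B : Set (V d)) : ℕ → V d → ℝ
  | 0 => fun _ => 0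
  | t + 1 => QC C (fun y => if y ∈ B then XL C B t y else 1)

lemma XL_bound (hd : 5 ≤ d) (C : Set (V d)) (x0 : V d) (r2 : ℝ) (t : ℕ) (x : V d) :
    r2 * XL C {x | nsq (x - x0) < r2} t x ≤ nsq (x - x0) + ∑ s ∈ Finset.range t, QI C s (fun _ => 1) x := by
  induction t generalizing x with
  | zero => simpa [XL] using nsq_nonneg _
  | succ t ih =>
    rw [XL, ← QC_smul]
    have h1 : ∀ y, r2 * (if y ∈ {x | nsq (x - x0) < r2} then XL C {x | nsq (x - x0) < r2} t y else 1) ≤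
        nsq (y - x0) + ∑ s ∈ Finset.range t, QI C s (fun _ => 1) y := by
      intro y
      split_ifs with hy
      · exact ih y
      · have : r2 ≤ nsq (y - x0) := not_lt.1 hy
        have h2 : 0 ≤ ∑ s ∈ Finset.range t, QI C s (fun _ => 1) y :=
          Finset.sum_nonneg fun s _ => QI_nonneg (fun _ => zero_le_one) s y
        linarith
    refine (QC_mono (fun y _ => h1 y) x).trans ?_
    rw [QC_add, QC_sum, Finset.sum_range_succ']
    simp only [QI_succ, QI_zero]
    have := QC_le_PP (C := C) (f := fun y => nsq (y - x0)) (g := fun y => nsq (y - x0)) (fun _ _ => le_rfl) (fun _ => nsq_nonneg _) x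
    rw [PP_nsq hd] at this
    linarith

lemma QI_le_XL (hd : 5 ≤ d) (C B : Set (V d)) (f : V d → ℝ) (hf : ∀ x, 0 ≤ f x) (hf1 : ∀ x, f x ≤ 1) (t : ℕ) (x : V d) :
    QI C t f x ≤ QI (C ∩ B) t f x + XL C B t x := by
  induction t generalizing x with
  | zero => simp [QI_zero, XL]
  | succ t ih =>
    rw [QI_succ, QI_succ, XL]
    unfold QC
    rw [← PP_add]
    apply PP_mono
    intro y
    by_cases hC : y ∈ C
    · by_cases hB : y ∈ B
      · simp only [Set.indicator_of_mem hC, Set.indicator_of_mem (show y ∈ C ∩ B from ⟨hC, hB⟩), if_pos hB]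
        exact ih y
      · simp only [Set.indicator_of_mem hC, Set.indicator_of_notMem (show y ∉ C ∩ B from fun h => hB h.2), if_neg hB]
        rw [zero_add]
        exact (QI_mono hf1 t y).trans (QI_one_le hd C t y)
    · simp [Set.indicator_of_notMem hC, Set.indicator_of_notMem (show y ∉ C ∩ B from fun h => hC h.1)]

lemma v_le_XL (hd : 5 ≤ d) (C B : Set (V d)) (v : V d → ℝ) (M : ℝ) (hM0 : 0 ≤ M)
    (hvC : ∀ x ∈ C, v x = PP v x) (hv : ∀ x, x ∉ C → v x = 0)
    (hM : ∀ x ∈ B, ∀ i, v (x + ev i) ≤ M ∧ v (x - ev i) ≤ M) (t : ℕ) (x : V d) (hx : x ∈ B) :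
    PP v x ≤ M * (QI C t (fun _ => 1) x + XL C B t x) := by
  induction t generalizing x with
  | zero =>
    simp only [QI_zero, XL, add_zero, mul_one]
    have := PP_mono_at (f := v) (g := fun _ => M) (x := x) (hM x hx)
    rwa [PP_const hd] at this
  | succ t ih =>
    rw [QI_succ, XL]
    unfold QC
    rw [← PP_add, ← PP_smul]
    have key : ∀ y, v y ≤ M → v y ≤ M * (C.indicator (QI C t fun _ => 1) y + C.indicator (fun y => if y ∈ B then XL C B t y else 1) y) := by
      intro y hy
      by_cases hC : y ∈ C
      · simp only [Set.indicator_of_mem hC]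
        by_cases hB : y ∈ B
        · rw [if_pos hB, hvC y hC]; exact ih y hB
        · rw [if_neg hB]
          have : 0 ≤ QI C t (fun _ => 1) y := QI_nonneg (fun _ => zero_le_one) t y
          nlinarith
      · simp [Set.indicator_of_notMem hC, hv y hC]
    exact PP_mono_at fun i => ⟨key _ (hM x hx i).1, key _ (hM x hx i).2⟩

theorem keyloc (hd : 5 ≤ d) (i : Fin d) {σ n : ℤ} (hσ : σ = 1 ∨ σ = -1) (C : Set (V d))
    (hC : ∀ x, 0 < ell i σ n x → x ∈ C) (x0 : V d) (hx0 : ell i σ n x0 = 0) (t : ℕ) (ht : 1 ≤ t)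
    (τ : ℝ) (hτ : 8 * d * τ ≤ √(2 * t)) (r2 : ℝ) (hr2 : 128 * d ^ 2 * t ≤ r2)
    (v : V d → ℝ) (M : ℝ) (hM0 : 0 ≤ M)
    (hvC : ∀ x ∈ C, v x = PP v x) (hv : ∀ x, x ∉ C → v x = 0)
    (hM : ∀ x, nsq (x - x0) < r2 → ∀ i, v (x + ev i) ≤ M ∧ v (x - ev i) ≤ M) :
    PP v x0 ≤ 64 * d * M * QI (C ∩ {x | nsq (x - x0) < r2}) t
      (fun y => if 0 < ell i σ n y ∧ τ ≤ ell i σ n y then 1 else 0) x0 := by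
  have hd0 : (5:ℝ) ≤ d := by exact_mod_cast hd
  have ht0 : (1:ℝ) ≤ t := by exact_mod_cast ht
  obtain ⟨m1, m2⟩ := moment hd i hσ C hC x0 hx0 t ht τ hτ
  set B := {x | nsq (x - x0) < r2}
  have hr0 : 0 < r2 := lt_of_lt_of_le (by positivity) hr2
  have hxB : x0 ∈ B := by simp [B, nsq, hr0]
  have h1 := v_le_XL hd C B v M hM0 hvC hv hM t x0 hxB
  have h2 := QI_le_XL hd C B (fun y => if 0 < ell i σ n y ∧ τ ≤ ell i σ n y then 1 else 0)
    (fun x => by split_ifs <;> norm_num) (fun x => by split_ifs <;> norm_num) t x0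
  have h3 := XL_bound hd C x0 r2 t x0
  have h0 : nsq (x0 - x0) = 0 := by simp [nsq]
  rw [h0, zero_add] at h3
  set a := QI C t (fun _ => 1) x0
  have ha : 0 ≤ a := QI_nonneg (fun _ => zero_le_one) t x0
  have h4 : XL C B t x0 ≤ a / (32 * d) := by
    rw [le_div_iff₀ (by positivity)]
    have h5 : r2 * XL C B t x0 ≤ 4 * d * t * a := h3.trans m1
    have h6 : 128 * d^2 * t * a ≤ r2 * a := mul_le_mul_of_nonneg_right hr2 ha
    have : r2 * (XL C B t x0 * (32 * d)) ≤ r2 * a := by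
      calc r2 * (XL C B t x0 * (32 * d)) = (r2 * XL C B t x0) * (32 * d) := by ring
        _ ≤ (4 * d * t * a) * (32 * d) := by gcongr
        _ = 128 * d^2 * t * a := by ring
        _ ≤ _ := h6
    exact le_of_mul_le_mul_left this hr0
  set q := QI (C ∩ B) t (fun y => if 0 < ell i σ n y ∧ τ ≤ ell i σ n y then (1:ℝ) else 0) x0
  have h7 : a ≤ 32 * d * q := by
    have : a ≤ 16 * d * (q + a / (32 * d)) := m2.trans (by gcongr; linarith)
    have e : 16 * d * (a / (32 * d)) = a / 2 := by field_simp; ring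
    rw [mul_add, e] at this; linarith
  have h8 : a / (32 * d) ≤ a := div_le_self ha (by linarith)
  calc PP v x0 ≤ M * (a + XL C B t x0) := h1
    _ ≤ M * (2 * (32 * d * q)) := by gcongr; linarith
    _ = _ := by ring

/-- stage 2 : occupation in the small ball before leaving the big ball -/
theorem stage2 (hd : 5 ≤ d) (δ : ℝ) (hδ : 0 < δ) (hδ1 : δ < 1) : ∃ c J0 : ℝ, 0 < c ∧ 0 < J0 ∧ ∀ (x1 : V d) (R : ℝ), 1 ≤ R →
    32 * d ≤ R ^ 2 → ∀ (J : ℕ), J0 * R ^ 2 ≤ J →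
    ∀ y, nsq (y - x1) ≤ (1 - δ) * R ^ 2 →
    c * R ^ 2 ≤ ∑ j ∈ Finset.range J, QI {x | nsq (x - x1) < R ^ 2} j (fun z => if nsq (z - x1) ≤ R ^ 2 / 16 then 1 else 0) y := by
  have hd0 : (5:ℝ) ≤ d := by exact_mod_cast hd
  set lam : ℝ := 16 * d with hlam
  have hl0 : 0 < lam := by positivity
  set c1 : ℝ := Real.exp (-lam * (1 - δ)) - Real.exp (-lam) with hc1
  have hc1p : 0 < c1 := by
    rw [hc1, sub_pos]; apply Real.exp_lt_exp.2; nlinarith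
  refine ⟨c1 / lam / 2, 8 / c1, by positivity, by positivity, ?_⟩
  intro x1 R hR hR2 J hJ y hy
  have hRp : 0 < R := by linarith
  set β := lam / R ^ 2 with hβ
  have hβ0 : 0 < β := by positivity
  have hβ2 : β ≤ 1/2 := by rw [hβ, div_le_iff₀ (by positivity)]; rw [hlam]; linarith
  set U := {x : V d | nsq (x - x1) < R ^ 2} with hU
  set φ : V d → ℝ := fun x => (gau β x1 x - Real.exp (-lam)) / β with hφ
  have hφU : ∀ x, x ∉ U → φ x ≤ 0 := by
    intro x hx
    have : R ^ 2 ≤ nsq (x - x1) := not_lt.1 hx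
    simp only [hφ]
    apply div_nonpos_of_nonpos_of_nonneg _ hβ0.le
    unfold gau
    rw [sub_nonpos]; apply Real.exp_le_exp.2
    have : β * R^2 ≤ β * nsq (x - x1) := by gcongr
    have e : β * R^2 = lam := by rw [hβ]; field_simp
    linarith
  have hPφ : ∀ x, PP φ x = (PP (gau β x1) x - Real.exp (-lam)) / β := by
    intro x
    have h1 : φ = fun x => β⁻¹ * ((fun x => gau β x1 x - (fun _ => Real.exp (-lam)) x) x) := by
      ext x; simp only [hφ]; rw [div_eq_inv_mul]
    rw [h1, PP_smul, PP_sub, PP_const hd]; rw [div_eq_inv_mul]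
  have hsub : ∀ x ∈ U, φ x ≤ (if nsq (x - x1) ≤ R ^ 2 / 16 then 1 else 0) + QC U φ x := by
    intro x hx
    have h1 : PP φ x ≤ QC U φ x := by
      unfold QC; apply PP_mono; intro z
      by_cases hz : z ∈ U
      · rw [Set.indicator_of_mem hz]
      · rw [Set.indicator_of_notMem hz]; exact hφU z hz
    rw [hPφ] at h1
    split_ifs with h
    · have h2 := gau_super hd hβ0.le x1 x
      have h3 : φ x - (PP (gau β x1) x - Real.exp (-lam)) / β ≤ 1 := by
        simp only [hφ]; rw [← sub_div, div_le_one hβ0]; linarith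
      linarith
    · have h2 := gau_sub hd hβ0 hβ2 x1 x (by
        push Not at h
        have e : d / β = R^2/16 := by rw [hβ, hlam]; field_simp
        rw [e]; exact h.le)
      have h3 : φ x ≤ (PP (gau β x1) x - Real.exp (-lam)) / β := by
        simp only [hφ]; gcongr
      linarith
  have hyU : y ∈ U := by
    have : (1 - δ) * R^2 < R^2 := by nlinarith [sq_nonneg R, pow_pos hRp 2]
    exact lt_of_le_of_lt hy this
  have hle := le_sum_QI hsub J y hyU
  have hφle : ∀ x, φ x ≤ (1/β) * 1 := by
    intro x; simp only [hφ, mul_one]; gcongr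
    have := gau_le_one hβ0.le x1 x
    have := Real.exp_pos (-lam); linarith
  have hJφ : QI U J φ y ≤ (1/β) * QI U J (fun _ => 1) y := by
    rw [← QI_smul]; exact QI_mono hφle J y
  have hW : ∑ j ∈ Finset.range J, QI U j (fun _ => 1) y ≤ (R+1)^2 - nsq (y - x1) := by
    refine sum_QI_le (C := U) (G := fun x => (R+1)^2 - nsq (x - x1)) ?_ ?_ J y hyU
    · intro x hx
      have : nsq (x - x1) < R^2 := hx
      have : R^2 ≤ (R+1)^2 := by nlinarith
      linarith
    · intro x hx
      have hx' : nsq (x - x1) < R^2 := hx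
      have h1 : QC U (fun x => (R+1)^2 - nsq (x - x1)) x ≤ PP (fun x => (R+1)^2 - nsq (x - x1)) x := by
        apply PP_mono_at
        have key : ∀ z : V d, nsq (z - x1) ≤ (R+1)^2 → U.indicator (fun x => (R+1)^2 - nsq (x - x1)) z ≤ (R+1)^2 - nsq (z - x1) := by
          intro z hz
          by_cases hzU : z ∈ U
          · rw [Set.indicator_of_mem hzU]
          · rw [Set.indicator_of_notMem hzU]; linarith
        intro k
        have hb : |(((x - x1) k : ℤ):ℝ)| ≤ R := by
          have := sq_le_nsq (x - x1) k
          exact abs_le_of_sq_le_sq (by linarith) hRp.le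
        have hb' := abs_le.1 hb
        constructor
        · apply key
          rw [add_sub_right_comm, nsq_add_ev]; nlinarith
        · apply key
          rw [sub_right_comm, nsq_sub_ev]; nlinarith
      have h2 : PP (fun x => (R+1)^2 - nsq (x - x1)) x = (R+1)^2 - (nsq (x - x1) + 1) := by
        rw [PP_sub (fun _ => (R+1)^2) (fun x => nsq (x - x1)), PP_const hd, PP_nsq hd]
      rw [h2] at h1; linarith
  have hJ1 : J * QI U J (fun _ => 1) y ≤ 4 * R^2 := by
    have := Finset.card_nsmul_le_sum (Finset.range J) (fun j => QI U j (fun _ => 1) y) (QI U J (fun _ => 1) y)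
      (fun r hr => QI_one_anti' hd U y (Finset.mem_range.1 hr).le)
    simp at this
    have h0 := nsq_nonneg (y - x1)
    nlinarith
  have hq : QI U J (fun _ => 1) y ≤ c1 / 2 := by
    have h1 : (8 / c1 * R^2) * QI U J (fun _ => 1) y ≤ 4 * R^2 :=
      (mul_le_mul_of_nonneg_right hJ (QI_nonneg (fun _ => zero_le_one) J y)).trans hJ1
    have h2 : (8 / c1 * R^2) * QI U J (fun _ => 1) y ≤ (8 / c1 * R^2) * (c1/2) := by
      have : (8 / c1 * R^2) * (c1/2) = 4 * R^2 := by field_simp; norm_num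
      linarith
    exact le_of_mul_le_mul_left h2 (by positivity)
  have hφy : c1 / β ≤ φ y := by
    simp only [hφ, hc1]; unfold gau
    apply div_le_div_of_nonneg_right _ hβ0.le
    apply sub_le_sub_right
    apply Real.exp_le_exp.2
    have : β * nsq (y - x1) ≤ β * ((1-δ) * R^2) := by gcongr
    have e : β * ((1-δ) * R^2) = lam * (1 - δ) := by rw [hβ]; field_simp
    linarith
  have hfin : 1/β * QI U J (fun _ => 1) y ≤ 1/β * (c1/2) := by gcongr
  have e : c1 / lam / 2 * R^2 = c1/β - 1/β * (c1/2) := by rw [hβ]; field_simp; ring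
  rw [e]; linarith

/-- set depending on coordinates `≤ s` only -/
def Dep (s : ℕ) (Γ : Set (ℕ → V d)) : Prop := ∀ ω ω' : ℕ → V d, (∀ i ≤ s, ω i = ω' i) → (ω ∈ Γ → ω' ∈ Γ)

lemma Dep.iff {s : ℕ} {Γ : Set (ℕ → V d)} (h : Dep s Γ) {ω ω' : ℕ → V d} (e : ∀ i ≤ s, ω i = ω' i) :
    ω ∈ Γ ↔ ω' ∈ Γ := ⟨h ω ω' e, h ω' ω (fun i hi => (e i hi).symm)⟩

lemma Dep.meas {s : ℕ} {Γ : Set (ℕ → V d)} (h : Dep s Γ) : MeasurableSet Γ := by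
  let π : (ℕ → V d) → (Fin (s+1) → V d) := fun ω i => ω i
  have hπ : Measurable π := measurable_pi_lambda _ fun i => measurable_pi_apply _
  have : Γ = π ⁻¹' (π '' Γ) := by
    ext ω
    constructor
    · intro hω; exact ⟨ω, hω, rfl⟩
    · rintro ⟨ω', hω', e⟩
      refine h ω' ω (fun i hi => ?_) hω'
      exact congrFun e ⟨i, by omega⟩
  rw [this]
  exact hπ (Set.to_countable _).measurableSet

def cyl (n : ℕ) (γ : ℕ → V d) : Set (ℕ → V d) := { ω | ∀ i ≤ n, ω i = γ i }

lemma cyl_dep (n : ℕ) (γ : ℕ → V d) : Dep n (cyl n γ) :=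
  fun ω ω' e h i hi => by rw [← e i hi]; exact h i hi

def ext (n : ℕ) (γ : Fin (n+1) → V d) : ℕ → V d := fun i => if h : i < n+1 then γ ⟨i, h⟩ else 0

lemma mem_cyl_ext (n : ℕ) (ω : ℕ → V d) : ω ∈ cyl n (ext n fun i => ω i) := by
  intro i hi; unfold ext; rw [dif_pos (by omega)]

lemma meas_uniq (ν ν' : Measure (ℕ → V d)) [IsFiniteMeasure ν] [IsFiniteMeasure ν']
    (h : ∀ n γ, ν (cyl n γ) = ν' (cyl n γ)) : ν = ν' := by
  have huniv : ν Set.univ = ν' Set.univ := by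
    have e : (Set.univ : Set (ℕ → V d)) = ⋃ x : V d, cyl 0 (fun _ => x) := by
      ext ω; simp [cyl]
    rw [e, measure_iUnion, measure_iUnion]
    · exact tsum_congr fun x => h _ _
    · intro x y hxy; rw [Function.onFun, Set.disjoint_left]; intro ω h1 h2
      exact hxy ((h1 0 le_rfl).symm.trans (h2 0 le_rfl))
    · exact fun x => (cyl_dep _ _).meas
    · intro x y hxy; rw [Function.onFun, Set.disjoint_left]; intro ω h1 h2
      exact hxy ((h1 0 le_rfl).symm.trans (h2 0 le_rfl))
    · exact fun x => (cyl_dep _ _).meas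
  refine ext_of_generate_finite (insert ∅ {s | ∃ n γ, s = cyl n γ}) ?_ ?_ ?_ huniv
  · apply le_antisymm
    · apply iSup_le
      intro k
      rintro _ ⟨t, ht, rfl⟩
      have : (fun b : ℕ → V d => b k) ⁻¹' t = ⋃ γ : {γ : Fin (k+1) → V d // γ (Fin.last k) ∈ t}, cyl k (ext k γ.1) := by
        ext ω
        simp only [Set.mem_preimage, Set.mem_iUnion]
        constructor
        · intro hω; exact ⟨⟨fun i => ω i, hω⟩, mem_cyl_ext k ω⟩
        · rintro ⟨γ, hγ⟩
          have := hγ k le_rfl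
          unfold ext at this; rw [dif_pos (by omega)] at this
          rw [this]; exact γ.2
      rw [this]
      exact MeasurableSet.iUnion fun γ => MeasurableSpace.measurableSet_generateFrom (Or.inr ⟨_, _, rfl⟩)
    · apply MeasurableSpace.generateFrom_le
      rintro t (rfl | ⟨n, γ, rfl⟩)
      · exact MeasurableSet.empty
      · exact (cyl_dep _ _).meas
  · rintro s (rfl | ⟨n, γ, rfl⟩) t (rfl | ⟨n', γ', rfl⟩) hst
    · simp at hst
    · simp at hst
    · simp at hst
    · right
      obtain ⟨ω, h1, h2⟩ := hst
      refine ⟨max n n', ω, ?_⟩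
      ext ω'
      constructor
      · rintro ⟨h3, h4⟩ i hi
        rcases le_max_iff.1 hi with hi | hi
        · rw [h3 i hi, h1 i hi]
        · rw [h4 i hi, h2 i hi]
      · intro h3
        exact ⟨fun i hi => by rw [h3 i (hi.trans (le_max_left _ _)), h1 i hi],
          fun i hi => by rw [h3 i (hi.trans (le_max_right _ _)), h2 i hi]⟩
  · rintro s (rfl | ⟨n, γ, rfl⟩)
    · simp
    · exact h n γ

def st (p : Fin d × Bool) : V d := if p.2 then ev p.1 else - ev p.1

lemma adj_iff_st (x y : V d) : adj x y ↔ ∃ p, y = x + st p := by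
  constructor
  · intro h
    unfold adj at h
    have h1 : ∃ i, |x i - y i| = 1 := by
      by_contra! hc
      have : ∃ i, |x i - y i| ≠ 0 := by
        by_contra! h0; simp [h0] at h
      obtain ⟨i, hi⟩ := this
      have h2 := Finset.single_le_sum (f := fun i => |x i - y i|) (fun j _ => abs_nonneg _) (Finset.mem_univ i)
      have h3 := abs_nonneg (x i - y i)
      have := hc i
      omega
    obtain ⟨i, hi⟩ := h1
    have h0 : ∀ j, j ≠ i → x j = y j := by
      intro j hj
      have h2 := Finset.add_le_sum (f := fun i => |x i - y i|) (s := Finset.univ) (fun j _ => abs_nonneg _) (Finset.mem_univ i) (Finset.mem_univ j) hj.symm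
      have := abs_nonneg (x j - y j)
      have h3 : |x j - y j| = 0 := by omega
      rw [abs_eq_zero] at h3; omega
    rcases (abs_eq zero_le_one).1 hi with h2 | h2
    · refine ⟨(i, false), ?_⟩
      ext j
      by_cases hj : j = i
      · subst hj; simp [st, ev_apply]; omega
      · simp [st, ev_apply, hj, h0 j hj]
    · refine ⟨(i, true), ?_⟩
      ext j
      by_cases hj : j = i
      · subst hj; simp [st, ev_apply]; omega
      · simp [st, ev_apply, hj, h0 j hj]
  · rintro ⟨⟨i, b⟩, rfl⟩
    unfold adj
    rw [Finset.sum_eq_single i]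
    · cases b <;> simp [st, ev_apply]
    · intro j _ hj; cases b <;> simp [st, ev_apply, hj]
    · simp

lemma st_inj : Function.Injective (st : Fin d × Bool → V d) := by
  rintro ⟨i, b⟩ ⟨j, c⟩ h
  have h1 := congrFun h i
  have h2 := congrFun h j
  by_cases hij : i = j
  · subst hij
    cases b <;> cases c <;> simp [st, ev_apply] at h1 ⊢
  · cases b <;> cases c <;> simp [st, ev_apply, hij] at h1

lemma PP_eq_st (f : V d → ℝ) (x : V d) : PP f x = (∑ p : Fin d × Bool, f (x + st p)) / (2 * d) := by
  unfold PP
  rw [Fintype.sum_prod_type]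
  congr 1
  exact Finset.sum_congr rfl fun i _ => by simp [st, sub_eq_add_neg]

section law
variable {μ : Measure (ℕ → V d)}

lemma ae_zero (hμ : IsSRWLaw μ 0) : ∀ᵐ ω ∂μ, ω 0 = 0 := by
  have := hμ.1
  have h := hμ.2 0 (fun _ => 0) rfl (by simp)
  rw [pow_zero] at h
  have : {ω : ℕ → V d | ∀ i ≤ 0, ω i = 0} = {ω | ω 0 = 0} := by ext ω; simp
  rw [this] at h
  exact (prob_compl_eq_zero_iff (by simpa [cyl] using (cyl_dep (d := d) 0 (fun _ => 0)).meas)).2 h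

lemma ae_nn_aux (hd : 5 ≤ d) (hμ : IsSRWLaw μ 0) (n : ℕ) : ∀ᵐ ω ∂μ, ω 0 = 0 ∧ ∀ i < n, adj (ω i) (ω (i+1)) := by
  have := hμ.1
  induction n with
  | zero => filter_upwards [ae_zero hμ] with ω h; exact ⟨h, by simp⟩
  | succ n ih =>
    have key : ∀ γ : Fin (n+1) → V d, ∀ᵐ ω ∂μ, ω ∈ cyl n (ext n γ) → (ω 0 = 0 ∧ ∀ i < n, adj (ω i) (ω (i+1))) →
        adj (ω n) (ω (n+1)) := by
      intro γ
      by_cases hγ : ext n γ 0 = 0 ∧ ∀ i < n, adj (ext n γ i) (ext n γ (i+1))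
      · set g := ext n γ
        let G : Fin d × Bool → ℕ → V d := fun p i => if i ≤ n then g i else g n + st p
        have hG : ∀ p, μ (cyl (n+1) (G p)) = (2 * (d : ℝ≥0∞))⁻¹ ^ (n+1) := by
          intro p
          apply hμ.2
          · simp [G, hγ.1]
          · intro i hi
            simp only [G]
            rw [if_pos (by omega)]
            split_ifs with h
            · exact hγ.2 i (by omega)
            · have : i = n := by omega
              subst this; rw [adj_iff_st]; exact ⟨p, rfl⟩
        have hU : μ (⋃ p, cyl (n+1) (G p)) = (2 * (d : ℝ≥0∞))⁻¹ ^ n := by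
          rw [measure_iUnion]
          · rw [tsum_fintype]; simp only [hG]
            rw [Finset.sum_const, Finset.card_univ, Fintype.card_prod, Fintype.card_fin, Fintype.card_bool,
              nsmul_eq_mul, pow_succ, mul_comm _ ((2 * (d : ℝ≥0∞))⁻¹), ← mul_assoc]
            push_cast
            rw [mul_comm (d:ℝ≥0∞) 2, ENNReal.mul_inv_cancel, one_mul]
            · have : (d:ℝ≥0∞) ≠ 0 := by simp; omega
              simp [this]
            · exact ENNReal.mul_ne_top (by simp) (by simp)
          · intro p p' hp; rw [Function.onFun, Set.disjoint_left]; intro ω h1 h2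
            have := (h1 (n+1) le_rfl).symm.trans (h2 (n+1) le_rfl)
            simp only [G] at this
            rw [if_neg (by omega), if_neg (by omega)] at this
            exact hp (st_inj (add_left_cancel this))
          · exact fun p => (cyl_dep _ _).meas
        have hc : μ (cyl n g) = (2 * (d : ℝ≥0∞))⁻¹ ^ n := hμ.2 n g hγ.1 hγ.2
        have hsub : (⋃ p, cyl (n+1) (G p)) ⊆ cyl n g := by
          intro ω hω i hi
          obtain ⟨p, hp⟩ := Set.mem_iUnion.1 hω
          have := hp i (by omega)
          simpa [G, hi] using this
        have hae := ae_eq_of_subset_of_measure_ge hsub (by rw [hU, hc])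
          (MeasurableSet.iUnion fun p => (cyl_dep _ _).meas).nullMeasurableSet (measure_ne_top _ _)
        filter_upwards [hae.mem_iff] with ω hω h1 _
        obtain ⟨p, hp⟩ := Set.mem_iUnion.1 (hω.2 h1)
        rw [adj_iff_st]
        refine ⟨p, ?_⟩
        have e1 := hp (n+1) le_rfl
        have e2 := hp n (by omega)
        simp only [G] at e1 e2
        rw [if_neg (by omega)] at e1; rw [if_pos le_rfl] at e2
        rw [e1, e2]
      · refine Filter.Eventually.of_forall fun ω h1 h2 => ?_
        exfalso; apply hγ
        refine ⟨by rw [← h1 0 (by omega)]; exact h2.1, fun i hi => ?_⟩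
        rw [← h1 i (by omega), ← h1 (i+1) (by omega)]; exact h2.2 i hi
    filter_upwards [ih, ae_all_iff.2 key] with ω h1 h2
    refine ⟨h1.1, fun i hi => ?_⟩
    rcases Nat.lt_succ_iff_lt_or_eq.1 hi with h | h
    · exact h1.2 i h
    · subst h; exact h2 _ (mem_cyl_ext i ω) h1

lemma ae_nn (hd : 5 ≤ d) (hμ : IsSRWLaw μ 0) : ∀ᵐ ω ∂μ, ω 0 = 0 ∧ ∀ i, adj (ω i) (ω (i+1)) := by
  filter_upwards [ae_zero hμ, ae_all_iff.2 (ae_nn_aux hd hμ)] with ω h1 h2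
  exact ⟨h1, fun i => (h2 (i+1)).2 i (by omega)⟩

def pth (x : V d) (ω : ℕ → V d) : ℕ → V d := fun j => x + ω j
def sh (s : ℕ) (ω : ℕ → V d) : ℕ → V d := fun j => ω (s + j)

lemma pth_meas (x : V d) : Measurable (pth x) :=
  measurable_pi_lambda _ fun i => (measurable_of_countable (fun y : V d => x + y)).comp (measurable_pi_apply i)

lemma sh_meas (s : ℕ) : Measurable (sh s : (ℕ → V d) → ℕ → V d) :=
  measurable_pi_lambda _ fun i => measurable_pi_apply _

noncomputable def q (μ : Measure (ℕ → V d)) (F : Set (ℕ → V d)) (x : V d) : ℝ := μ.real (pth x ⁻¹' F)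

lemma cyl_zero (hd : 5 ≤ d) (hμ : IsSRWLaw μ 0) (n : ℕ) (γ : ℕ → V d)
    (h : ¬ (γ 0 = 0 ∧ ∀ i < n, adj (γ i) (γ (i+1)))) : μ (cyl n γ) = 0 := by
  refine measure_mono_null (t := {ω | ¬ (ω 0 = 0 ∧ ∀ i, adj (ω i) (ω (i+1)))}) ?_ (ae_nn hd hμ)
  intro ω hω hc
  apply h
  refine ⟨by rw [← hω 0 (by omega)]; exact hc.1, fun i hi => ?_⟩
  rw [← hω i (by omega), ← hω (i+1) (by omega)]; exact hc.2 i

lemma adj_add_left (z x y : V d) : adj (z + x) (z + y) ↔ adj x y := by simp [adj]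

lemma law_shift (hd : 5 ≤ d) (hμ : IsSRWLaw μ 0) :
    μ.map (sh 1) = (2 * (d : ℝ≥0∞))⁻¹ • ∑ p : Fin d × Bool, μ.map (pth (st p)) := by
  have := hμ.1
  have hd0 : (d:ℝ≥0∞) ≠ 0 := by simp; omega
  have h2d : 2 * (d : ℝ≥0∞) ≠ 0 := by simp [hd0]
  have h2d' : 2 * (d : ℝ≥0∞) ≠ ⊤ := ENNReal.mul_ne_top (by simp) (by simp)
  have : ∀ p : Fin d × Bool, IsFiniteMeasure (μ.map (pth (st p))) := fun p => inferInstance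
  have : IsFiniteMeasure ((2 * (d : ℝ≥0∞))⁻¹ • ∑ p : Fin d × Bool, μ.map (pth (st p))) := by
    apply Measure.smul_finite
    simp [hd0]
  apply meas_uniq
  intro n γ
  rw [Measure.map_apply (sh_meas 1) (cyl_dep _ _).meas, Measure.smul_apply, Measure.finsetSum_apply]
  have e1 : ∀ p, μ.map (pth (st p)) (cyl n γ) = μ (cyl n (fun i => γ i - st p)) := by
    intro p
    rw [Measure.map_apply (pth_meas _) (cyl_dep _ _).meas]
    congr 1; ext ω
    exact forall₂_congr fun i hi => by unfold pth; rw [eq_sub_iff_add_eq']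
  simp only [e1]
  let γ' : ℕ → V d := fun i => if i = 0 then 0 else γ (i-1)
  have e2 : μ (sh 1 ⁻¹' cyl n γ) = μ (cyl (n+1) γ') := by
    apply measure_congr
    filter_upwards [ae_zero hμ] with ω hω
    apply propext
    constructor
    · intro h i hi
      rcases i with _ | i
      · simp [γ', hω]
      · have := h i (by omega)
        simp only [γ']; rw [if_neg (by omega)]; simp only [sh] at this
        rw [add_comm]; rw [add_comm] at this; simpa [add_comm] using this
    · intro h i hi
      have := h (i+1) (by omega)
      simp only [γ'] at this; rw [if_neg (by omega)] at this
      simp only [sh]; rw [add_comm]; simpa using this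
  rw [e2]
  by_cases h : ∃ p, γ 0 = st p ∧ ∀ i < n, adj (γ i) (γ (i+1))
  · obtain ⟨p, hp, hγ⟩ := h
    have e3 : μ (cyl (n+1) γ') = (2 * (d : ℝ≥0∞))⁻¹ ^ (n+1) := by
      apply hμ.2
      · simp [γ']
      · intro i hi
        rcases i with _ | i
        · simp only [γ']; rw [if_pos trivial, if_neg (by omega), adj_iff_st]; exact ⟨p, by simpa using hp⟩
        · simp only [γ']; rw [if_neg (by omega), if_neg (by omega)]; exact hγ i (by omega)
    rw [e3, Finset.sum_eq_single p]
    · have : μ (cyl n (fun i => γ i - st p)) = (2 * (d : ℝ≥0∞))⁻¹ ^ n := by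
        apply hμ.2
        · simp [hp]
        · intro i hi; have := hγ i hi; simpa [adj] using this
      rw [this, pow_succ, smul_eq_mul, mul_comm]
    · intro p' _ hp'
      apply cyl_zero hd hμ
      rintro ⟨h1, -⟩
      rw [hp, sub_eq_zero] at h1; exact hp' (st_inj h1.symm)
    · simp
  · rw [cyl_zero hd hμ (n+1) γ', Finset.sum_eq_zero]
    · simp
    · intro p _
      apply cyl_zero hd hμ
      rintro ⟨h1, h2⟩
      apply h
      refine ⟨p, by simpa [sub_eq_zero] using h1, fun i hi => ?_⟩
      have := h2 i hi; simpa [adj] using this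
    · rintro ⟨-, h2⟩
      apply h
      have h0 := h2 0 (by omega)
      simp only [γ'] at h0; rw [if_pos trivial, if_neg (by omega), adj_iff_st] at h0
      obtain ⟨p, hp⟩ := h0
      refine ⟨p, by simpa using hp, fun i hi => ?_⟩
      have := h2 (i+1) (by omega)
      simp only [γ'] at this; rw [if_neg (by omega), if_neg (by omega)] at this; exact this

end law

section law
variable {μ : Measure (ℕ → V d)}

lemma q_nonneg (F : Set (ℕ → V d)) (x : V d) : 0 ≤ q μ F x := measureReal_nonneg
lemma q_le_one (hμ : IsSRWLaw μ 0) (F : Set (ℕ → V d)) (x : V d) : q μ F x ≤ 1 := by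
  have := hμ.1
  exact measureReal_le_one
lemma q_univ (hμ : IsSRWLaw μ 0) (x : V d) : q μ Set.univ x = 1 := by
  have := hμ.1
  simp [q]

lemma q_mono' (hd : 5 ≤ d) (hμ : IsSRWLaw μ 0) {F F' : Set (ℕ → V d)} (x : V d)
    (h : ∀ ω, ω 0 = x → (∀ i, adj (ω i) (ω (i+1))) → ω ∈ F → ω ∈ F') : q μ F x ≤ q μ F' x := by
  have := hμ.1
  unfold q
  rw [measureReal_def, measureReal_def]
  apply ENNReal.toReal_mono (measure_ne_top _ _)
  apply measure_mono_ae
  filter_upwards [ae_nn hd hμ] with ω hω hF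
  refine h (pth x ω) ?_ ?_ hF
  · simp [pth, hω.1]
  · intro i; exact (adj_add_left _ _ _).2 (hω.2 i)

lemma q_congr' (hd : 5 ≤ d) (hμ : IsSRWLaw μ 0) {F F' : Set (ℕ → V d)} (x : V d)
    (h : ∀ ω, ω 0 = x → (∀ i, adj (ω i) (ω (i+1))) → (ω ∈ F ↔ ω ∈ F')) : q μ F x = q μ F' x :=
  le_antisymm (q_mono' hd hμ x fun ω h1 h2 => (h ω h1 h2).1) (q_mono' hd hμ x fun ω h1 h2 => (h ω h1 h2).2)

lemma q_mono (hμ : IsSRWLaw μ 0) {F F' : Set (ℕ → V d)} (h : F ⊆ F') (x : V d) : q μ F x ≤ q μ F' x := by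
  have := hμ.1
  exact measureReal_mono (Set.preimage_mono h)

lemma q_union_le (F F' : Set (ℕ → V d)) (x : V d) : q μ (F ∪ F') x ≤ q μ F x + q μ F' x := by
  unfold q; rw [Set.preimage_union]; exact measureReal_union_le _ _

lemma q_biUnion_le (hμ : IsSRWLaw μ 0) {ι : Type*} (s : Finset ι) (F : ι → Set (ℕ → V d)) (x : V d) :
    q μ (⋃ i ∈ s, F i) x ≤ ∑ i ∈ s, q μ (F i) x := by
  induction s using Finset.induction_on with
  | empty => simp [q]
  | insert a s ha ih =>
    rw [Finset.set_biUnion_insert, Finset.sum_insert ha]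
    exact (q_union_le _ _ x).trans (by linarith)

lemma q_step (hd : 5 ≤ d) (hμ : IsSRWLaw μ 0) {F : Set (ℕ → V d)} (hF : MeasurableSet F) (x : V d) :
    q μ (sh 1 ⁻¹' F) x = PP (q μ F) x := by
  have := hμ.1
  have hd0 : (d:ℝ) ≠ 0 := by exact_mod_cast (by omega : d ≠ 0)
  have hd0' : (d:ℝ≥0∞) ≠ 0 := by simp; omega
  have hm := pth_meas x hF
  have e1 : pth x ⁻¹' (sh 1 ⁻¹' F) = sh 1 ⁻¹' (pth x ⁻¹' F) := rfl
  have e2 : ∀ p, μ.map (pth (st p)) (pth x ⁻¹' F) = μ (pth (x + st p) ⁻¹' F) := by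
    intro p
    rw [Measure.map_apply (pth_meas _) hm]
    congr 1; ext ω; simp only [Set.mem_preimage]
    have : pth x (pth (st p) ω) = pth (x + st p) ω := by ext1 j; simp [pth, add_assoc]
    rw [this]
  unfold q
  rw [PP_eq_st, e1, measureReal_def, ← Measure.map_apply (sh_meas 1) hm, law_shift hd hμ,
    Measure.smul_apply, Measure.finsetSum_apply]
  simp only [e2]
  rw [smul_eq_mul, ENNReal.toReal_mul, ENNReal.toReal_sum (fun p _ => measure_ne_top _ _)]
  simp only [measureReal_def]
  rw [ENNReal.toReal_inv, ENNReal.toReal_mul]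
  simp [div_eq_inv_mul]

lemma q_ind (hd : 5 ≤ d) (hμ : IsSRWLaw μ 0) (C : Set (V d)) (F : Set (ℕ → V d)) (x : V d) :
    q μ ({ω | ω 0 ∈ C} ∩ F) x = C.indicator (q μ F) x := by
  by_cases hx : x ∈ C
  · rw [Set.indicator_of_mem hx]
    apply q_congr' hd hμ; intro ω h1 _
    simp [h1, hx]
  · rw [Set.indicator_of_notMem hx]
    have : q μ ({ω | ω 0 ∈ C} ∩ F) x = q μ ∅ x := by
      apply q_congr' hd hμ; intro ω h1 _; simp [h1, hx]
    rw [this]; simp [q]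

/-- prepend -/
def cns (x : V d) (ω : ℕ → V d) : ℕ → V d := fun i => if i = 0 then x else ω (i-1)

lemma cns_sh (ω : ℕ → V d) : cns (ω 0) (sh 1 ω) = ω := by
  ext1 i; unfold cns sh
  split_ifs with h
  · rw [h]
  · congr 1; omega

lemma q_markov (hd : 5 ≤ d) (hμ : IsSRWLaw μ 0) {F F' : Set (ℕ → V d)} (hF : MeasurableSet F) (hF' : MeasurableSet F')
    (c : ℝ) (s : ℕ) : ∀ (Γ : Set (ℕ → V d)), Dep s Γ → (∀ ω ∈ Γ, q μ F (ω s) ≤ c * q μ F' (ω s)) → ∀ x,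
    q μ (Γ ∩ sh s ⁻¹' F) x ≤ c * q μ (Γ ∩ sh s ⁻¹' F') x := by
  induction s with
  | zero =>
    intro Γ hΓ h x
    have e0 : ∀ F : Set (ℕ → V d), sh 0 ⁻¹' F = F := by
      intro F; ext ω; simp only [Set.mem_preimage]
      have : sh 0 ω = ω := by ext1 j; simp [sh]
      rw [this]
    have e : ∀ F, q μ (Γ ∩ sh 0 ⁻¹' F) x = Set.indicator {x | (fun _ => x) ∈ Γ} (q μ F) x := by
      intro F
      rw [e0, ← q_ind hd hμ]
      apply q_congr' hd hμ; intro ω h1 _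
      have : ω ∈ Γ ↔ (fun _ => ω 0) ∈ Γ := hΓ.iff (by intro i hi; rw [Nat.le_zero.1 hi])
      simp [this]
    rw [e, e]
    by_cases hx : (fun _ => x) ∈ Γ
    · rw [Set.indicator_of_mem (by exact hx), Set.indicator_of_mem (by exact hx)]; exact h _ hx
    · rw [Set.indicator_of_notMem (by exact hx), Set.indicator_of_notMem (by exact hx)]; simp
  | succ s ih =>
    intro Γ hΓ h x
    set Γx : Set (ℕ → V d) := {ω | cns x ω ∈ Γ}
    have hdep : Dep s Γx := by
      intro ω ω' e hω
      refine hΓ _ _ ?_ hω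
      intro i hi; unfold cns; split_ifs with h0
      · rfl
      · exact e _ (by omega)
    have e : ∀ F, MeasurableSet F → q μ (Γ ∩ sh (s+1) ⁻¹' F) x = PP (q μ (Γx ∩ sh s ⁻¹' F)) x := by
      intro F hF
      rw [← q_step hd hμ (hdep.meas.inter (sh_meas s hF))]
      apply q_congr' hd hμ; intro ω h1 _
      have h3 : cns x (sh 1 ω) = ω := by rw [← h1]; exact cns_sh ω
      have h4 : sh s (sh 1 ω) = sh (s+1) ω := by ext1 j; simp [sh]; congr 1; ring
      simp [Γx, h3, h4]
    rw [e F hF, e F' hF', ← PP_smul]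
    apply PP_mono
    intro y
    apply ih Γx hdep
    intro ω hω
    have := h _ hω
    simpa [cns] using this

lemma q_markov_le (hd : 5 ≤ d) (hμ : IsSRWLaw μ 0) {F : Set (ℕ → V d)} (hF : MeasurableSet F)
    (c : ℝ) (s : ℕ) (Γ : Set (ℕ → V d)) (hΓ : Dep s Γ) (h : ∀ ω ∈ Γ, q μ F (ω s) ≤ c) (x : V d) :
    q μ (Γ ∩ sh s ⁻¹' F) x ≤ c * q μ Γ x := by
  have := q_markov hd hμ hF MeasurableSet.univ c s Γ hΓ (fun ω hω => by rw [q_univ hμ]; simpa using h ω hω) x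
  simpa using this

lemma q_markov_ge (hd : 5 ≤ d) (hμ : IsSRWLaw μ 0) {F : Set (ℕ → V d)} (hF : MeasurableSet F)
    (c : ℝ) (hc : 0 < c) (s : ℕ) (Γ : Set (ℕ → V d)) (hΓ : Dep s Γ) (h : ∀ ω ∈ Γ, c ≤ q μ F (ω s)) (x : V d) :
    c * q μ Γ x ≤ q μ (Γ ∩ sh s ⁻¹' F) x := by
  have := q_markov hd hμ MeasurableSet.univ hF c⁻¹ s Γ hΓ (fun ω hω => by
    rw [q_univ hμ, inv_mul_eq_div, one_le_div hc]; exact h ω hω) x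
  simp at this
  rwa [inv_mul_eq_div, le_div_iff₀' hc] at this

def stay (C : Set (V d)) (t : ℕ) : Set (ℕ → V d) := {ω | ∀ l, 1 ≤ l → l ≤ t → ω l ∈ C}

lemma stay_dep (C : Set (V d)) (t : ℕ) : Dep t (stay C t) := by
  intro ω ω' e h l h1 h2
  rw [← e l h2]; exact h l h1 h2

lemma q_stay (hd : 5 ≤ d) (hμ : IsSRWLaw μ 0) (C : Set (V d)) {F : Set (ℕ → V d)} (hF : MeasurableSet F) (t : ℕ) (x : V d) :
    q μ (stay C t ∩ sh t ⁻¹' F) x = QI C t (q μ F) x := by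
  induction t generalizing x with
  | zero =>
    rw [QI_zero]
    apply q_congr' hd hμ; intro ω h1 _
    have : sh 0 ω = ω := by ext1 j; simp [sh]
    simp [stay, this]
    intro h
    intro l h1 h2; omega
  | succ t ih =>
    rw [QI_succ, QC, ← funext (fun y => ih y)]
    rw [← funext (fun y => q_ind hd hμ C (stay C t ∩ sh t ⁻¹' F) y)]
    have hm : MeasurableSet ({ω : ℕ → V d | ω 0 ∈ C} ∩ (stay C t ∩ sh t ⁻¹' F)) :=
      (Dep.meas (s := 0) (by intro ω ω' e h; simpa [← e 0 le_rfl] using h)).inter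
        ((stay_dep C t).meas.inter (sh_meas t hF))
    rw [← q_step hd hμ hm]
    apply q_congr' hd hμ; intro ω h1 _
    have h4 : sh t (sh 1 ω) = sh (t+1) ω := by ext1 j; simp [sh]; congr 1; ring
    simp only [Set.mem_inter_iff, Set.mem_preimage, h4, Set.mem_setOf_eq, ← and_assoc]
    apply and_congr_left'
    constructor
    · intro h
      refine ⟨h 1 le_rfl (by omega), fun l h1 h2 => h (1 + l) (by omega) (by omega)⟩
    · rintro ⟨h2, h3⟩ l hl hl'
      rcases Nat.eq_or_lt_of_le hl with h | h
      · rw [← h]; exact h2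
      · have := h3 (l-1) (by omega) (by omega)
        simp only [sh] at this
        rwa [show 1 + (l-1) = l by omega] at this

lemma q_at (hd : 5 ≤ d) (hμ : IsSRWLaw μ 0) (k : ℕ) (x y : V d) : q μ {ω | ω k = y} x = pk k (x - y) := by
  have e : q μ {ω | ω k = y} x = q μ {ω | ω k = 0} (x - y) := by
    unfold q; congr 1; ext ω; simp only [pth, Set.mem_preimage, Set.mem_setOf_eq]
    rw [← sub_eq_zero]; constructor <;> intro h <;> rw [← h] <;> abel
  rw [e]
  have h0 : q μ {ω : ℕ → V d | ω 0 = 0} = dl := by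
    ext1 z
    have := q_ind hd hμ {0} Set.univ z
    simp only [Set.inter_univ, Set.mem_singleton_iff] at this
    rw [this]; unfold dl
    split_ifs with h
    · rw [Set.indicator_of_mem (by simp [h]), q_univ hμ]
    · rw [Set.indicator_of_notMem (by simp [h])]
  unfold pk
  rw [← h0, ← q_stay hd hμ _ (Dep.meas (s := 0) (by intro ω ω' e h; simpa [← e 0 le_rfl] using h))]
  apply q_congr' hd hμ; intro ω _ _
  simp [stay, sh]

lemma ae_transient (hd : 5 ≤ d) (hμ : IsSRWLaw μ 0) : ∀ᵐ ω ∂μ, ∀ x : V d, ∃ k, ∀ j, k ≤ j → ω j ≠ x := by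
  have := hμ.1
  rw [ae_all_iff]
  intro x
  have hs : Summable fun k => pk k (0 - x) := summable_of_sum_range_le (fun k => pk_nonneg k _) (fun n => pk_sum hd n _)
  have h1 : ∀ k, μ {ω | ω k = x} = ENNReal.ofReal (pk k (0 - x)) := by
    intro k
    rw [← q_at hd hμ k 0 x]; unfold q
    rw [ofReal_measureReal]
    congr 1; ext ω; simp [pth]
  have h2 : ∑' k, μ {ω | ω k = x} ≠ ⊤ := by
    simp only [h1]
    rw [← ENNReal.ofReal_tsum_of_nonneg (fun k => pk_nonneg k _) hs]
    exact ENNReal.ofReal_ne_top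
  filter_upwards [ae_eventually_notMem h2] with ω hω
  obtain ⟨k, hk⟩ := Filter.eventually_atTop.1 hω
  exact ⟨k, hk⟩

end law

section law
variable {μ : Measure (ℕ → V d)}

def Fav (α : Set (V d)) : Set (ℕ → V d) := {ω | ∀ j, ω j ∉ α}
noncomputable def vv (μ : Measure (ℕ → V d)) (α : Set (V d)) : V d → ℝ := q μ (Fav α)

lemma meas_at (k : ℕ) (S : Set (V d)) : MeasurableSet {ω : ℕ → V d | ω k ∈ S} :=
  Dep.meas (s := k) (fun ω ω' e h => by
    have h : ω k ∈ S := h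
    show ω' k ∈ S
    rwa [← e k le_rfl])

lemma Fav_meas (α : Set (V d)) : MeasurableSet (Fav α) := by
  have : Fav α = ⋂ j, {ω : ℕ → V d | ω j ∈ αᶜ} := by ext ω; simp [Fav]
  rw [this]; exact MeasurableSet.iInter fun j => meas_at j _

lemma vv_nonneg (α : Set (V d)) (x : V d) : 0 ≤ vv μ α x := q_nonneg _ _
lemma vv_eq (hd : 5 ≤ d) (hμ : IsSRWLaw μ 0) (α : Set (V d)) (x : V d) :
    vv μ α x = Set.indicator αᶜ (PP (vv μ α)) x := by
  have : Set.indicator αᶜ (PP (vv μ α)) x = q μ ({ω | ω 0 ∈ αᶜ} ∩ sh 1 ⁻¹' Fav α) x := by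
    rw [q_ind hd hμ]
    congr 1; ext1 y; rw [q_step hd hμ (Fav_meas α)]; rfl
  rw [this]
  apply q_congr' hd hμ; intro ω _ _
  constructor
  · intro h; exact ⟨h 0, fun j => h _⟩
  · rintro ⟨h1, h2⟩ j
    rcases j with _ | j
    · exact h1
    · have := h2 j; simpa [sh, add_comm] using this

lemma vv_harm (hd : 5 ≤ d) (hμ : IsSRWLaw μ 0) {α : Set (V d)} {x : V d} (hx : x ∉ α) :
    vv μ α x = PP (vv μ α) x := by
  have := vv_eq hd hμ α x
  rwa [Set.indicator_of_mem hx] at this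
lemma vv_zero (hd : 5 ≤ d) (hμ : IsSRWLaw μ 0) {α : Set (V d)} {x : V d} (hx : x ∈ α) :
    vv μ α x = 0 := by
  have := vv_eq hd hμ α x
  rwa [Set.indicator_of_notMem (by simpa using hx)] at this

noncomputable def wt (α : Set (V d)) : ℕ → V d → ℝ
  | 0 => fun x => if x ∈ α then 0 else 1
  | t + 1 => fun x => if x ∈ α then 0 else PP (wt α t) x

lemma wt_eq (hd : 5 ≤ d) (hμ : IsSRWLaw μ 0) (α : Set (V d)) (t : ℕ) (x : V d) :
    wt α t x = q μ {ω | ∀ j ≤ t, ω j ∉ α} x := by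
  induction t generalizing x with
  | zero =>
    have := q_ind hd hμ αᶜ Set.univ x
    have e : ({ω : ℕ → V d | ω 0 ∈ αᶜ} ∩ Set.univ) = {ω | ∀ j ≤ 0, ω j ∉ α} := by ext ω; simp
    rw [← e, this, wt]
    by_cases hx : x ∈ α
    · simp [hx]
    · simp [hx, q_univ hμ]
  | succ t ih =>
    have hm : MeasurableSet {ω : ℕ → V d | ∀ j ≤ t, ω j ∉ α} := Dep.meas (s := t) (fun ω ω' e h j hj => by
      rw [← e j hj]; exact h j hj)
    have e : q μ {ω | ∀ j ≤ t + 1, ω j ∉ α} x = q μ ({ω | ω 0 ∈ αᶜ} ∩ sh 1 ⁻¹' {ω | ∀ j ≤ t, ω j ∉ α}) x := by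
      apply q_congr' hd hμ; intro ω _ _
      constructor
      · intro h; exact ⟨h 0 (by omega), fun j hj => h _ (by omega)⟩
      · rintro ⟨h1, h2⟩ j hj
        rcases j with _ | j
        · exact h1
        · have := h2 j (by omega); simpa [sh, add_comm] using this
    rw [e, q_ind hd hμ, wt, funext (fun y => ih y)]
    by_cases hx : x ∈ α
    · simp [hx]
    · rw [Set.indicator_of_mem (by simpa using hx), q_step hd hμ hm]; simp only [if_neg hx]

lemma wt_tendsto (hd : 5 ≤ d) (hμ : IsSRWLaw μ 0) (α : Set (V d)) (x : V d) :
    Filter.Tendsto (fun t => wt α t x) Filter.atTop (nhds (vv μ α x)) := by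
  have := hμ.1
  simp only [wt_eq hd hμ]
  unfold vv q
  simp only [measureReal_def]
  refine (ENNReal.tendsto_toReal (measure_ne_top _ _)).comp ?_
  have e : pth x ⁻¹' Fav α = ⋂ t, pth x ⁻¹' {ω | ∀ j ≤ t, ω j ∉ α} := by
    ext ω; simp only [Set.mem_preimage, Fav, Set.mem_iInter, Set.mem_ofPred_eq]
    exact ⟨fun h t j _ => h j, fun h j => h j j le_rfl⟩
  rw [e]
  apply tendsto_measure_iInter_atTop
  · intro t
    have hm : MeasurableSet {ω : ℕ → V d | ∀ j ≤ t, ω j ∉ α} := Dep.meas (s := t) (fun ω ω' e h j hj => by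
      rw [← e j hj]; exact h j hj)
    exact (pth_meas x hm).nullMeasurableSet
  · intro s t hst ω h j hj; exact h j (hj.trans hst)
  · exact ⟨0, measure_ne_top _ _⟩

lemma wt_refl (i : Fin d) {σ n : ℤ} (hσ : σ = 1 ∨ σ = -1) (α : Set (V d))
    (hα : ∀ x ∈ α, ell i σ n x ≤ 0) (t : ℕ) : ∀ z, ell i σ n z ≤ 0 → wt α t z ≤ wt α t (io i σ n 0 z) := by
  have hnot : ∀ z, ell i σ n z < 0 → io i σ n 0 z ∉ α := by
    intro z hz h
    have := hα _ h
    rw [ell_io i hσ] at this; omega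
  have h0 : ∀ t x, x ∈ α → wt α t x = 0 := by intro t x hx; cases t <;> simp [wt, hx]
  induction t with
  | zero =>
    intro z hz
    rcases hz.lt_or_eq with h | h
    · simp only [wt]; rw [if_neg (hnot z h)]; split_ifs <;> norm_num
    · rw [io_fix i hσ 0 z h]
  | succ t ih =>
    intro z hz
    rcases hz.lt_or_eq with h | h
    · have hn : ∀ s x, 0 ≤ wt α s x := by
        intro s; induction s with
        | zero => intro x; simp only [wt]; split_ifs <;> norm_num
        | succ s ih => intro x; simp only [wt]; split_ifs; exact le_rfl; exact PP_nonneg ih x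
      by_cases hz' : z ∈ α
      · rw [h0 _ _ hz']; exact hn _ _
      · simp only [wt]
        rw [if_neg (hnot z h), if_neg hz']
        unfold io
        rw [← PP_rf]
        apply PP_mono_at
        intro k
        constructor
        · apply ih; rw [ell_add_ev]; split_ifs <;> rcases hσ with rfl | rfl <;> omega
        · apply ih; rw [ell_sub_ev]; split_ifs <;> rcases hσ with rfl | rfl <;> omega
    · rw [io_fix i hσ 0 z h]

lemma vv_refl (hd : 5 ≤ d) (hμ : IsSRWLaw μ 0) (i : Fin d) {σ n : ℤ} (hσ : σ = 1 ∨ σ = -1) (α : Set (V d))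
    (hα : ∀ x ∈ α, ell i σ n x ≤ 0) (z : V d) (hz : ell i σ n z ≤ 0) : vv μ α z ≤ vv μ α (io i σ n 0 z) :=
  le_of_tendsto_of_tendsto' (wt_tendsto hd hμ α z) (wt_tendsto hd hμ α _) fun t => wt_refl i hσ α hα t z hz

lemma vv_lift (hd : 5 ≤ d) (hμ : IsSRWLaw μ 0) (i : Fin d) {σ n : ℤ} (hσ : σ = 1 ∨ σ = -1) (α : Set (V d))
    (hα : ∀ x ∈ α, ell i σ n x ≤ 0) (z : V d) (hz : 0 ≤ ell i σ n z) (j : ℕ) :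
    vv μ α z ≤ vv μ α (z + (2 * (j:ℤ) * σ) • ev i) := by
  have h := vv_refl hd hμ i (n := n + (ell i σ n z + j)) hσ α (fun x hx => by
    have := hα x hx; unfold ell at *; omega) z (by unfold ell; omega)
  convert h using 2
  ext k
  by_cases hk : k = i
  · subst hk; unfold io; rw [rf_same]; simp [ev_apply, ell]
    rcases hσ with rfl | rfl <;> ring
  · unfold io; rw [rf_ne hk]; simp [ev_apply, hk]

lemma wt_lower (hd : 5 ≤ d) (α : Set (V d)) (γ : ℝ) (hγ : 0 < γ) (hα : ∀ y ∈ α, γ ≤ gG y) (t : ℕ) (x : V d) :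
    1 - gG x / γ ≤ wt α t x := by
  induction t generalizing x with
  | zero =>
    simp only [wt]; split_ifs with h
    · have := hα x h; rw [sub_nonpos, one_le_div hγ]; exact this
    · have := div_pos (gG_pos x) hγ; linarith
  | succ t ih =>
    simp only [wt]; split_ifs with h
    · have := hα x h; rw [sub_nonpos, one_le_div hγ]; exact this
    · have h1 := PP_mono (f := fun y => 1 - γ⁻¹ * gG y) (g := wt α t) (fun y => by
        have := ih y; rwa [div_eq_inv_mul] at this) x
      rw [PP_sub (fun _ => 1) (fun y => γ⁻¹ * gG y), PP_const hd, PP_smul] at h1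
      have h2 := (barrier_main hd x).2
      have : γ⁻¹ * PP gG x ≤ γ⁻¹ * gG x := by gcongr; linarith
      rw [div_eq_inv_mul]; linarith

lemma gG_mono (x y : V d) (h : nsq y ≤ nsq x) : gG x ≤ gG y := by
  have h1 := gG_ratio x y h
  have h2 : (nsq y + 10000) / (nsq x + 10000) ≤ 1 := by
    rw [div_le_one (by have := nsq_nonneg x; linarith)]; linarith
  exact (div_le_one (gG_pos y)).1 (h1.trans h2)

lemma vv_far (hd : 5 ≤ d) (hμ : IsSRWLaw μ 0) (n : ℕ) (hn : 16 ≤ n) (α : Set (V d)) (hα : α ⊆ cube 0 n)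
    (z : V d) (hz : 18 * d * (n:ℝ)^2 ≤ nsq z) : 1/2 ≤ vv μ α z := by
  have hd0 : (5:ℝ) ≤ d := by exact_mod_cast hd
  have hn0 : (16:ℝ) ≤ n := by exact_mod_cast hn
  set y : V d := fun _ => (n:ℤ)
  have hy : nsq y = d * (n:ℝ)^2 := by simp [nsq, y]
  have h1 := fun t => wt_lower hd α (gG y) (gG_pos y) (fun x hx => by
    apply gG_mono; rw [hy]
    unfold nsq
    have : ∀ i ∈ (Finset.univ : Finset (Fin d)), ((x i : ℤ):ℝ)^2 ≤ (n:ℝ)^2 := by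
      intro i _
      have := hα hx i
      rw [sq_le_sq, Nat.abs_cast]
      simp at this
      exact_mod_cast this
    have := Finset.sum_le_card_nsmul _ _ _ this
    simpa using this) t z
  have h2 : 1 - gG z / gG y ≤ vv μ α z := ge_of_tendsto' (wt_tendsto hd hμ α z) h1
  have hn2 : (256:ℝ) ≤ (n:ℝ)^2 := by nlinarith
  have h3 : gG z / gG y ≤ 1/2 := by
    refine (gG_ratio z y (by rw [hy]; nlinarith)).trans ?_
    rw [div_le_iff₀ (by have := nsq_nonneg z; linarith), hy]
    nlinarith
  linarith

lemma vv_out (hd : 5 ≤ d) : ∃ c : ℝ, 0 < c ∧ ∀ μ : Measure (ℕ → V d), IsSRWLaw μ 0 → ∀ (n : ℕ), 16 ≤ n → ∀ α : Set (V d), α ⊆ cube 0 n →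
    ∀ z : V d, z ∉ cube 0 (3 * n) → c ≤ vv μ α z := by
  have hd0 : (5:ℝ) ≤ d := by exact_mod_cast hd
  set Λ : ℕ := 72 * d with hΛ
  have hΛ0 : (360:ℝ) ≤ Λ := by rw [hΛ]; push_cast; linarith
  refine ⟨1/2 * (Real.exp (-(4 * d * (Λ:ℝ)^2 / (Λ+1)^2)) - Real.exp (-(4 * d))), ?_, ?_⟩
  · have : Real.exp (-(4 * (d:ℝ))) < Real.exp (-(4 * d * (Λ:ℝ)^2 / (Λ+1)^2)) := by
      apply Real.exp_lt_exp.2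
      rw [neg_lt_neg_iff, div_lt_iff₀ (by positivity)]
      nlinarith
    linarith
  intro μ hμ n hn α hα z hz
  have hn0 : (16:ℝ) ≤ n := by exact_mod_cast hn
  have : ∃ i, (3 * n : ℤ) < |z i| := by
    by_contra! h; apply hz; intro i; simpa using h i
  obtain ⟨i, hi⟩ := this
  obtain ⟨σ, hσ, hσz⟩ : ∃ σ : ℤ, (σ = 1 ∨ σ = -1) ∧ (3 * n : ℤ) < σ * z i := by
    rcases lt_abs.1 hi with h | h
    · exact ⟨1, Or.inl rfl, by simpa using h⟩
    · exact ⟨-1, Or.inr rfl, by simpa using h⟩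
  have hσ2 : (σ:ℝ)^2 = 1 := by rcases hσ with rfl | rfl <;> norm_num
  set w := z + (σ * (Λ * n : ℕ)) • ev i with hw
  set S : ℝ := ((Λ + 1) * n)^2 with hS
  have hSp : 0 < S := by positivity
  set β := 4 * d / S with hβ
  have hdβ : d / β = S / 4 := by rw [hβ]; field_simp
  have hzw : nsq (z - w) = (Λ * n : ℝ)^2 := by
    have : z - w = 0 + (-(σ * (Λ * n : ℕ))) • ev i := by rw [hw]; simp
    rw [this, nsq_add_smul]; simp [nsq]; rw [mul_pow, hσ2]; push_cast; ring
  have hcoord : ∀ x s, 0 ≤ s → nsq (x - w) ≤ s^2 → (3 * n + Λ * n : ℝ) - s ≤ σ * x i := by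
    intro x s hs h
    have h1 := (sq_le_nsq (x - w) i).trans h
    have h2 := abs_le_of_sq_le_sq' h1 hs
    have h3 : (((x - w) i : ℤ) : ℝ) = x i - z i - σ * (Λ * n) := by
      simp [hw, ev_apply]; ring
    rw [h3] at h2
    have h4 : (3 * n : ℝ) < σ * z i := by exact_mod_cast hσz
    rcases hσ with rfl | rfl <;> push_cast at * <;> nlinarith
  have hΛn : (360:ℝ) * n ≤ Λ * n := by gcongr
  have key := gauss_lower hd (β := β) (by positivity) (by
      rw [hβ, div_le_iff₀ hSp, hS]
      have : (d:ℝ) ≤ Λ := by rw [hΛ]; push_cast; linarith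
      nlinarith) w S (1/2) (by norm_num) (vv μ α) (vv_nonneg α) ?_ ?_ z ?_
  · rw [hzw] at key
    have e1 : -β * (Λ * n:ℝ)^2 = -(4 * d * (Λ:ℝ)^2 / (Λ+1)^2) := by rw [hβ, hS]; field_simp
    have e2 : -β * S = -(4*d) := by rw [hβ]; field_simp
    rwa [e1, e2] at key
  · intro x hx
    rw [← vv_harm hd hμ]
    intro hxα
    have h1 := hcoord x ((Λ+1)*n) (by positivity) hx.le
    have h2 := hα hxα i
    simp at h2
    have h3 : (σ:ℝ) * x i ≤ n := by
      have h4 := abs_le.1 h2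
      have : σ * x i ≤ n := by rcases hσ with rfl | rfl <;> omega
      exact_mod_cast this
    nlinarith
  · intro x hx
    apply vv_far hd hμ n hn α hα
    rw [hdβ] at hx
    have h1 := hcoord x ((Λ+1)*n/2) (by positivity) (by rw [hS] at hx; linarith)
    have h2 := sq_le_nsq x i
    have h3 : (Λ * n / 2 : ℝ) ≤ σ * x i := by nlinarith
    have h4 : (Λ * n / 2 : ℝ)^2 ≤ (σ * x i)^2 := by
      apply pow_le_pow_left₀ (by positivity) h3
    rw [mul_pow (σ:ℝ), hσ2, one_mul] at h4
    have h5 : (18 * d * (n:ℝ)^2) ≤ (Λ * n / 2 : ℝ)^2 := by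
      have : (Λ * n / 2 : ℝ)^2 = (1296 * d * n^2) * d := by rw [hΛ]; push_cast; ring
      rw [this]
      have : 0 ≤ (d:ℝ) * n^2 := by positivity
      nlinarith
    linarith
  · rw [hzw, hS]; apply pow_lt_pow_left₀ _ (by positivity) (by norm_num)
    nlinarith

/-- comparison: escape from `D` versus escape to infinity -/
lemma esc_cmp (hd : 5 ≤ d) : ∃ C : ℝ, 0 < C ∧ ∀ μ : Measure (ℕ → V d), IsSRWLaw μ 0 → ∀ (n : ℕ), 16 ≤ n → ∀ α : Set (V d), α ⊆ cube 0 n →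
    ∀ x0 ∈ cube (0 : V d) n, q μ {ω | ∀ j, 1 ≤ j → (∀ l < j, ω l ∈ cube 0 (3*n)) → ω j ∉ α} x0 ≤ C * PP (vv μ α) x0 := by
  obtain ⟨c, hc, hv⟩ := vv_out hd
  refine ⟨c⁻¹, by positivity, ?_⟩
  intro μ hμ n hn α hα x0 hx0
  set Q := cube (0 : V d) (3*n)
  set E : Set (ℕ → V d) := {ω | ∀ j, (∀ l < j, ω l ∈ Q) → ω j ∉ α} with hE
  have hsubQ : cube (0 : V d) n ⊆ Q := by
    intro x hx i; have := hx i; push_cast; omega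
  have hEm : MeasurableSet E := by
    have : E = ⋂ j, {ω : ℕ → V d | (∀ l < j, ω l ∈ Q) → ω j ∉ α} := by ext ω; simp [hE]
    rw [this]
    refine MeasurableSet.iInter fun j => Dep.meas (s := j) ?_
    intro ω ω' e h h1
    rw [← e j le_rfl]
    apply h; intro l hl; rw [e l hl.le]; exact h1 l hl
  have hstep : ∀ x ∈ Q, x ∉ α → q μ E x = PP (q μ E) x := by
    intro x hx hxα
    rw [← q_step hd hμ hEm]
    apply q_congr' hd hμ; intro ω h0 _
    constructor
    · intro h j hj
      apply h (1 + j)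
      intro l hl
      rcases l with _ | l
      · rw [h0]; exact hx
      · have := hj l (by omega); simpa [sh, add_comm] using this
    · intro h j hj
      rcases j with _ | j
      · rw [h0]; exact hxα
      · have := h j (fun l hl => by simpa [sh, add_comm] using hj (l+1) (by omega))
        simpa [sh, add_comm] using this
  have hEα : ∀ x ∈ α, q μ E x = 0 := by
    intro x hx
    have : q μ E x = q μ ∅ x := by
      apply q_congr' hd hμ; intro ω h0 _
      simp only [Set.mem_empty_iff_false, iff_false]
      intro h; exact h 0 (by simp) (by rw [h0]; exact hx)
    rw [this]; simp [q]
  have hcmp : ∀ x, q μ E x ≤ c⁻¹ * vv μ α x := by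
    have hQfin : (Q \ α).Finite := by
      apply Set.Finite.subset (Set.finite_Icc (fun _ => -((3*n : ℕ):ℤ)) (fun _ => ((3*n:ℕ):ℤ)))
      intro x hx
      have := hx.1
      constructor <;> intro i <;> have := abs_le.1 (this i) <;> simp at this ⊢ <;> omega
    have hout : ∀ x, x ∉ Q \ α → q μ E x - c⁻¹ * vv μ α x ≤ 0 := by
      intro x hx
      by_cases hxα : x ∈ α
      · rw [hEα x hxα]
        have := mul_nonneg (inv_nonneg.2 hc.le) (vv_nonneg (μ := μ) α x); linarith
      · have hxQ : x ∉ Q := fun h => hx ⟨h, hxα⟩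
        have h1 := hv μ hμ n hn α hα x hxQ
        have h2 := q_le_one hμ E x
        have : 1 ≤ c⁻¹ * vv μ α x := by rw [inv_mul_eq_div, one_le_div hc]; exact h1
        linarith
    intro x
    by_cases hx : x ∈ Q \ α
    · have := maxp hd (Q \ α) hQfin (fun x => q μ E x - c⁻¹ * vv μ α x) ?_ ?_ x hx
      · simpa using this
      · intro y hy
        rw [PP_sub (q μ E) (fun x => c⁻¹ * vv μ α x), PP_smul, ← hstep y hy.1 hy.2, ← vv_harm hd hμ hy.2]
      · intro y hy k
        exact ⟨hout _, hout _⟩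
    · have := hout x hx; linarith
  have h1 : q μ {ω | ∀ j, 1 ≤ j → (∀ l < j, ω l ∈ Q) → ω j ∉ α} x0 = PP (q μ E) x0 := by
    rw [← q_step hd hμ hEm]
    apply q_congr' hd hμ; intro ω h0 _
    constructor
    · intro h j hj
      apply h (1 + j) (by omega)
      intro l hl
      rcases l with _ | l
      · rw [h0]; exact hsubQ hx0
      · have := hj l (by omega); simpa [sh, add_comm] using this
    · intro h j hj1 hj
      obtain ⟨j, rfl⟩ : ∃ k, j = k + 1 := ⟨j - 1, by omega⟩
      have := h j (fun l hl => by simpa [sh, add_comm] using hj (l+1) (by omega))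
      simpa [sh, add_comm] using this
  rw [h1, ← PP_smul]
  exact PP_mono hcmp x0

end law

section law
variable {μ : Measure (ℕ → V d)}

lemma nrm_smul_ev (i : Fin d) (c : ℤ) : nrm (c • ev i : V d) = |(c:ℝ)| := by
  have h : nsq (c • ev i : V d) = (c:ℝ)^2 := by
    have := nsq_add_smul (0 : V d) i c
    simpa [nsq] using this
  unfold nrm; rw [h, Real.sqrt_sq_eq_abs]

lemma ell_lip (i : Fin d) {σ n : ℤ} (hσ : σ = 1 ∨ σ = -1) (x y : V d) :
    (ell i σ n y : ℝ) - nrm (x - y) ≤ ell i σ n x := by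
  have h := abs_le.1 (abs_le_nrm (x - y) i)
  have e : (((x - y) i : ℤ) : ℝ) = x i - y i := by simp
  rw [e] at h
  unfold ell
  rcases hσ with rfl | rfl <;> push_cast <;> linarith [h.1, h.2]

lemma ell_smul (i : Fin d) {σ n : ℤ} (hσ : σ = 1 ∨ σ = -1) (x : V d) (c : ℤ) :
    ell i σ n (x + (c * σ) • ev i) = ell i σ n x + c := by
  unfold ell
  simp only [Pi.add_apply, Pi.smul_apply, ev_apply, if_true, smul_eq_mul, mul_one]
  rcases hσ with rfl | rfl <;> ring

lemma abs_mul_sg {σ : ℤ} (hσ : σ = 1 ∨ σ = -1) (c : ℤ) : |((c * σ : ℤ):ℝ)| = |(c:ℝ)| := by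
  rcases hσ with rfl | rfl <;> simp

lemma sq_aux {H R p : ℝ} (hR : 0 < R) (hH : R ≤ H) (h : p * H ≤ 3 * R / 4) : (H - 3 * R / 4)^2 ≤ (1 - p) * H^2 := by
  nlinarith [mul_le_mul_of_nonneg_right h (by linarith : 0 ≤ H)]

set_option maxHeartbeats 800000 in
lemma e2 (hd : 5 ≤ d) : ∃ (C c : ℝ) (k : ℕ), 1 ≤ C ∧ 0 < c ∧ 1 ≤ k ∧
    ∀ μ : Measure (ℕ → V d), IsSRWLaw μ 0 → ∀ (i : Fin d) (σ n : ℤ), (σ = 1 ∨ σ = -1) → ∀ α : Set (V d),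
    (∀ x ∈ α, ell i σ n x ≤ 0) → ∀ x0, ell i σ n x0 = 0 → ∀ m : ℕ, 1 ≤ m →
    (∀ z, nrm (z - x0) ≤ m → vv μ α z ≤ C * vv μ α (x0 + (2 * ((k * m : ℕ):ℤ) * σ) • ev i)) ∧
    (∀ R : ℕ, R ≤ m → m ≤ 4 * R → ∀ w, nsq (w - (x0 + ((R:ℤ) * σ) • ev i)) ≤ (R:ℝ)^2/16 →
      c * vv μ α (x0 + (2 * ((k * m : ℕ):ℤ) * σ) • ev i) ≤ vv μ α w) := by
  obtain ⟨C, Λ, hC, hΛ, hH⟩ := harnack hd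
  have hd0 : (5:ℝ) ≤ d := by exact_mod_cast hd
  obtain ⟨k, hk⟩ := exists_nat_ge (d * (Λ + 2))
  set lam : ℝ := d * (Λ + 2)^2 with hlam
  have hl0 : 0 < lam := by positivity
  have hk8 : (40:ℝ) ≤ k := by nlinarith
  have hk0 : (0:ℝ) < k := by linarith
  refine ⟨C, C⁻¹ * (Real.exp (-(lam * (1 - 3 / (32 * k)))) - Real.exp (-lam)), k, hC, ?_, ?_, ?_⟩
  · have : 0 < lam * (3 / (32 * k)) := by positivity
    have : Real.exp (-lam) < Real.exp (-(lam * (1 - 3 / (32 * k)))) := Real.exp_lt_exp.2 (by linarith)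
    have := sub_pos.2 this
    positivity
  · exact_mod_cast (by linarith : (1:ℝ) ≤ k)
  intro μ hμ i σ n hσ α hα x0 hx0 m hm
  set y : V d := x0 + (2 * ((k * m : ℕ):ℤ) * σ) • ev i with hy
  have hm0 : (1:ℝ) ≤ m := by exact_mod_cast hm
  set H : ℝ := 2 * k * m with hHd
  have hly : ((ell i σ n y : ℤ) : ℝ) = H := by
    rw [hy, ell_smul i hσ, hx0, hHd]; push_cast; ring
  have hharm : ∀ x, nrm (x - y) < H → vv μ α x = PP (vv μ α) x := by
    intro x hx
    apply vv_harm hd hμ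
    intro h
    have h1 := hα x h
    have h2 := ell_lip i (n := n) hσ x y
    have h3 : (ell i σ n x : ℝ) ≤ 0 := by exact_mod_cast h1
    linarith
  have hvn := vv_nonneg (μ := μ) α
  have hkm : (k:ℝ) ≤ k * m := by nlinarith
  constructor
  · intro z hz
    obtain ⟨z', h1, h2, h3⟩ : ∃ z', 0 ≤ ell i σ n z' ∧ nrm (z' - x0) ≤ 3 * m ∧ vv μ α z ≤ vv μ α z' := by
      rcases le_total 0 (ell i σ n z) with h | h
      · exact ⟨z, h, by linarith, le_rfl⟩
      · refine ⟨io i σ n 0 z, by rw [ell_io i hσ]; omega, ?_, vv_refl hd hμ i hσ α hα z h⟩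
        have e : io i σ n 0 z = z + ((-2 * ell i σ n z) * σ) • ev i := by
          ext j
          by_cases hj : j = i
          · subst hj
            unfold io
            rw [rf_same]
            simp only [Pi.add_apply, Pi.smul_apply, ev_apply, if_true, smul_eq_mul, mul_one, ell]
            rcases hσ with rfl | rfl <;> ring
          · unfold io
            rw [rf_ne hj]
            simp [ev_apply, hj]
        have h4 := nrm_tri (io i σ n 0 z) z x0
        have h5 : nrm (io i σ n 0 z - z) = |((-2 * ell i σ n z : ℤ):ℝ)| := by
          rw [e, add_sub_cancel_left, nrm_smul_ev, abs_mul_sg hσ]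
        have h6 := ell_lip i (n := n) hσ z x0
        rw [hx0] at h6
        have h7 : (ell i σ n z : ℝ) ≤ 0 := by exact_mod_cast h
        rw [abs_of_nonneg (by push_cast; linarith)] at h5
        push_cast at h5 h6
        linarith
    have h4 := vv_lift hd hμ i hσ α hα z' h1 (k * m)
    refine h3.trans (h4.trans ?_)
    refine hH _ hvn y (3 * m) (by linarith) ?_ _ ?_
    · intro x hx
      apply hharm
      have : Λ * (3 * m) < 2 * k * m := by
        have : 3 * Λ < 2 * k := by nlinarith
        nlinarith
      linarith
    · have : z' + (2 * ((k * m : ℕ):ℤ) * σ) • ev i - y = z' - x0 := by rw [hy]; abel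
      rw [this]; exact h2
  · intro R hR1 hR2 w hw
    have hR1' : (R:ℝ) ≤ m := by exact_mod_cast hR1
    have hR2' : (m:ℝ) ≤ 4 * R := by exact_mod_cast hR2
    have hHk : 2 * (d * (Λ + 2)) ≤ H := by rw [hHd]; linarith
    set s := H / (Λ + 2) with hs
    have hΛ2 : 0 < Λ + 2 := by linarith
    have hH0 : 0 < H := by positivity
    have hs1 : 1 ≤ s := by rw [hs, le_div_iff₀ hΛ2]; nlinarith
    have hsH : s * (Λ + 2) = H := by rw [hs]; field_simp
    have hin : ∀ x, nrm (x - y) ≤ s → C⁻¹ * vv μ α y ≤ vv μ α x := by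
      intro x hx
      rw [inv_mul_le_iff₀ (by linarith)]
      refine hH _ hvn x s hs1 ?_ y (by rw [nrm_sub_comm]; exact hx)
      intro x' hx'
      apply hharm
      have := nrm_tri x' x y
      nlinarith
    have hx1y : nrm ((x0 + ((R:ℤ) * σ) • ev i) - y) = H - R := by
      have : (x0 + ((R:ℤ) * σ) • ev i) - y = (((R:ℤ) - 2 * ((k * m : ℕ):ℤ)) * σ) • ev i := by
        rw [hy, add_sub_add_left_eq_sub, ← sub_smul, sub_mul]
      rw [this, nrm_smul_ev, abs_mul_sg hσ, abs_of_nonpos]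
      · push_cast; rw [hHd]; ring
      · push_cast; nlinarith
    have hwx : nrm (w - (x0 + ((R:ℤ) * σ) • ev i)) ≤ R / 4 := by
      rw [nrm_le_iff _ (by positivity)]; refine hw.trans (le_of_eq ?_); ring
    have hwy : nrm (w - y) ≤ H - 3 * R / 4 := by
      have := nrm_tri w (x0 + ((R:ℤ) * σ) • ev i) y
      linarith
    have hRH : (R:ℝ) ≤ H := by nlinarith
    have hwn : nsq (w - y) ≤ (H - 3 * R / 4)^2 := by
      rw [← nrm_sq]; exact pow_le_pow_left₀ (nrm_nonneg _) hwy 2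
    have hR0 : (0:ℝ) < R := by linarith
    have hg := gauss_lower hd (β := lam / H^2) (by positivity) (by
        rw [div_le_iff₀ (by positivity), hlam]
        have : (2 * (d * (Λ + 2)))^2 ≤ H^2 := pow_le_pow_left₀ (by positivity) hHk 2
        nlinarith [sq_nonneg (Λ+2)]) y (H^2) (C⁻¹ * vv μ α y) (by have := hvn y; positivity) (vv μ α) hvn (by
        intro x hx
        apply (hharm x _).ge
        rw [← nrm_sq] at hx
        exact lt_of_pow_lt_pow_left₀ 2 hH0.le hx) (by
        intro x hx
        apply hin
        rw [nrm_le_iff _ (by linarith)]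
        refine hx.trans (le_of_eq ?_)
        rw [hs, hlam]; field_simp) w (by nlinarith)
    refine le_trans ?_ hg
    have e1 : -(lam / H^2) * H^2 = -lam := by field_simp
    rw [e1]
    have hv := hvn y
    have hC0 : 0 < C⁻¹ := by positivity
    have e2 : -(lam * (1 - 3 / (32 * k))) ≤ -(lam / H^2) * nsq (w - y) := by
      have h1 : lam / H^2 * nsq (w - y) ≤ lam * (1 - 3 / (32 * k)) := by
        rw [div_mul_eq_mul_div, div_le_iff₀ (by positivity), mul_assoc lam]
        apply mul_le_mul_of_nonneg_left _ hl0.le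
        refine hwn.trans ?_
        have h2 : 3 / (32 * k) * H ≤ 3 * R / 4 := by
          have : 3 / (32 * (k:ℝ)) * H = 3 * m / 16 := by rw [hHd]; field_simp; norm_num
          linarith
        exact sq_aux hR0 hRH h2
      linarith
    have := Real.exp_le_exp.2 e2
    calc C⁻¹ * (Real.exp (-(lam * (1 - 3 / (32 * k)))) - Real.exp (-lam)) * vv μ α y
        = C⁻¹ * vv μ α y * (Real.exp (-(lam * (1 - 3 / (32 * k)))) - Real.exp (-lam)) := by ring
      _ ≤ _ := by gcongr

lemma q_iUnion_le (hμ : IsSRWLaw μ 0) (F : ℕ → Set (ℕ → V d)) (x : V d) (B : ℝ)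
    (h : ∀ n, ∑ k ∈ Finset.range n, q μ (F k) x ≤ B) : q μ (⋃ k, F k) x ≤ B := by
  have := hμ.1
  have hs : Summable fun k => q μ (F k) x := summable_of_sum_range_le (fun k => q_nonneg _ _) h
  have hB : 0 ≤ B := by simpa using h 0
  unfold q at *
  rw [Set.preimage_iUnion]
  have h1 : μ (⋃ k, pth x ⁻¹' F k) ≤ ∑' k, ENNReal.ofReal (μ.real (pth x ⁻¹' F k)) := by
    refine (measure_iUnion_le _).trans (le_of_eq ?_)
    congr 1; ext1 k; rw [ofReal_measureReal]
  rw [← ENNReal.ofReal_tsum_of_nonneg (fun k => measureReal_nonneg) hs] at h1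
  rw [measureReal_def]
  refine (ENNReal.toReal_mono ENNReal.ofReal_ne_top h1).trans ?_
  rw [ENNReal.toReal_ofReal (tsum_nonneg fun k => measureReal_nonneg)]
  exact hs.tsum_le_of_sum_range_le h

/-- visit `x` at time `k` and avoid `α` afterwards -/
lemma hit_avoid (hd : 5 ≤ d) (hμ : IsSRWLaw μ 0) (α : Set (V d)) (x z : V d) (k : ℕ) :
    q μ ({ω | ω k = x} ∩ sh k ⁻¹' Fav α) z ≤ vv μ α x * pk k (z - x) := by
  rw [← q_at hd hμ]
  have hdep : Dep k {ω : ℕ → V d | ω k = x} := fun ω ω' e h => by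
    show ω' k = x
    rw [← e k le_rfl]; exact h
  refine q_markov_le hd hμ (Fav_meas α) (vv μ α x) k _ hdep ?_ z
  intro ω h
  rw [show ω k = x from h]; rfl

lemma hit_avoid_any (hd : 5 ≤ d) (hμ : IsSRWLaw μ 0) (α : Set (V d)) (x z : V d) :
    q μ ({ω | ∃ k, ω k = x} ∩ Fav α) z ≤ vv μ α x * (gG (z - x) / (gG (0 : V d) - PP gG (0 : V d))) := by
  have e : ({ω | ∃ k, ω k = x} ∩ Fav α : Set (ℕ → V d)) ⊆ ⋃ k, ({ω | ω k = x} ∩ sh k ⁻¹' Fav α) := by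
    rintro ω ⟨⟨k, h1⟩, h2⟩
    exact Set.mem_iUnion.2 ⟨k, h1, fun j => h2 _⟩
  refine (q_mono hμ e z).trans ?_
  apply q_iUnion_le hμ
  intro n
  refine (Finset.sum_le_sum fun k _ => hit_avoid hd hμ α x z k).trans ?_
  rw [← Finset.mul_sum]
  exact mul_le_mul_of_nonneg_left (pk_sum hd n _) (vv_nonneg _ _)

end law

section law
variable {μ : Measure (ℕ → V d)}

lemma q_markov_dep (hd : 5 ≤ d) (hμ : IsSRWLaw μ 0) (F : V d → Set (ℕ → V d)) (hF : ∀ y, MeasurableSet (F y))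
    (c : ℝ) (hc : 0 ≤ c) (s l : ℕ) (hl : l ≤ s) (Γ : Set (ℕ → V d)) (hΓ : Dep s Γ)
    (h : ∀ ω ∈ Γ, q μ (F (ω l)) (ω s) ≤ c) (x : V d) :
    q μ {ω | ω ∈ Γ ∧ sh s ω ∈ F (ω l)} x ≤ c * q μ Γ x := by
  have := hμ.1
  have hdep : ∀ y, Dep s (Γ ∩ {ω | ω l = y}) := by
    rintro y ω ω' e ⟨h1, h2⟩
    exact ⟨hΓ ω ω' e h1, by show ω' l = y; rw [← e l hl]; exact h2⟩
  have h1 : ∀ y, μ (pth x ⁻¹' ((Γ ∩ {ω | ω l = y}) ∩ sh s ⁻¹' F y)) ≤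
      ENNReal.ofReal c * μ (pth x ⁻¹' (Γ ∩ {ω | ω l = y})) := by
    intro y
    have h2 := q_markov_le hd hμ (hF y) c s _ (hdep y) (by
      rintro ω ⟨h3, h4⟩; have := h ω h3; rwa [show ω l = y from h4] at this) x
    unfold q at h2
    rw [← ofReal_measureReal, ← ofReal_measureReal (s := pth x ⁻¹' (Γ ∩ _)), ← ENNReal.ofReal_mul hc]
    exact ENNReal.ofReal_le_ofReal h2
  have e1 : pth x ⁻¹' {ω | ω ∈ Γ ∧ sh s ω ∈ F (ω l)} ⊆ ⋃ y, pth x ⁻¹' ((Γ ∩ {ω | ω l = y}) ∩ sh s ⁻¹' F y) := by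
    rintro ω ⟨h2, h3⟩
    exact Set.mem_iUnion.2 ⟨pth x ω l, ⟨h2, rfl⟩, h3⟩
  have e2 : pth x ⁻¹' Γ = ⋃ y, pth x ⁻¹' (Γ ∩ {ω | ω l = y}) := by
    ext ω
    rw [Set.mem_iUnion]
    exact ⟨fun h => ⟨_, h, rfl⟩, fun ⟨_, h, _⟩ => h⟩
  have h3 : μ (pth x ⁻¹' {ω | ω ∈ Γ ∧ sh s ω ∈ F (ω l)}) ≤ ENNReal.ofReal c * μ (pth x ⁻¹' Γ) := by
    refine (measure_mono e1).trans ((measure_iUnion_le _).trans ((ENNReal.tsum_le_tsum h1).trans ?_))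
    rw [ENNReal.tsum_mul_left, e2, measure_iUnion]
    · intro y y' hy
      refine Set.disjoint_left.2 ?_
      rintro ω ⟨_, h4⟩ ⟨_, h5⟩
      exact hy (h4.symm.trans h5)
    · intro y; exact pth_meas x (hdep y).meas
  unfold q
  rw [measureReal_def, measureReal_def]
  refine (ENNReal.toReal_mono (ENNReal.mul_ne_top ENNReal.ofReal_ne_top (measure_ne_top _ _)) h3).trans ?_
  rw [ENNReal.toReal_mul, ENNReal.toReal_ofReal hc]

def E0 (W Y U A : Set (V d)) (t j : ℕ) : Set (ℕ → V d) :=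
  stay W t ∩ sh t ⁻¹' ({ω | ω 0 ∈ Y} ∩ (stay U j ∩ sh j ⁻¹' {ω | ω 0 ∈ A}))

def noret (K i : ℕ) : Set (ℕ → V d) := {ω | ∀ l ≤ i, ∀ k, i + K ≤ k → ω k ≠ ω l}

def Good (α W Y U A : Set (V d)) (t K j : ℕ) : Set (ℕ → V d) :=
  (E0 W Y U A t j ∩ sh (t + j) ⁻¹' Fav α) ∩ noret K (t + j)

lemma at_dep (S : Set (V d)) (k s : ℕ) (h : k ≤ s) : Dep s {ω : ℕ → V d | ω k ∈ S} := by
  intro ω ω' e h1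
  show ω' k ∈ S
  rw [← e k h]; exact h1

lemma E0_dep (W Y U A : Set (V d)) (t j : ℕ) : Dep (t + j) (E0 W Y U A t j) := by
  rintro ω ω' e ⟨h1, h2, h3, h4⟩
  refine ⟨fun l a b => ?_, ?_, fun l a b => ?_, ?_⟩
  · rw [← e l (by omega)]; exact h1 l a b
  · show ω' (t + 0) ∈ Y
    rw [← e _ (by omega)]; exact h2
  · show ω' (t + l) ∈ U
    rw [← e _ (by omega)]; exact h3 l a b
  · show ω' (t + (j + 0)) ∈ A
    rw [← e _ (by omega)]; exact h4

lemma noret_meas (K i : ℕ) : MeasurableSet (noret K i : Set (ℕ → V d)) := by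
  have : (noret K i : Set (ℕ → V d)) = ⋂ l, ⋂ k, {ω | l ≤ i → i + K ≤ k → ω k ≠ ω l} := by
    ext ω; simp only [noret, Set.mem_iInter, Set.mem_ofPred_eq]
    exact ⟨fun h l k a b => h l a k b, fun h l a k b => h l k a b⟩
  rw [this]
  refine MeasurableSet.iInter fun l => MeasurableSet.iInter fun k => Dep.meas (s := max l k) ?_
  intro ω ω' e h a b
  rw [← e k (le_max_right _ _), ← e l (le_max_left _ _)]; exact h a b

lemma sh_meas' (s : ℕ) {F : Set (ℕ → V d)} (hF : MeasurableSet F) : MeasurableSet (sh s ⁻¹' F) := sh_meas s hF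

lemma Good_meas (α W Y U A : Set (V d)) (t K j : ℕ) : MeasurableSet (Good α W Y U A t K j) :=
  ((E0_dep W Y U A t j).meas.inter (sh_meas' _ (Fav_meas α))).inter (noret_meas _ _)

lemma q_zero_mem (hd : 5 ≤ d) (hμ : IsSRWLaw μ 0) (A : Set (V d)) (x : V d) :
    q μ {ω | ω 0 ∈ A} x = A.indicator (fun _ => 1) x := by
  have := q_ind hd hμ A Set.univ x
  rw [Set.inter_univ] at this
  rw [this]; congr 1; ext1 y; exact q_univ hμ y

lemma E0_prob (hd : 5 ≤ d) (hμ : IsSRWLaw μ 0) (W Y U A : Set (V d)) (t j : ℕ) (x : V d) :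
    q μ (E0 W Y U A t j) x = QI W t (Y.indicator (QI U j (A.indicator fun _ => 1))) x := by
  have hm : MeasurableSet {ω : ℕ → V d | ω 0 ∈ A} := (at_dep A 0 0 le_rfl).meas
  have hm2 : MeasurableSet (stay U j ∩ sh j ⁻¹' {ω : ℕ → V d | ω 0 ∈ A}) :=
    (stay_dep U j).meas.inter (sh_meas' _ hm)
  unfold E0
  rw [q_stay hd hμ W (((at_dep Y 0 0 le_rfl).meas).inter hm2)]
  apply QI_congr
  intro y
  rw [q_ind hd hμ]
  congr 1; ext1 z
  rw [q_stay hd hμ U hm]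
  apply QI_congr
  intro w; exact q_zero_mem hd hμ A w

lemma QI_mono_on {C : Set (V d)} {f g : V d → ℝ} (h : ∀ x ∈ C, f x ≤ g x) (t : ℕ) (ht : 1 ≤ t) (x : V d) :
    QI C t f x ≤ QI C t g x := by
  obtain ⟨s, rfl⟩ : ∃ s, t = s + 1 := ⟨t - 1, by omega⟩
  rw [QI_succ', QI_succ']
  exact QI_mono (fun y => QC_mono h y) s x

lemma QI_sum (C : Set (V d)) {ι : Type*} (s : Finset ι) (f : ι → V d → ℝ) (t : ℕ) (x : V d) :
    QI C t (fun y => ∑ i ∈ s, f i y) x = ∑ i ∈ s, QI C t (f i) x := by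
  induction s using Finset.induction_on with
  | empty => simp [QI_zero_fun]
  | insert a s ha ih => simp only [Finset.sum_insert ha]; rw [QI_add, ih]

lemma E0_sum (hd : 5 ≤ d) (hμ : IsSRWLaw μ 0) (W Y U A : Set (V d)) (t J : ℕ) (ht : 1 ≤ t) (x : V d) (S : ℝ)
    (h : ∀ y ∈ W, y ∈ Y → S ≤ ∑ j ∈ Finset.range J, QI U j (A.indicator fun _ => 1) y) :
    S * QI W t (Y.indicator fun _ => 1) x ≤ ∑ j ∈ Finset.range J, q μ (E0 W Y U A t j) x := by
  simp only [E0_prob hd hμ]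
  rw [← QI_sum, ← QI_smul]
  apply QI_mono_on _ t ht
  intro y hy
  by_cases hY : y ∈ Y
  · simp only [Set.indicator_of_mem hY]; simpa using h y hy hY
  · simp [Set.indicator_of_notMem hY]

lemma good_one (hd : 5 ≤ d) (hμ : IsSRWLaw μ 0) (α W Y U A : Set (V d)) (t K j : ℕ) (x0 : V d) (cV M b1 ε : ℝ)
    (hcV : 0 < cV) (hM : 0 ≤ M) (hb1 : 0 ≤ b1)
    (h1 : ∀ w ∈ A, cV ≤ vv μ α w)
    (h3 : ∀ x, x ∈ W ∨ x = x0 ∨ x ∈ U → vv μ α x ≤ M)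
    (h4 : ∀ x, x ∈ W ∨ x = x0 → ∀ z ∈ A, (t + 1) * (M * (gG (z - x) / (gG (0 : V d) - PP gG (0 : V d)))) ≤ b1)
    (h5 : ∀ n n' : ℕ, ∑ k ∈ Finset.range n, ∑ j ∈ Finset.range n', pk (K + k + j) (0 : V d) ≤ ε) :
    (cV - b1) * q μ (E0 W Y U A t j) x0 - M * ε * QI W t (Y.indicator fun _ => 1) x0 ≤
      q μ (Good α W Y U A t K j) x0 := by
  have hg0 := (barrier_main hd (0 : V d)).2
  set g0 := gG (0 : V d) - PP gG (0 : V d)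
  set E := E0 W Y U A t j with hE
  have hEd := E0_dep W Y U A t j
  have hb : cV * q μ E x0 ≤ q μ (E ∩ sh (t + j) ⁻¹' Fav α) x0 :=
    q_markov_ge hd hμ (Fav_meas α) cV hcV (t + j) _ hEd (by
      rintro ω ⟨_, _, _, h⟩
      exact h1 _ h) x0
  set F1 : V d → Set (ℕ → V d) := fun x => {ω | ∃ k, ω k = x} ∩ Fav α with hF1
  have hF1m : ∀ x, MeasurableSet (F1 x) := by
    intro x
    refine MeasurableSet.inter ?_ (Fav_meas α)
    have : {ω : ℕ → V d | ∃ k, ω k = x} = ⋃ k, {ω | ω k ∈ ({x} : Set (V d))} := by ext ω; simp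
    rw [this]
    exact MeasurableSet.iUnion fun k => (at_dep _ k k le_rfl).meas
  set Γ2 : ℕ → Set (ℕ → V d) := fun i => (stay W t ∩ sh t ⁻¹' {ω | ω 0 ∈ Y}) ∩ {ω | ω (t + (j - i)) ∈ U} with hΓ2
  set F2 : ℕ → ℕ → V d → Set (ℕ → V d) := fun k i x => {ω | ω (K + k + i) = x} ∩ sh (K + k + i) ⁻¹' Fav α with hF2
  have hF2m : ∀ k i x, MeasurableSet (F2 k i x) := fun k i x =>
    ((at_dep {x} _ _ le_rfl).meas).inter (sh_meas' _ (Fav_meas α))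
  set B1 : Set (ℕ → V d) := ⋃ l ∈ Finset.range (t + 1), {ω | ω ∈ E ∧ sh (t + j) ω ∈ F1 (ω l)}
  set B2 : Set (ℕ → V d) := ⋃ k, ⋃ i ∈ Finset.range j, {ω | ω ∈ Γ2 i ∧ sh (t + (j - i)) ω ∈ F2 k i (ω (t + (j - i)))}
  have hcov : q μ (E ∩ sh (t + j) ⁻¹' Fav α) x0 ≤ q μ (Good α W Y U A t K j ∪ (B1 ∪ B2)) x0 := by
    apply q_mono hμ
    rintro ω ⟨hω1, hω2⟩
    by_cases hn : ω ∈ noret K (t + j)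
    · exact Or.inl ⟨⟨hω1, hω2⟩, hn⟩
    · right
      simp only [noret, Set.mem_ofPred_eq] at hn
      push Not at hn
      obtain ⟨l, hl, k, hk, he⟩ := hn
      by_cases hlt : l ≤ t
      · left
        refine Set.mem_biUnion (x := l) (by simpa using Nat.lt_succ_of_le hlt) ⟨hω1, ⟨k - (t + j), ?_⟩, hω2⟩
        show ω (t + j + (k - (t + j))) = ω l
        rw [← he]; congr 1; omega
      · right
        refine Set.mem_iUnion.2 ⟨k - (t + j) - K, Set.mem_biUnion (x := t + j - l) (by simp; omega) ⟨⟨⟨hω1.1, hω1.2.1⟩, ?_⟩, ?_, ?_⟩⟩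
        · exact hω1.2.2.1 _ (by omega) (by omega)
        · show ω _ = ω _
          rw [show t + (j - (t + j - l)) + (K + (k - (t + j) - K) + (t + j - l)) = k by omega,
            show t + (j - (t + j - l)) = l by omega, he]
        · intro a
          show ω (t + (j - (t + j - l)) + (K + (k - (t + j) - K) + (t + j - l) + a)) ∉ α
          have e : ω (t + j + (k - (t + j) + a)) ∉ α := hω2 (k - (t + j) + a)
          rwa [show t + (j - (t + j - l)) + (K + (k - (t + j) - K) + (t + j - l) + a) = t + j + (k - (t + j) + a) by omega]
  have hB1 : q μ B1 x0 ≤ b1 * q μ E x0 := by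
    refine (q_biUnion_le hμ _ _ x0).trans ?_
    have : ∀ l ∈ Finset.range (t + 1), q μ {ω | ω ∈ E ∩ {ω | ω 0 = x0} ∧ sh (t + j) ω ∈ F1 (ω l)} x0 ≤ b1 / (t + 1) * q μ (E ∩ {ω | ω 0 = x0}) x0 := by
      intro l hl
      rw [Finset.mem_range] at hl
      refine q_markov_dep hd hμ F1 hF1m _ (by positivity) (t + j) l (by omega) _ ?_ ?_ x0
      · intro ω ω' e h
        exact ⟨hEd ω ω' e h.1, at_dep {x0} 0 _ (by omega) ω ω' e h.2⟩
      · rintro ω ⟨hω, h0⟩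
        have hx : ω l ∈ W ∨ ω l = x0 := by
          rcases Nat.eq_zero_or_pos l with rfl | h
          · exact Or.inr h0
          · exact Or.inl (hω.1 l h (by omega))
        refine (hit_avoid_any hd hμ α (ω l) (ω (t + j))).trans ?_
        have h6 := h4 _ hx (ω (t + j)) hω.2.2.2
        rw [le_div_iff₀ (by positivity)]
        have h7 : vv μ α (ω l) ≤ M := h3 _ (by tauto)
        have h8 : 0 ≤ gG (ω (t + j) - ω l) / g0 := div_nonneg (gG_pos _).le hg0.le
        refine le_trans ?_ h6
        rw [mul_comm]
        gcongr
    have e1 : ∀ l, q μ {ω | ω ∈ E ∧ sh (t + j) ω ∈ F1 (ω l)} x0 = q μ {ω | ω ∈ E ∩ {ω | ω 0 = x0} ∧ sh (t + j) ω ∈ F1 (ω l)} x0 := by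
      intro l; apply q_congr' hd hμ; intro ω h _
      exact ⟨fun h' => ⟨⟨h'.1, h⟩, h'.2⟩, fun h' => ⟨h'.1.1, h'.2⟩⟩
    simp only [e1]
    refine (Finset.sum_le_sum this).trans ?_
    rw [Finset.sum_const, Finset.card_range, nsmul_eq_mul]
    have : q μ (E ∩ {ω | ω 0 = x0}) x0 ≤ q μ E x0 := q_mono hμ Set.inter_subset_left x0
    push_cast
    rw [← mul_assoc, mul_div_cancel₀ _ (by positivity)]
    gcongr
  have hp0 : ∀ i, q μ (Γ2 i) x0 ≤ QI W t (Y.indicator fun _ => 1) x0 := by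
    intro i
    refine (q_mono hμ Set.inter_subset_left x0).trans ?_
    rw [q_stay hd hμ W (at_dep Y 0 0 le_rfl).meas]
    exact (QI_congr (fun y => q_zero_mem hd hμ Y y) t x0).le
  set p0 := QI W t (Y.indicator fun _ => 1) x0
  have hp00 : 0 ≤ p0 := QI_nonneg (fun y => Set.indicator_nonneg (fun _ _ => zero_le_one) y) t x0
  have hB2 : q μ B2 x0 ≤ M * ε * p0 := by
    apply q_iUnion_le hμ
    intro n
    have : ∀ k ∈ Finset.range n, q μ (⋃ i ∈ Finset.range j, {ω | ω ∈ Γ2 i ∧ sh (t + (j - i)) ω ∈ F2 k i (ω (t + (j - i)))}) x0 ≤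
        M * p0 * ∑ i ∈ Finset.range j, pk (K + k + i) (0 : V d) := by
      intro k _
      refine (q_biUnion_le hμ _ _ x0).trans ?_
      rw [Finset.mul_sum]
      apply Finset.sum_le_sum
      intro i hi
      have hpn := pk_nonneg (K + k + i) (0 : V d)
      refine (q_markov_dep hd hμ (F2 k i) (hF2m k i) (M * pk (K + k + i) (0 : V d)) (by positivity) (t + (j - i)) _ le_rfl _ ?_ ?_ x0).trans ?_
      · rintro ω ω' e ⟨⟨a1, a2⟩, a3⟩
        refine ⟨⟨fun l u1 u2 => ?_, ?_⟩, at_dep U _ _ le_rfl ω ω' e a3⟩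
        · rw [← e l (by omega)]; exact a1 l u1 u2
        · show ω' (t + 0) ∈ Y
          rw [← e _ (by omega)]; exact a2
      · rintro ω ⟨_, hU⟩
        refine (hit_avoid hd hμ α _ _ _).trans ?_
        rw [sub_self]
        have := h3 _ (Or.inr (Or.inr hU))
        gcongr
      · have := hp0 i
        calc _ ≤ M * pk (K + k + i) (0 : V d) * p0 := by gcongr
          _ = _ := by ring
    refine (Finset.sum_le_sum this).trans ?_
    rw [← Finset.mul_sum]
    calc _ ≤ M * p0 * ε := by have := h5 n j; gcongr
      _ = _ := by ring
  have := q_union_le (μ := μ) (Good α W Y U A t K j) (B1 ∪ B2) x0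
  have := q_union_le (μ := μ) B1 B2 x0
  nlinarith

end law

section law
variable {μ : Measure (ℕ → V d)}

def CI (K m : ℕ) (x0 x1 : V d) (ω : ℕ → V d) (i : ℕ) : Prop :=
  (∀ l < i + K, ω l ∈ cube x0 (m - 1)) ∧ (∀ l, i ≤ l → l < i + K → ω l ∈ cube x1 (m / 4)) ∧ ω ∈ noret K i

def GG (α : Set (V d)) (K m : ℕ) (x0 x1 : V d) (a : ℝ) : Set (ℕ → V d) :=
  {ω | (∀ j, 1 ≤ j → ω j ∉ α) ∧ ∃ I : Finset ℕ, a ≤ I.card ∧ ∀ i ∈ I, CI K m x0 x1 ω i}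

lemma rev_markov {Ω : Type*} [MeasurableSpace Ω] (ν : Measure Ω) [IsProbabilityMeasure ν] (J : ℕ) (G : ℕ → Set Ω)
    (E : Set Ω) (hG : ∀ j, MeasurableSet (G j)) (hE : MeasurableSet E) (hGE : ∀ j, G j ⊆ E) (a : ℝ) (ha : 0 ≤ a) :
    ∑ j ∈ Finset.range J, ν.real (G j) ≤
      J * ν.real {ω | a ≤ (((Finset.range J).filter fun j => ω ∈ G j).card : ℝ)} + a * ν.real E := by
  set N : Ω → ℝ := fun ω => ∑ j ∈ Finset.range J, (G j).indicator (fun _ => (1:ℝ)) ω with hN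
  have hNc : ∀ ω, N ω = (((Finset.range J).filter fun j => ω ∈ G j).card : ℝ) := by
    intro ω
    rw [hN]
    simp only [Set.indicator_apply]
    rw [Finset.sum_boole]
  simp only [← hNc]
  have hNm : Measurable N := Finset.measurable_sum _ fun j _ => measurable_const.indicator (hG j)
  set H := {ω | a ≤ N ω} with hH
  have hHm : MeasurableSet H := measurableSet_le measurable_const hNm
  have hi : ∀ S : Set Ω, MeasurableSet S → Integrable (S.indicator fun _ => (1:ℝ)) ν := fun S hS =>
    (integrable_const _).indicator hS
  have hI : ∀ S : Set Ω, MeasurableSet S → ∫ ω, S.indicator (fun _ => (1:ℝ)) ω ∂ν = ν.real S := fun S hS => by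
    rw [integral_indicator hS]; simp
  have h1 : ∫ ω, N ω ∂ν = ∑ j ∈ Finset.range J, ν.real (G j) := by
    rw [hN, integral_finsetSum _ fun j _ => hi _ (hG j)]
    exact Finset.sum_congr rfl fun j _ => hI _ (hG j)
  have h2 : ∫ ω, (J * H.indicator (fun _ => (1:ℝ)) ω + a * E.indicator (fun _ => (1:ℝ)) ω) ∂ν = J * ν.real H + a * ν.real E := by
    rw [integral_add ((hi _ hHm).const_mul _) ((hi _ hE).const_mul _), integral_const_mul, integral_const_mul, hI _ hHm, hI _ hE]
  rw [← h1, ← h2]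
  apply integral_mono (integrable_finsetSum _ fun j _ => hi _ (hG j))
    (((hi _ hHm).const_mul _).add ((hi _ hE).const_mul _))
  intro ω
  have hNJ : N ω ≤ J := by
    rw [hNc]
    exact_mod_cast (Finset.card_filter_le _ _).trans (Finset.card_range J).le
  have hE0 : 0 ≤ E.indicator (fun _ => (1:ℝ)) ω := Set.indicator_nonneg (fun _ _ => zero_le_one) ω
  show N ω ≤ J * H.indicator (fun _ => (1:ℝ)) ω + a * E.indicator (fun _ => (1:ℝ)) ω
  by_cases h : ω ∈ H
  · rw [Set.indicator_of_mem h]; nlinarith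
  · rw [Set.indicator_of_notMem h]
    have h' : N ω < a := not_le.1 h
    by_cases hω : ω ∈ E
    · rw [Set.indicator_of_mem hω]; linarith
    · have : N ω = 0 := by
        apply Finset.sum_eq_zero
        intro j _
        exact Set.indicator_of_notMem (fun h => hω (hGE j h)) _
      rw [this, mul_zero, zero_add]; positivity

lemma adj_coord {x y : V d} (h : adj x y) (i : Fin d) : |y i - x i| ≤ 1 := by
  unfold adj at h
  rw [← h, abs_sub_comm]
  exact Finset.single_le_sum (f := fun i => |x i - y i|) (fun i _ => abs_nonneg _) (Finset.mem_univ i)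

lemma nn_disp {ω : ℕ → V d} (h : ∀ i, adj (ω i) (ω (i+1))) (a l : ℕ) (i : Fin d) : |ω (a + l) i - ω a i| ≤ (l:ℤ) := by
  induction l with
  | zero => simp
  | succ l ih =>
    have h1 := adj_coord (h (a + l)) i
    have : ω (a + (l + 1)) = ω (a + l + 1) := rfl
    rw [this]
    have := abs_sub_le (ω (a + l + 1) i) (ω (a + l) i) (ω a i)
    push_cast; linarith

lemma good_CI {α W Y U A : Set (V d)} {t K j m : ℕ} {x0 x1 : V d} {ω : ℕ → V d} (h0 : ω 0 = x0)
    (hnn : ∀ i, adj (ω i) (ω (i+1))) (hW : W ⊆ cube x0 (m - 1)) (hU : U ⊆ cube x0 (m - 1))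
    (hA : ∀ z ∈ A, ∀ z' : V d, (∀ i, |z' i - z i| ≤ (K:ℤ)) → z' ∈ cube x0 (m - 1) ∧ z' ∈ cube x1 (m / 4))
    (h : ω ∈ Good α W Y U A t K j) : CI K m x0 x1 ω (t + j) := by
  obtain ⟨⟨⟨h1, h2, h3, h4⟩, h5⟩, h6⟩ := h
  have key : ∀ l, t + j ≤ l → l < t + j + K → ω l ∈ cube x0 (m - 1) ∧ ω l ∈ cube x1 (m / 4) := by
    intro l hl1 hl2
    refine hA _ h4 _ fun i => ?_
    have := nn_disp hnn (t + j) (l - (t + j)) i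
    rw [show t + j + (l - (t + j)) = l by omega] at this
    refine this.trans (by omega)
  refine ⟨fun l hl => ?_, fun l a b => (key l a b).2, h6⟩
  by_cases hl0 : l = 0
  · subst hl0; rw [h0]; intro i; simp
  by_cases hlt : l ≤ t
  · exact hW (h1 l (by omega) hlt)
  by_cases hlj : l ≤ t + j
  · have := hU (h3 (l - t) (by omega) (by omega))
    have e : sh t ω (l - t) = ω l := by unfold sh; congr 1; omega
    rwa [e] at this
  · exact (key l (by omega) hl).1

lemma good_esc {α W Y U A : Set (V d)} {t K j : ℕ} (hW : ∀ x ∈ W, x ∉ α) (hU : ∀ x ∈ U, x ∉ α) :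
    Good α W Y U A t K j ⊆ sh 1 ⁻¹' Fav α := by
  rintro ω ⟨⟨⟨h1, h2, h3, h4⟩, h5⟩, h6⟩ a
  show ω (1 + a) ∉ α
  by_cases hlt : 1 + a ≤ t
  · exact hW _ (h1 _ (by omega) hlt)
  by_cases hlj : 1 + a ≤ t + j
  · have := hU _ (h3 (1 + a - t) (by omega) (by omega))
    have e : sh t ω (1 + a - t) = ω (1 + a) := by unfold sh; congr 1; omega
    rwa [e] at this
  · have e : ω (t + j + (1 + a - (t + j))) ∉ α := h5 (1 + a - (t + j))
    rwa [show t + j + (1 + a - (t + j)) = 1 + a by omega] at e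

/-- from expected number of good times to probability of many good times -/
lemma good_many (hd : 5 ≤ d) (hμ : IsSRWLaw μ 0) {α W Y U A : Set (V d)} {t K J m : ℕ} {x0 x1 : V d}
    (hWα : ∀ x ∈ W, x ∉ α) (hUα : ∀ x ∈ U, x ∉ α) (hW : W ⊆ cube x0 (m - 1)) (hU : U ⊆ cube x0 (m - 1))
    (hA : ∀ z ∈ A, ∀ z' : V d, (∀ i, |z' i - z i| ≤ (K:ℤ)) → z' ∈ cube x0 (m - 1) ∧ z' ∈ cube x1 (m / 4))
    (a : ℝ) (ha : 0 < a) :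
    ∑ j ∈ Finset.range J, q μ (Good α W Y U A t K j) x0 ≤ J * q μ (GG α K m x0 x1 a) x0 + a * PP (vv μ α) x0 := by
  have := hμ.1
  have h := rev_markov μ J (fun j => pth x0 ⁻¹' Good α W Y U A t K j) (pth x0 ⁻¹' (sh 1 ⁻¹' Fav α))
    (fun j => pth_meas x0 (Good_meas _ _ _ _ _ _ _ _)) (pth_meas x0 (sh_meas' _ (Fav_meas α)))
    (fun j => Set.preimage_mono (good_esc hWα hUα)) a ha.le
  refine h.trans ?_
  have e : μ.real (pth x0 ⁻¹' (sh 1 ⁻¹' Fav α)) = PP (vv μ α) x0 := q_step hd hμ (Fav_meas α) x0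
  rw [e]
  have h2 : q μ {ω | a ≤ (((Finset.range J).filter fun j => ω ∈ Good α W Y U A t K j).card : ℝ)} x0 ≤ q μ (GG α K m x0 x1 a) x0 := by
    apply q_mono' hd hμ
    intro ω h0 hnn hω
    set I := (Finset.range J).filter fun j => ω ∈ Good α W Y U A t K j with hI
    have hω' : a ≤ (I.card : ℝ) := hω
    have hne : I.Nonempty := by
      rw [← Finset.card_pos]
      exact_mod_cast ha.trans_le hω'
    obtain ⟨j0, hj0⟩ := hne
    refine ⟨fun j hj => ?_, I.image (fun j => t + j), ?_, ?_⟩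
    · have h3 := good_esc hWα hUα (Finset.mem_filter.1 hj0).2 (j - 1)
      have e : sh 1 ω (j - 1) = ω j := by unfold sh; congr 1; omega
      rwa [e] at h3
    · rw [Finset.card_image_of_injective _ (add_right_injective t)]; exact hω'
    · intro i hi
      obtain ⟨j, hj, rfl⟩ := Finset.mem_image.1 hi
      exact good_CI h0 hnn hW hU hA (Finset.mem_filter.1 hj).2
  have h3 : (J:ℝ) * q μ {ω | a ≤ (((Finset.range J).filter fun j => ω ∈ Good α W Y U A t K j).card : ℝ)} x0 ≤ J * q μ (GG α K m x0 x1 a) x0 :=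
    mul_le_mul_of_nonneg_left h2 (Nat.cast_nonneg J)
  unfold q at h3 ⊢
  exact add_le_add_left h3 _

lemma gG_small {T X : ℝ} (hT : 0 < T) (hX : 0 < X) (hTX : T ^ 4 ≤ X) (x : V d) (h : X ≤ nsq x) : gG x ≤ 1 / (X * T) := by
  have hb := bq_pos x
  have h4 := bq_pow x
  have hTb : T ≤ bq x := by
    apply le_of_pow_le_pow_left₀ (n := 4) (by norm_num) hb.le
    rw [h4]; linarith
  unfold gG
  apply one_div_le_one_div_of_le (by positivity)
  calc X * T ≤ bq x ^ 4 * bq x := by gcongr; linarith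
    _ = _ := by ring

end law

lemma nsq_x1 (i : Fin d) {σ n : ℤ} (hσ : σ = 1 ∨ σ = -1) (x0 y : V d) (hx0 : ell i σ n x0 = 0) (R : ℕ) :
    nsq (y - (x0 + ((R:ℤ) * σ) • ev i)) = nsq (y - x0) - 2 * R * ell i σ n y + (R:ℝ)^2 := by
  have h := nsq_add_smul (y - x0) i (-((R:ℤ) * σ))
  have e : y - (x0 + ((R:ℤ) * σ) • ev i) = y - x0 + (-((R:ℤ) * σ)) • ev i := by rw [neg_smul]; abel
  rw [e, h]
  have h2 : (σ:ℝ) * x0 i = n := by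
    have : σ * x0 i = n := by unfold ell at hx0; omega
    exact_mod_cast this
  have h3 : (σ:ℝ)^2 = 1 := by rcases hσ with rfl | rfl <;> norm_num
  unfold ell
  simp only [Pi.sub_apply]
  push_cast
  linear_combination (R:ℝ)^2 * h3 + 2 * R * h2

lemma mem_cube_of_nrm {x y : V d} {r : ℕ} (h : nrm (x - y) < r + 1) : x ∈ cube y r := by
  intro i
  have h1 := (abs_le_nrm (x - y) i).trans_lt h
  have : |((x - y) i : ℤ)| < (r:ℤ) + 1 := by exact_mod_cast h1
  have h2 : |x i - y i| < (r:ℤ) + 1 := this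
  omega

lemma ar1 {s R t : ℝ} (h : 2 ≤ s * R) (ht : s^2 * R^2 < t + 1) : (s * R)^2 ≤ 2 * t ∧ 1 < t := by
  constructor <;> nlinarith

lemma ar2 {δ R l N D s: ℝ} (hR : 0 ≤ R) (h1 : N < D * (s^2 * R^2)) (h0 : D * s^2 ≤ δ) (h2 : δ * R ≤ l) :
    N - 2 * R * l + R^2 ≤ (1 - δ) * R^2 := by
  have h3 := mul_le_mul_of_nonneg_left h2 hR
  have h4 := mul_le_mul_of_nonneg_right h0 (sq_nonneg R)
  nlinarith

lemma large_core (hd : 5 ≤ d) {s δ : ℝ} (hs0 : 0 < s) (hδd : δ * (8 * d) = s) (hsδ : 128 * d^2 * s^2 ≤ δ)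
    (hd2s : 128 * d^2 * s^2 ≤ 1 / 4) {m R K : ℕ} (hR1 : 2 * R ≤ m) (hR2 : m ≤ 4 * R) (hRK : 4 * K + 4 ≤ R)
    (hR8 : 8 ≤ R) (hRs : 2 ≤ s * R)
    {μ : Measure (ℕ → V d)} (hμ : IsSRWLaw μ 0) {i : Fin d} {σ n : ℤ} (hσ : σ = 1 ∨ σ = -1) {α : Set (V d)}
    (hα : ∀ x ∈ α, ell i σ n x ≤ 0) {x0 : V d} (hx0 : ell i σ n x0 = 0) {CH cL V0 : ℝ} (hCH : 1 ≤ CH) (hcL : 0 < cL)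
    (hV0 : 0 < V0) (hup : ∀ z, nrm (z - x0) ≤ m → vv μ α z ≤ CH * V0) {x1 : V d} (hx1 : x1 = x0 + ((R:ℤ) * σ) • ev i)
    (hlo : ∀ w, nsq (w - x1) ≤ (R:ℝ)^2 / 16 → cL * V0 ≤ vv μ α w)
    {c2 ε : ℝ} {J : ℕ} (hst : ∀ y, nsq (y - x1) ≤ (1 - δ) * (R:ℝ)^2 →
      c2 * (R:ℝ)^2 ≤ ∑ j ∈ Finset.range J, QI {x | nsq (x - x1) < (R:ℝ)^2} j (fun z => if nsq (z - x1) ≤ (R:ℝ)^2 / 16 then 1 else 0) y)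
    (hK : ∀ n n' : ℕ, ∑ k ∈ Finset.range n, ∑ j ∈ Finset.range n', pk (K + k + j) (0 : V d) ≤ ε)
    (hb : ∀ w : V d, (R:ℝ)^2 / 16 ≤ nsq w → (s^2 * (R:ℝ)^2 + 1) * (CH * (gG w / (gG (0 : V d) - PP gG (0 : V d)))) ≤ cL / 4) :
    ∃ p0, 0 ≤ p0 ∧ PP (vv μ α) x0 ≤ 64 * d * (CH * V0) * p0 ∧ ∀ a, 0 < a →
      (3 / 4 * (cL * V0)) * (c2 * (R:ℝ)^2 * p0) - J * (CH * V0 * ε * p0) ≤ J * q μ (GG α K m x0 x1 a) x0 + a * PP (vv μ α) x0 := by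
  have hd0 : (5:ℝ) ≤ d := by exact_mod_cast hd
  have hR80 : (8:ℝ) ≤ R := by exact_mod_cast hR8
  have hRm : 2 * (R:ℝ) ≤ m := by exact_mod_cast hR1
  have hRK' : 4 * (K:ℝ) + 4 ≤ R := by exact_mod_cast hRK
  obtain ⟨t, ht⟩ : ∃ t, t = ⌊s^2 * (R:ℝ)^2⌋₊ := ⟨_, rfl⟩
  have ht1 : (t:ℝ) ≤ s^2 * (R:ℝ)^2 := by rw [ht]; exact Nat.floor_le (by positivity)
  have ht2 : s^2 * (R:ℝ)^2 < t + 1 := by rw [ht]; exact Nat.lt_floor_add_one _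
  obtain ⟨ht4, ht3'⟩ := ar1 hRs ht2
  have ht3 : 1 ≤ t := by exact_mod_cast ht3'.le
  obtain ⟨r2, hr2⟩ : ∃ r2, r2 = 128 * (d:ℝ)^2 * (s^2 * (R:ℝ)^2) := ⟨_, rfl⟩
  have hr2' : r2 ≤ (R / 2 :ℝ)^2 := by
    have h1 : r2 = 128 * d^2 * s^2 * (R:ℝ)^2 := by rw [hr2]; ring
    have h2 := mul_le_mul_of_nonneg_right hd2s (sq_nonneg (R:ℝ))
    rw [h1]; linarith
  obtain ⟨τ, hτ⟩ : ∃ τ, τ = δ * (R:ℝ) := ⟨_, rfl⟩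
  obtain ⟨B, hB⟩ : ∃ B : Set (V d), B = {x | nsq (x - x0) < r2} := ⟨_, rfl⟩
  obtain ⟨Y, hY⟩ : ∃ Y : Set (V d), Y = {y | 0 < ell i σ n y ∧ τ ≤ ell i σ n y} := ⟨_, rfl⟩
  obtain ⟨U, hU⟩ : ∃ U : Set (V d), U = {x | nsq (x - x1) < (R:ℝ)^2} := ⟨_, rfl⟩
  obtain ⟨A, hA⟩ : ∃ A : Set (V d), A = {x | nsq (x - x1) ≤ (R:ℝ)^2 / 16} := ⟨_, rfl⟩
  have hBn : ∀ x ∈ B, nrm (x - x0) ≤ R / 2 := by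
    intro x hx
    rw [nrm_le_iff _ (by positivity)]
    rw [hB] at hx
    exact (le_of_lt hx).trans hr2'
  have hUn : ∀ x ∈ U, nrm (x - x1) < R := by
    intro x hx
    rw [hU] at hx
    have : nsq (x - x1) < (R:ℝ)^2 := hx
    rw [← nrm_sq] at this
    exact lt_of_pow_lt_pow_left₀ 2 (by positivity) this
  have hAn : ∀ x ∈ A, nrm (x - x1) ≤ R / 4 := by
    intro x hx
    rw [nrm_le_iff _ (by positivity)]
    rw [hA] at hx
    have : nsq (x - x1) ≤ (R:ℝ)^2 / 16 := hx
    linarith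
  have hx10 : nrm (x1 - x0) = R := by
    rw [hx1, add_sub_cancel_left, nrm_smul_ev, abs_mul_sg hσ]; simp
  have hlx1 : (ell i σ n x1 : ℝ) = R := by rw [hx1, ell_smul i hσ, hx0]; simp
  have hM0 : 0 ≤ CH * V0 := by positivity
  have hkey := keyloc hd i hσ αᶜ (fun x hx h => by have := hα x h; omega) x0 hx0 t ht3 τ (by
      apply Real.le_sqrt_of_sq_le
      have : 8 * d * τ = s * R := by rw [hτ, ← hδd]; ring
      rw [this]; exact ht4) r2 (by rw [hr2]; gcongr) (vv μ α) (CH * V0) hM0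
      (fun x hx => vv_harm hd hμ hx) (fun x hx => vv_zero hd hμ (by simpa using hx)) (by
      intro x hx j
      have h1 := hBn x (by rw [hB]; exact hx)
      have e1 : nrm (ev j : V d) = 1 := by simpa using nrm_smul_ev j 1
      constructor
      · apply hup
        have := nrm_add_le (x - x0) (ev j)
        rw [show x + ev j - x0 = x - x0 + ev j by abel]; linarith
      · apply hup
        have := nrm_add_le (x - x0) (-ev j)
        rw [nrm_neg] at this
        rw [show x - ev j - x0 = x - x0 + -ev j by abel]; linarith)
  rw [← hB] at hkey
  obtain ⟨W, hW⟩ : ∃ W : Set (V d), W = αᶜ ∩ B := ⟨_, rfl⟩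
  have eY : QI W t (fun y => if 0 < ell i σ n y ∧ τ ≤ ell i σ n y then 1 else 0) x0 = QI W t (Y.indicator fun _ => 1) x0 := by
    apply QI_congr; intro y
    by_cases h : 0 < ell i σ n y ∧ τ ≤ ell i σ n y
    · rw [if_pos h, Set.indicator_of_mem (by rw [hY]; exact h)]
    · rw [if_neg h, Set.indicator_of_notMem (by rw [hY]; exact h)]
  rw [← hW, eY] at hkey
  obtain ⟨p0, hp0⟩ : ∃ p0, p0 = QI W t (Y.indicator fun _ => 1) x0 := ⟨_, rfl⟩
  have hp00 : 0 ≤ p0 := by rw [hp0]; exact QI_nonneg (fun y => Set.indicator_nonneg (fun _ _ => zero_le_one) y) t x0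
  refine ⟨p0, hp00, by rw [hp0]; exact hkey, ?_⟩
  intro a ha
  have hsum := E0_sum hd hμ W Y U A t J ht3 x0 (c2 * (R:ℝ)^2) (by
    intro y hyW hyY
    rw [hW, hB] at hyW
    rw [hY] at hyY
    have h1 : nsq (y - x0) < r2 := hyW.2
    have h2 : τ ≤ ell i σ n y := hyY.2
    rw [hτ] at h2
    rw [hr2] at h1
    refine (hst y ?_).trans (le_of_eq ?_)
    · rw [hx1, nsq_x1 i hσ x0 y hx0]
      exact ar2 (by positivity) h1 hsδ h2
    · rw [hU, hA]
      apply Finset.sum_congr rfl; intro j _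
      apply QI_congr; intro z; rw [Set.indicator_apply]; rfl)
  rw [← hp0] at hsum
  have hdist : ∀ x, x ∈ W ∨ x = x0 → nrm (x - x0) ≤ R / 2 := by
    rintro x (hx | rfl)
    · rw [hW] at hx; exact hBn x hx.2
    · rw [sub_self]
      have : nrm (0 : V d) = 0 := by simp [nrm, nsq]
      rw [this]; positivity
  have hgood := fun j => good_one hd hμ α W Y U A t K j x0 (cL * V0) (CH * V0) (cL * V0 / 4) ε (by positivity) hM0 (by positivity)
    (by rw [hA]; exact hlo) (by
      intro x hx
      apply hup
      rcases or_assoc.2 hx with h | h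
      · have := hdist x h; linarith
      · have h1 := hUn x h
        have := nrm_tri x x1 x0
        linarith) (by
      intro x hx z hz
      have h1 := hdist x hx
      have h2 := hAn z hz
      have h3 := nrm_tri x1 z x0
      have h4 := nrm_tri z x x0
      rw [nrm_sub_comm x1 z] at h3
      have h5 : (R:ℝ) / 4 ≤ nrm (z - x) := by linarith
      have h6 : (R:ℝ)^2 / 16 ≤ nsq (z - x) := by
        rw [← nrm_sq]
        have := pow_le_pow_left₀ (by positivity) h5 2
        linarith
      have h7 := mul_le_mul_of_nonneg_left (hb _ h6) hV0.le
      have h8 : 0 ≤ CH * (gG (z - x) / (gG (0 : V d) - PP gG (0 : V d))) * V0 := by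
        have := div_nonneg (gG_pos (z - x)).le (barrier_main hd (0 : V d)).2.le
        positivity
      have h9 := mul_le_mul_of_nonneg_right (by linarith : (t:ℝ) + 1 ≤ s^2 * (R:ℝ)^2 + 1) h8
      linarith) hK
  have hmany := good_many (J := J) (m := m) (x0 := x0) (x1 := x1) (α := α) (W := W) (Y := Y) (U := U) (A := A) (t := t) (K := K) hd hμ
    (by rw [hW]; exact fun x hx => hx.1)
    (by
      intro x hx h
      have h1 := hUn x hx
      have h2 := ell_lip i (n := n) hσ x x1
      have h3 : (ell i σ n x : ℝ) ≤ 0 := by exact_mod_cast hα x h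
      linarith)
    (by
      intro x hx
      apply mem_cube_of_nrm
      have := hdist x (Or.inl hx)
      rw [Nat.cast_sub (by omega)]; push_cast; linarith)
    (by
      intro x hx
      apply mem_cube_of_nrm
      have h1 := hUn x hx
      have := nrm_tri x x1 x0
      rw [Nat.cast_sub (by omega)]; push_cast; linarith)
    (by
      intro z hz z' hz'
      have h1 := hAn z hz
      have key : ∀ j, |z' j - x1 j| ≤ ((R / 4 + K : ℕ) : ℤ) := by
        intro j
        have h2 := (abs_le_nrm (z - x1) j).trans h1
        have h3 : |z j - x1 j| ≤ ((R / 4 : ℕ) : ℤ) := by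
          have h4 : ((4 * |z j - x1 j| : ℤ) : ℝ) ≤ (R : ℤ) := by
            have : (((|z j - x1 j| : ℤ)) : ℝ) ≤ R / 4 := by simpa using h2
            push_cast at this ⊢; linarith
          have h5 : 4 * |z j - x1 j| ≤ (R : ℤ) := by exact_mod_cast h4
          omega
        have := abs_sub_le (z' j) (z j) (x1 j)
        have := hz' j
        push_cast at *
        linarith
      constructor
      · intro j
        have h2 : |x1 j - x0 j| ≤ (R:ℤ) := by
          have := abs_le_nrm (x1 - x0) j
          rw [hx10] at this
          have h3 : ((|x1 j - x0 j| : ℤ) : ℝ) ≤ R := by simpa using this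
          exact_mod_cast h3
        have := abs_sub_le (z' j) (x1 j) (x0 j)
        have := key j
        omega
      · intro j
        have := key j
        omega) a ha
  refine le_trans ?_ hmany
  have h1 := Finset.sum_le_sum fun j (_ : j ∈ Finset.range J) => hgood j
  refine le_trans ?_ h1
  rw [Finset.sum_sub_distrib, ← Finset.mul_sum, Finset.sum_const, Finset.card_range, nsmul_eq_mul, ← hp0]
  have h2 := mul_le_mul_of_nonneg_left hsum (by positivity : 0 ≤ 3 / 4 * (cL * V0))
  have e : cL * V0 - cL * V0 / 4 = 3 / 4 * (cL * V0) := by ring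
  rw [e]
  linarith

lemma fin_ar {P D CH V0 p0 cL c2 J0 J R2 a Q ε m2 c : ℝ} (hD : 0 < D) (hCH : 0 < CH) (hcL : 0 < cL) (hc2 : 0 < c2)
    (hV0 : 0 < V0) (hp0 : 0 ≤ p0) (hP : 0 ≤ P) (hQ : 0 ≤ Q) (hR2 : 0 < R2)
    (hJ0 : 0 < J0) (h1 : P ≤ 64 * D * (CH * V0) * p0)
    (h2 : (3 / 4 * (cL * V0)) * (c2 * R2 * p0) - J * (CH * V0 * ε * p0) ≤ J * Q + a * P)
    (hε : ε = cL * c2 / (4 * CH * (J0 + 1))) (hJ : J ≤ (J0 + 1) * R2)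
    (hc : c = cL * c2 / (128 * D * CH) / (32 * (J0 + 1))) (ha : a = c * m2) (hm : m2 ≤ 16 * R2) : c * P ≤ Q := by
  have hJ1 : 0 < J0 + 1 := by linarith
  have hcp : 0 < c := by rw [hc]; positivity
  have hεp : 0 < ε := by rw [hε]; positivity
  have e1 : J * (CH * V0 * ε * p0) ≤ (J0 + 1) * R2 * (CH * V0 * ε * p0) :=
    mul_le_mul_of_nonneg_right hJ (by positivity)
  have e2 : (J0 + 1) * R2 * (CH * V0 * ε * p0) = cL * c2 / 4 * R2 * V0 * p0 := by
    rw [hε]; field_simp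
  have e3 : J * Q ≤ (J0 + 1) * R2 * Q := mul_le_mul_of_nonneg_right hJ hQ
  have e4 : a * P ≤ c * (16 * R2) * P := by rw [ha]; gcongr
  have e5 : 32 * (J0 + 1) * c * R2 * P ≤ 32 * (J0 + 1) * c * R2 * (64 * D * (CH * V0) * p0) := by gcongr
  have e6 : 32 * (J0 + 1) * c * R2 * (64 * D * (CH * V0) * p0) = cL * c2 / 2 * R2 * V0 * p0 := by
    rw [hc]; field_simp; ring
  have e7 : c * (16 * R2) * P ≤ c * (16 * R2) * P * (J0 + 1) := le_mul_of_one_le_right (by positivity) (by linarith)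
  have e8 : 16 * ((J0 + 1) * R2) * (c * P) ≤ (J0 + 1) * R2 * Q := by linarith
  have e9 : (J0 + 1) * R2 * (c * P) ≤ (J0 + 1) * R2 * Q := by
    have : 0 ≤ (J0 + 1) * R2 * (c * P) := by positivity
    linarith
  exact le_of_mul_le_mul_left e9 (by positivity)

lemma pk_tail1 (hd : 5 ≤ d) (ε : ℝ) (hε : 0 < ε) : ∃ K : ℕ, 1 ≤ K ∧ ∀ n n' : ℕ,
    ∑ k ∈ Finset.range n, ∑ j ∈ Finset.range n', pk (K + k + j) (0 : V d) ≤ ε := by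
  obtain ⟨K, hK⟩ := pk_tail hd (0 : V d) ε hε
  refine ⟨K + 1, by omega, fun n n' => ?_⟩
  have h := hK (n + 1) n'
  rw [Finset.sum_range_succ'] at h
  have h0 : 0 ≤ ∑ j ∈ Finset.range n', pk (K + 0 + j) (0 : V d) := Finset.sum_nonneg fun j _ => pk_nonneg _ _
  have e : ∑ k ∈ Finset.range n, ∑ j ∈ Finset.range n', pk (K + 1 + k + j) (0 : V d)
    = ∑ k ∈ Finset.range n, ∑ j ∈ Finset.range n', pk (K + (k + 1) + j) (0 : V d) := by
    apply Finset.sum_congr rfl; intro k _; apply Finset.sum_congr rfl; intro j _; congr 1; ring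
  linarith

lemma PP_vv_le (hd : 5 ≤ d) {μ : Measure (ℕ → V d)} (α : Set (V d)) (x0 : V d) (M : ℝ)
    (h : ∀ z, nrm (z - x0) ≤ 1 → vv μ α z ≤ M) : PP (vv μ α) x0 ≤ M := by
  rw [← PP_const hd M x0]
  apply PP_mono_at
  intro j
  have e1 : nrm (ev j : V d) = 1 := by simpa using nrm_smul_ev j 1
  exact ⟨h _ (by rw [add_sub_cancel_left, e1]), h _ (by rw [show x0 - ev j - x0 = -ev j by abel, nrm_neg, e1])⟩

lemma hb_ar {s R T CH cL g0 g : ℝ} (hs : s^2 ≤ 1) (hR : 1 ≤ R) (hCH : 1 ≤ CH) (hcL : 0 < cL) (hg0 : 0 < g0)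
    (hT : T = 128 * CH / (cL * g0)) (hg : g ≤ 1 / (R^2 / 16 * T)) :
    (s^2 * R^2 + 1) * (CH * (g / g0)) ≤ cL / 4 := by
  have h1 : s^2 * R^2 + 1 ≤ 2 * R^2 := by nlinarith
  have hT0 : 0 < T := by rw [hT]; positivity
  have h2 : CH * (g / g0) ≤ CH * (1 / (R^2 / 16 * T) / g0) := by gcongr
  have h3 : 0 ≤ CH * (1 / (R^2 / 16 * T) / g0) := by positivity
  calc (s^2 * R^2 + 1) * (CH * (g / g0)) ≤ (s^2 * R^2 + 1) * (CH * (1 / (R^2 / 16 * T) / g0)) := by gcongr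
    _ ≤ 2 * R^2 * (CH * (1 / (R^2 / 16 * T) / g0)) := by gcongr
    _ = cL / 4 := by rw [hT]; field_simp; norm_num

lemma large (hd : 5 ≤ d) : ∃ (c : ℝ) (K m0 : ℕ), 0 < c ∧ 1 ≤ K ∧ ∀ m : ℕ, m0 ≤ m →
    ∀ μ : Measure (ℕ → V d), IsSRWLaw μ 0 → ∀ (i : Fin d) (σ n : ℤ), (σ = 1 ∨ σ = -1) → ∀ α : Set (V d),
    (∀ x ∈ α, ell i σ n x ≤ 0) → ∀ x0, ell i σ n x0 = 0 →
    c * PP (vv μ α) x0 ≤ q μ (GG α K m x0 (x0 + (((m/2 : ℕ):ℤ) * σ) • ev i) (c * (m:ℝ)^2)) x0 := by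
  obtain ⟨CH, cL, k, hCH, hcL, hk, hE⟩ := e2 hd
  have hd0 : (5:ℝ) ≤ d := by exact_mod_cast hd
  have hdp : (0:ℝ) < d := by linarith
  have hd3 : (125:ℝ) ≤ (d:ℝ)^3 := by
    have := pow_le_pow_left₀ (by norm_num) hd0 3; linarith
  obtain ⟨s, hs⟩ : ∃ s : ℝ, s = 1 / (1024 * (d:ℝ)^3) := ⟨_, rfl⟩
  have hs0 : 0 < s := by rw [hs]; positivity
  have hsd : s * (d:ℝ)^3 = 1 / 1024 := by rw [hs]; field_simp
  have hs1 : s ≤ 1 / 1024 := by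
    rw [← hsd]; exact le_mul_of_one_le_right hs0.le (by linarith)
  obtain ⟨δ, hδ⟩ : ∃ δ : ℝ, δ = s / (8 * d) := ⟨_, rfl⟩
  have hδ0 : 0 < δ := by rw [hδ]; positivity
  have hδd : δ * (8 * d) = s := by rw [hδ]; field_simp
  have hsδ : 128 * d^2 * s^2 ≤ δ := by
    rw [hδ, le_div_iff₀ (by positivity)]
    have : 128 * (d:ℝ)^2 * s^2 * (8 * d) = 1024 * (s * d^3) * s := by ring
    rw [this, hsd]; linarith
  have hδs : δ ≤ s := by
    rw [hδ]; exact div_le_self hs0.le (by linarith)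
  have hd2s : 128 * d^2 * s^2 ≤ 1 / 4 := by linarith
  obtain ⟨c2, J0, hc2, hJ0, hst⟩ := stage2 hd δ hδ0 (by linarith)
  obtain ⟨ε, hε⟩ : ∃ ε : ℝ, ε = cL * c2 / (4 * CH * (J0 + 1)) := ⟨_, rfl⟩
  have hε0 : 0 < ε := by rw [hε]; positivity
  obtain ⟨K, hK1, hK⟩ := pk_tail1 hd ε hε0
  obtain ⟨g0, hg0⟩ : ∃ g0 : ℝ, g0 = gG (0 : V d) - PP gG (0 : V d) := ⟨_, rfl⟩
  have hg0p : 0 < g0 := by rw [hg0]; exact (barrier_main hd (0 : V d)).2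
  obtain ⟨T, hT⟩ : ∃ T : ℝ, T = 128 * CH / (cL * g0) := ⟨_, rfl⟩
  have hT0 : 0 < T := by rw [hT]; positivity
  obtain ⟨R0, hR0⟩ := exists_nat_ge (2 / s + 4 * T^2 + 32 * d)
  obtain ⟨c, hc⟩ : ∃ c : ℝ, c = cL * c2 / (128 * d * CH) / (32 * (J0 + 1)) := ⟨_, rfl⟩
  have hc0 : 0 < c := by rw [hc]; positivity
  refine ⟨c, K, 2 * (R0 + 4 * K + 8), hc0, hK1, ?_⟩
  intro m hm μ hμ i σ n hσ α hα x0 hx0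
  obtain ⟨R, hR⟩ : ∃ R, R = m / 2 := ⟨_, rfl⟩
  rw [← hR]
  have hRR : R0 + 4 * K + 8 ≤ R := by omega
  have hRr : (R0:ℝ) + 4 * K + 8 ≤ R := by exact_mod_cast hRR
  have hK0 : (0:ℝ) ≤ K := by positivity
  have hp1 : 0 < 2 / s := by positivity
  have hp2 : 0 < T^2 := by positivity
  obtain ⟨hup, hlo⟩ := hE μ hμ i σ n hσ α hα x0 hx0 m (by omega)
  obtain ⟨V0, hV0⟩ : ∃ V0, V0 = vv μ α (x0 + (2 * ((k * m : ℕ):ℤ) * σ) • ev i) := ⟨_, rfl⟩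
  rw [← hV0] at hup hlo
  have hP0 : 0 ≤ PP (vv μ α) x0 := PP_nonneg (fun x => vv_nonneg α x) x0
  have hm1 : (1:ℝ) ≤ m := by exact_mod_cast (by omega : 1 ≤ m)
  rcases (show 0 ≤ V0 by rw [hV0]; exact vv_nonneg α _).eq_or_lt with h0 | h0
  · have := PP_vv_le hd (μ := μ) α x0 (CH * V0) (fun z hz => hup z (hz.trans hm1))
    rw [← h0, mul_zero] at this
    rw [le_antisymm this hP0, mul_zero]
    exact q_nonneg _ _
  have hRs : 2 ≤ s * R := by
    have : 2 / s ≤ R := by linarith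
    rwa [div_le_iff₀ hs0, mul_comm] at this
  have hR1 : (1:ℝ) ≤ R := by linarith
  have hR32 : 32 * (d:ℝ) ≤ (R:ℝ)^2 := by
    have : (R:ℝ) * 1 ≤ R * R := by gcongr
    rw [sq]; linarith
  have hRT : T^4 ≤ (R:ℝ)^2 / 16 := by
    have h1 : 4 * T^2 ≤ R := by linarith
    have := pow_le_pow_left₀ (by positivity) h1 2
    linarith [show (4 * T^2)^2 = 16 * T^4 by ring]
  obtain ⟨p0, hp0, hkey, hmain⟩ := large_core hd hs0 hδd hsδ hd2s (m := m) (R := R) (K := K) (by omega) (by omega) (by omega) (by omega)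
    hRs hμ hσ hα hx0 hCH hcL h0 hup rfl (hlo R (by omega) (by omega)) (c2 := c2) (ε := ε) (J := ⌈J0 * (R:ℝ)^2⌉₊)
    (fun y hy => hst _ R hR1 hR32 _ (Nat.le_ceil _) y hy) hK (by
      intro w hw
      rw [← hg0]
      exact hb_ar (pow_le_one₀ hs0.le (by linarith)) hR1 hCH hcL hg0p hT (gG_small hT0 (by positivity) hRT w hw))
  have hm2 := hmain (c * (m:ℝ)^2) (by positivity)
  have hmR : (m:ℝ) ≤ 4 * R := by exact_mod_cast (by omega : m ≤ 4 * R)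
  refine fin_ar hdp (by linarith) hcL hc2 h0 hp0 hP0 (q_nonneg _ _) (by positivity : 0 < (R:ℝ)^2) hJ0 hkey hm2 hε ?_ hc rfl ?_
  · have := (Nat.ceil_lt_add_one (by positivity : 0 ≤ J0 * (R:ℝ)^2)).le
    have h2 : 1 ≤ (R:ℝ)^2 := one_le_pow₀ hR1
    linarith
  · have := pow_le_pow_left₀ (by positivity) hmR 2
    linarith

lemma line_prob (hd : 5 ≤ d) {μ : Measure (ℕ → V d)} (hμ : IsSRWLaw μ 0) (i : Fin d) {σ : ℤ} (hσ : σ = 1 ∨ σ = -1)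
    (x0 : V d) (J : ℕ) : q μ (cyl J fun l => x0 + ((l:ℤ) * σ) • ev i) x0 = (2 * (d:ℝ))⁻¹ ^ J := by
  have e : pth x0 ⁻¹' (cyl J fun l => x0 + ((l:ℤ) * σ) • ev i) = {ω | ∀ l ≤ J, ω l = ((l:ℤ) * σ) • ev i} := by
    ext ω; simp [cyl, pth]
  unfold q
  rw [e, measureReal_def, hμ.2 J (fun l => ((l:ℤ) * σ) • ev i) (by simp) (by
    intro l _
    rw [adj_iff_st]
    rcases hσ with rfl | rfl
    · exact ⟨(i, true), by simp [st, add_smul]⟩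
    · exact ⟨(i, false), by simp only [st]; push_cast; simp [add_smul]; abel⟩)]
  simp

lemma small (hd : 5 ≤ d) (m0 : ℕ) : ∃ c : ℝ, 0 < c ∧ ∀ m : ℕ, 1 ≤ m → m ≤ m0 →
    ∀ μ : Measure (ℕ → V d), IsSRWLaw μ 0 → ∀ (i : Fin d) (σ n : ℤ), (σ = 1 ∨ σ = -1) → ∀ α : Set (V d),
    (∀ x ∈ α, ell i σ n x ≤ 0) → ∀ x0, ell i σ n x0 = 0 →
    c * PP (vv μ α) x0 ≤ q μ (GG α 1 m x0 (x0 + (((m/2 : ℕ):ℤ) * σ) • ev i) (c * (m:ℝ)^2)) x0 := by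
  obtain ⟨CH, cL, k, hCH, hcL, hk, hE⟩ := e2 hd
  obtain ⟨g0, hg0⟩ : ∃ g0 : ℝ, g0 = gG (0 : V d) - PP gG (0 : V d) := ⟨_, rfl⟩
  have hg0p : 0 < g0 := by rw [hg0]; exact (barrier_main hd (0 : V d)).2
  obtain ⟨T, hT⟩ : ∃ T : ℝ, T = 2 * CH * (m0 + 1) / g0 + 1 := ⟨_, rfl⟩
  have hT' : 0 < 2 * CH * (m0 + 1) / g0 := by positivity
  have hT1 : 1 ≤ T := by linarith
  obtain ⟨J', hJ'⟩ := exists_nat_ge (T^2 + m0 + k * m0)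
  obtain ⟨c, hc⟩ : ∃ c : ℝ, c = (2 * (d:ℝ))⁻¹ ^ (2 * J') / (2 * CH) / (m0 + 1)^2 := ⟨_, rfl⟩
  have hdp : (0:ℝ) < d := by exact_mod_cast (by omega : 0 < d)
  have hd1 : (2 * (d:ℝ))⁻¹ ≤ 1 := inv_le_one_of_one_le₀ (by
    have : (1:ℝ) ≤ d := by exact_mod_cast (by omega : 1 ≤ d)
    linarith)
  have hc0 : 0 < c := by rw [hc]; positivity
  refine ⟨c, hc0, ?_⟩
  intro m hm1 hm μ hμ i σ n hσ α hα x0 hx0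
  obtain ⟨R, hR⟩ : ∃ R, R = m / 2 := ⟨_, rfl⟩
  rw [← hR]
  have hJk : k * m0 + m0 ≤ J' := by
    have : ((k * m0 + m0 : ℕ) : ℝ) ≤ J' := by push_cast; nlinarith
    exact_mod_cast this
  have hJT : T^2 + m0 ≤ J' := by
    have : (0:ℝ) ≤ k * m0 := by positivity
    linarith
  have hkm : k * m ≤ k * m0 := Nat.mul_le_mul_left _ hm
  obtain ⟨γ, hγ⟩ : ∃ γ : ℕ → V d, γ = fun l : ℕ => x0 + ((l:ℤ) * σ) • ev i := ⟨_, rfl⟩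
  have hell : ∀ l, ell i σ n (γ l) = l := by intro l; rw [hγ]; simp only; rw [ell_smul i hσ, hx0]; simp
  obtain ⟨hup, -⟩ := hE μ hμ i σ n hσ α hα x0 hx0 m hm1
  obtain ⟨w, hw⟩ : ∃ w, w = γ (2 * J') := ⟨_, rfl⟩
  have hVw : vv μ α (x0 + (2 * ((k * m : ℕ):ℤ) * σ) • ev i) ≤ vv μ α w := by
    have h := vv_lift hd hμ i (n := n) hσ α hα (x0 + (2 * ((k * m : ℕ):ℤ) * σ) • ev i) (by
      rw [ell_smul i hσ, hx0]; positivity) (J' - k * m)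
    refine h.trans (le_of_eq ?_)
    congr 1
    rw [hw, hγ]
    simp only
    rw [add_assoc, ← add_smul, Nat.cast_sub (by omega)]
    congr 2; push_cast; ring
  have hvv : ∀ z, nrm (z - x0) ≤ m → vv μ α z ≤ CH * vv μ α w := fun z hz => (hup z hz).trans (by gcongr)
  have hP := PP_vv_le hd (μ := μ) α x0 (CH * vv μ α w) (fun z hz => hvv z (hz.trans (by exact_mod_cast hm1)))
  have hw0 := vv_nonneg (μ := μ) α w
  rcases hw0.eq_or_lt with h0 | h0
  · rw [← h0, mul_zero] at hP
    rw [le_antisymm hP (PP_nonneg (fun x => vv_nonneg α x) x0), mul_zero]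
    exact q_nonneg _ _
  have hγl : ∀ l, γ l - x0 = ((l:ℤ) * σ) • ev i := by intro l; rw [hγ]; simp
  have hdist : ∀ l l' : ℕ, l ≤ l' → nrm (γ l' - γ l) = (l':ℝ) - l := by
    intro l l' hl
    have : γ l' - γ l = (((l' - l : ℕ):ℤ) * σ) • ev i := by
      rw [hγ]; simp only; rw [add_sub_add_left_eq_sub, ← sub_smul, Nat.cast_sub hl]; congr 1; ring
    rw [this, nrm_smul_ev, abs_mul_sg hσ, Nat.cast_sub hl]
    have hl' : (l:ℝ) ≤ l' := by exact_mod_cast hl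
    push_cast; rw [abs_of_nonneg (by linarith)]
  have hγn : ∀ l, nrm (γ l - x0) = l := by
    intro l; rw [hγl, nrm_smul_ev, abs_mul_sg hσ]; simp
  have hinj : ∀ l l', γ l = γ l' → l = l' := by
    intro l l' h
    have := congrArg (ell i σ n) h
    rw [hell, hell] at this; exact_mod_cast this
  obtain ⟨P, hPdef⟩ : ∃ P : Set (V d), P = {x | ∃ l ≤ R, x = γ l} := ⟨_, rfl⟩
  have hFm : MeasurableSet (Fav (α ∪ P)) := Fav_meas _
  have hF : vv μ α w / 2 ≤ q μ (Fav (α ∪ P)) w := by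
    have hsub : Fav α ⊆ Fav (α ∪ P) ∪ ⋃ l ∈ Finset.range (R + 1), ({ω | ∃ k, ω k = γ l} ∩ Fav α) := by
      intro ω hω
      by_cases h : ∃ j, ω j ∈ P
      · obtain ⟨j, hj⟩ := h
        rw [hPdef] at hj
        obtain ⟨l, hl, e⟩ := hj
        right
        simp only [Set.mem_iUnion]
        exact ⟨l, Finset.mem_range.2 (by omega), ⟨j, e⟩, hω⟩
      · push Not at h
        left
        intro j hj
        rcases hj with hj | hj
        · exact hω j hj
        · exact h j hj
    have h1 := (q_mono hμ hsub w).trans ((q_union_le _ _ w).trans (add_le_add_right (q_biUnion_le hμ _ _ w) _))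
    have h2 : ∀ l ∈ Finset.range (R + 1), q μ ({ω | ∃ k, ω k = γ l} ∩ Fav α) w ≤ vv μ α w / (2 * (m0 + 1)) := by
      intro l hl
      rw [Finset.mem_range] at hl
      refine (hit_avoid_any hd hμ α (γ l) w).trans ?_
      rw [← hg0]
      have hlm : (l:ℝ) ≤ m0 := by exact_mod_cast (by omega : l ≤ m0)
      have hlm' : (l:ℝ) ≤ m := by exact_mod_cast (by omega : l ≤ m)
      have h3 : vv μ α (γ l) ≤ CH * vv μ α w := hvv _ (by rw [hγn]; exact hlm')
      have h4 : gG (w - γ l) ≤ 1 / (T^4 * T) := by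
        apply gG_small (by linarith) (by positivity) le_rfl
        rw [← nrm_sq, hw, hdist _ _ (by omega)]
        have : T^2 ≤ ((2 * J' : ℕ):ℝ) - l := by push_cast; linarith
        have := pow_le_pow_left₀ (by positivity) this 2
        linarith [show (T^2)^2 = T^4 by ring]
      have h5 : gG (w - γ l) ≤ 1 / T := by
        refine h4.trans (one_div_le_one_div_of_le (by linarith) ?_)
        exact le_mul_of_one_le_left (by linarith) (one_le_pow₀ hT1)
      have h6 : 1 / T ≤ g0 / (2 * CH * (m0 + 1)) := by
        rw [← one_div_div (2 * CH * (m0 + 1)) g0]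
        apply one_div_le_one_div_of_le hT'
        linarith
      calc vv μ α (γ l) * (gG (w - γ l) / g0) ≤ (CH * vv μ α w) * (g0 / (2 * CH * (m0 + 1)) / g0) := by
            have := gG_pos (w - γ l)
            gcongr
            exact h5.trans h6
        _ = vv μ α w / (2 * (m0 + 1)) := by field_simp
    have h3 := Finset.sum_le_card_nsmul _ _ _ h2
    rw [Finset.card_range, nsmul_eq_mul] at h3
    have h4 : ((R + 1 : ℕ):ℝ) * (vv μ α w / (2 * (m0 + 1))) ≤ (m0 + 1) * (vv μ α w / (2 * (m0 + 1))) := by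
      gcongr
      exact_mod_cast (by omega : R + 1 ≤ m0 + 1)
    have h5 : (m0 + 1) * (vv μ α w / (2 * (m0 + 1))) = vv μ α w / 2 := by field_simp
    have h6 : q μ (Fav α) w = vv μ α w := rfl
    linarith
  have hM := q_markov_ge hd hμ hFm (vv μ α w / 2) (by linarith) (2 * J') (cyl (2 * J') γ) (cyl_dep _ _) (by
    intro ω hω
    rw [hω _ le_rfl, ← hw]; exact hF) x0
  have hline : q μ (cyl (2 * J') γ) x0 = (2 * (d:ℝ))⁻¹ ^ (2 * J') := by rw [hγ]; exact line_prob hd hμ i hσ x0 _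
  have hsub : cyl (2 * J') γ ∩ sh (2 * J') ⁻¹' Fav (α ∪ P) ⊆ GG α 1 m x0 (x0 + ((R:ℤ) * σ) • ev i) (c * (m:ℝ)^2) := by
    rintro ω ⟨h1, h2⟩
    have h2' : ∀ k, 2 * J' ≤ k → ω k ∉ α ∪ P := by
      intro k hk
      have := h2 (k - 2 * J')
      simpa [sh, Nat.add_sub_cancel' hk] using this
    refine ⟨?_, {R}, ?_, ?_⟩
    · intro j hj hα'
      rcases le_total j (2 * J') with h | h
      · rw [h1 j h] at hα'
        have := hα _ hα'
        rw [hell] at this; omega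
      · exact h2' j h (Or.inl hα')
    · rw [Finset.card_singleton, hc]
      have hmm : (m:ℝ)^2 ≤ (m0 + 1)^2 := by
        gcongr; exact_mod_cast (by omega : m ≤ m0 + 1)
      have h3 : (2 * (d:ℝ))⁻¹ ^ (2 * J') ≤ 1 := pow_le_one₀ (by positivity) hd1
      have h4 : (2 * (d:ℝ))⁻¹ ^ (2 * J') / (2 * CH) ≤ 1 := by
        rw [div_le_one (by positivity)]; linarith
      push_cast
      calc _ ≤ 1 / ((m0:ℝ) + 1)^2 * (m0 + 1)^2 := by gcongr
        _ = 1 := by field_simp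
    · intro i' hi'
      rw [Finset.mem_singleton] at hi'
      subst i'
      refine ⟨?_, ?_, ?_⟩
      · intro l hl
        rw [h1 l (by omega)]
        apply mem_cube_of_nrm
        rw [hγn]
        exact_mod_cast (by omega : l < m - 1 + 1)
      · intro l hl1 hl2
        have : l = R := by omega
        rw [this, h1 R (by omega), hγ]
        intro j; rw [sub_self, abs_zero]; positivity
      · intro l hl k hk e
        rw [hR] at hl
        rcases le_total k (2 * J') with h | h
        · rw [h1 k h, h1 l (by omega)] at e
          have := hinj _ _ e
          omega
        · refine h2' k h (Or.inr ?_)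
          rw [e, h1 l (by omega), hPdef]
          exact ⟨l, by omega, rfl⟩
  refine le_trans ?_ (hM.trans (q_mono hμ hsub x0))
  rw [hline, hc]
  have h1 : (1:ℝ) ≤ ((m0:ℝ) + 1)^2 := one_le_pow₀ (by linarith [(Nat.cast_nonneg m0 : (0:ℝ) ≤ m0)])
  have h2 : (2 * (d:ℝ))⁻¹ ^ (2 * J') / (2 * CH) / (m0 + 1)^2 ≤ (2 * (d:ℝ))⁻¹ ^ (2 * J') / (2 * CH) :=
    div_le_self (by positivity) h1
  calc _ ≤ (2 * (d:ℝ))⁻¹ ^ (2 * J') / (2 * CH) * (CH * vv μ α w) := by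
        have := PP_nonneg (fun x => vv_nonneg (μ := μ) α x) x0
        gcongr
    _ = _ := by field_simp

lemma GG_mono {α : Set (V d)} {K m : ℕ} {x0 x1 : V d} {a b : ℝ} (h : a ≤ b) : GG α K m x0 x1 b ⊆ GG α K m x0 x1 a := by
  rintro ω ⟨h1, I, h2, h3⟩
  exact ⟨h1, I, h.trans h2, h3⟩

lemma combined (hd : 5 ≤ d) : ∃ (c : ℝ) (K0 : ℕ), 0 < c ∧ 1 ≤ K0 ∧ ∀ m : ℕ, 1 ≤ m → ∃ K, 1 ≤ K ∧ K ≤ K0 ∧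
    ∀ μ : Measure (ℕ → V d), IsSRWLaw μ 0 → ∀ (i : Fin d) (σ n : ℤ), (σ = 1 ∨ σ = -1) → ∀ α : Set (V d),
    (∀ x ∈ α, ell i σ n x ≤ 0) → ∀ x0, ell i σ n x0 = 0 →
    c * PP (vv μ α) x0 ≤ q μ (GG α K m x0 (x0 + (((m/2 : ℕ):ℤ) * σ) • ev i) (c * (m:ℝ)^2)) x0 := by
  obtain ⟨c, K, m0, hc, hK, hl⟩ := large hd
  obtain ⟨c', hc', hs⟩ := small hd m0
  refine ⟨min c c', K, lt_min hc hc', hK, fun m hm => ?_⟩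
  rcases le_total m0 m with h | h
  · refine ⟨K, hK, le_rfl, fun μ hμ i σ n hσ α hα x0 hx0 => ?_⟩
    have hP := PP_nonneg (fun x => vv_nonneg (μ := μ) α x) x0
    refine le_trans ?_ ((hl m h μ hμ i σ n hσ α hα x0 hx0).trans (q_mono hμ (GG_mono ?_) x0))
    · gcongr; exact min_le_left _ _
    · gcongr; exact min_le_left _ _
  · refine ⟨1, le_rfl, hK, fun μ hμ i σ n hσ α hα x0 hx0 => ?_⟩
    have hP := PP_nonneg (fun x => vv_nonneg (μ := μ) α x) x0
    refine le_trans ?_ ((hs m hm h μ hμ i σ n hσ α hα x0 hx0).trans (q_mono hμ (GG_mono ?_) x0))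
    · gcongr; exact min_le_right _ _
    · gcongr; exact min_le_right _ _

def live (D : Set (V d)) (ω : ℕ → V d) (t : ℕ) : Prop := ∀ l ≤ t, ω l ∈ D

lemma stopAt_eq {D : Set (V d)} {ω : ℕ → V d} {j : ℕ} (h : ∀ l < j, ω l ∈ D) : stopAt D ω j = ω j := by
  unfold stopAt
  rw [if_pos]
  unfold exitTimeE
  split_ifs with h1
  · have : j ≤ Nat.find h1 := by
      rw [Nat.le_find_iff]; intro l hl; simpa using h l hl
    exact_mod_cast this
  · exact le_top

lemma stopAt_live {D : Set (V d)} {ω : ℕ → V d} {j : ℕ} (h : live D ω j) : stopAt D ω j = ω j :=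
  stopAt_eq fun l hl => h l hl.le

lemma stopAt_not {D : Set (V d)} {ω : ℕ → V d} {j : ℕ} (h : ¬ live D ω j) :
    ∃ j' ≤ j, stopAt D ω j = ω j' ∧ ω j' ∉ D ∧ ∀ l < j', ω l ∈ D := by
  unfold live at h
  push Not at h
  obtain ⟨l, hl, hlD⟩ := h
  have hex : ∃ j, ω j ∉ D := ⟨l, hlD⟩
  have hfl : Nat.find hex ≤ l := Nat.find_min' hex hlD
  have he : exitTimeE D ω = (Nat.find hex : ENat) := by unfold exitTimeE; rw [dif_pos hex]
  refine ⟨Nat.find hex, by omega, ?_, Nat.find_spec hex, fun l' hl' => by simpa using Nat.find_min hex hl'⟩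
  unfold stopAt exitTime
  rw [he]
  split_ifs with h1
  · have : j ≤ Nat.find hex := by exact_mod_cast h1
    congr 1; omega
  · rfl

lemma stopAt_mem {D : Set (V d)} {ω : ℕ → V d} {j : ℕ} (h : stopAt D ω j ∈ D) : live D ω j := by
  by_contra h1
  obtain ⟨j', _, h2, h3, _⟩ := stopAt_not h1
  rw [h2] at h; exact h3 h

lemma lastVisit_eq {W : ℕ → V d} {t t' : ℕ} (h1 : t ≤ t') (h2 : W t' = W t) (h3 : ∀ j, t' < j → W j ≠ W t) :
    lastVisit W t = t' := by
  have : IsGreatest {j | t ≤ j ∧ W j = W t} t' := by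
    refine ⟨⟨h1, h2⟩, ?_⟩
    rintro j ⟨_, h5⟩
    by_contra h6
    exact h3 j (by omega) h5
  exact this.csSup_eq

section walk
variable {D : Set (V d)} {ω : ℕ → V d}

lemma last_gen (htr : ∀ x, ∃ k, ∀ j, k ≤ j → ω j ≠ x) {t : ℕ} (ht : live D ω t) :
    t ≤ lastVisit (stopAt D ω) t ∧ stopAt D ω (lastVisit (stopAt D ω) t) = stopAt D ω t ∧
    live D ω (lastVisit (stopAt D ω) t) ∧ ∀ j, lastVisit (stopAt D ω) t < j → stopAt D ω j ≠ stopAt D ω t := by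
  obtain ⟨B, hB⟩ := htr (ω t)
  have hlv : ∀ j, stopAt D ω j = stopAt D ω t → live D ω j := by
    intro j h
    apply stopAt_mem
    rw [h, stopAt_live ht]; exact ht t le_rfl
  have hbd : BddAbove {j | t ≤ j ∧ stopAt D ω j = stopAt D ω t} := by
    refine ⟨B, ?_⟩
    rintro j ⟨_, h⟩
    by_contra h1
    have h2 := hlv j h
    rw [stopAt_live h2, stopAt_live ht] at h
    exact hB j (by omega) h
  have hmem := Nat.sSup_mem (s := {j | t ≤ j ∧ stopAt D ω j = stopAt D ω t}) ⟨t, le_rfl, rfl⟩ hbd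
  refine ⟨hmem.1, hmem.2, hlv _ hmem.2, ?_⟩
  intro j hj h
  have hle : t ≤ j := hmem.1.trans hj.le
  have := le_csSup hbd (show j ∈ {j | t ≤ j ∧ stopAt D ω j = stopAt D ω t} from ⟨hle, h⟩)
  exact absurd this (not_le.2 hj)

def Gd (D : Set (V d)) (ω : ℕ → V d) (k : ℕ) : Prop := ∀ i < k, live D ω (leTime (stopAt D ω) i + 1)

lemma Gd_facts (htr : ∀ x, ∃ k, ∀ j, k ≤ j → ω j ≠ x) (h0 : ω 0 ∈ D) {k : ℕ} (h : Gd D ω k) :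
    live D ω (leTime (stopAt D ω) k) ∧ lerw D ω k = ω (leTime (stopAt D ω) k) ∧
    ∀ j, leTime (stopAt D ω) k < j → stopAt D ω j ≠ lerw D ω k := by
  have hl0 : live D ω 0 := by intro l hl; rw [Nat.le_zero.1 hl]; exact h0
  have key : live D ω (leTime (stopAt D ω) k) ∧ ∀ j, leTime (stopAt D ω) k < j → stopAt D ω j ≠ lerw D ω k := by
    cases k with
    | zero =>
      obtain ⟨_, h2, h3, h4⟩ := last_gen htr hl0
      exact ⟨h3, fun j hj => by
        show _ ≠ stopAt D ω (lastVisit _ 0)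
        rw [h2]; exact h4 j hj⟩
    | succ k =>
      obtain ⟨_, h2, h3, h4⟩ := last_gen htr (h k (by omega))
      exact ⟨h3, fun j hj => by
        show _ ≠ stopAt D ω (lastVisit _ _)
        rw [h2]; exact h4 j hj⟩
  exact ⟨key.1, stopAt_live key.1, key.2⟩

lemma Gd_step (htr : ∀ x, ∃ k, ∀ j, k ≤ j → ω j ≠ x) {k : ℕ}
    (h : live D ω (leTime (stopAt D ω) k + 1)) : leTime (stopAt D ω) k < leTime (stopAt D ω) (k + 1) ∧
    lerw D ω (k + 1) = ω (leTime (stopAt D ω) k + 1) := by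
  obtain ⟨h1, h2, h3, h4⟩ := last_gen htr h
  refine ⟨h1, ?_⟩
  show stopAt D ω (lastVisit _ _) = _
  rw [h2, stopAt_live h]

lemma Gd_mono {k k' : ℕ} (h : k' ≤ k) (hk : Gd D ω k) : Gd D ω k' := fun i hi => hk i (by omega)

lemma Gd_adj (htr : ∀ x, ∃ k, ∀ j, k ≤ j → ω j ≠ x) (hnn : ∀ i, adj (ω i) (ω (i+1))) (h0 : ω 0 ∈ D) {k : ℕ} (h : Gd D ω (k + 1)) :
    adj (lerw D ω k) (lerw D ω (k + 1)) := by
  rw [(Gd_step htr (h k (by omega))).2, (Gd_facts htr h0 (Gd_mono (by omega) h : Gd D ω k)).2.1]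
  exact hnn _

lemma Gd_lt (htr : ∀ x, ∃ k, ∀ j, k ≤ j → ω j ≠ x) {k : ℕ} (h : Gd D ω k) {i j : ℕ} (hij : i < j) (hj : j ≤ k) :
    leTime (stopAt D ω) i < leTime (stopAt D ω) j := by
  induction j, hij using Nat.le_induction with
  | base => exact (Gd_step htr (h i (by omega))).1
  | succ j hij ih => exact (ih (by omega)).trans (Gd_step htr (h j (by omega))).1

lemma cube_finite (x : V d) (r : ℕ) : (cube x r).Finite := by
  apply (Set.finite_Icc (fun i => x i - (r:ℤ)) (fun i => x i + (r:ℤ))).subset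
  intro y hy
  constructor
  · intro i; have := abs_le.1 (hy i); show x i - (r:ℤ) ≤ y i; omega
  · intro i; have := abs_le.1 (hy i); show y i ≤ x i + (r:ℤ); omega

lemma le_far (htr : ∀ x, ∃ k, ∀ j, k ≤ j → ω j ≠ x) (hnn : ∀ i, adj (ω i) (ω (i+1))) (h0 : ω 0 ∈ D) {r : ℕ}
    (hD : cube 0 (r + 1) ⊆ D) : ∃ k, Gd D ω k ∧ lerw D ω k ∉ cube 0 r := by
  by_cases h : ∀ i, live D ω (leTime (stopAt D ω) i + 1)
  · have hG : ∀ k, Gd D ω k := fun k i _ => h i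
    have hge : ∀ k, k ≤ leTime (stopAt D ω) k := by
      intro k
      induction k with
      | zero => exact Nat.zero_le _
      | succ k ih => have := (Gd_step htr (h k)).1; omega
    choose f hf using htr
    have hfin := cube_finite (0 : V d) r
    obtain ⟨B, hB⟩ := (hfin.image f).bddAbove
    refine ⟨B, hG B, fun hmem => ?_⟩
    rw [(Gd_facts (fun x => ⟨f x, hf x⟩) h0 (hG B)).2.1] at hmem
    exact hf _ _ ((hB (Set.mem_image_of_mem f hmem)).trans (hge B)) rfl
  · push Not at h
    have hG : Gd D ω (Nat.find h) := fun i hi => by simpa using Nat.find_min h hi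
    refine ⟨Nat.find h, hG, fun hmem => ?_⟩
    obtain ⟨h1, h2, h3⟩ := Gd_facts htr h0 hG
    apply Nat.find_spec h
    intro l hl
    rcases Nat.lt_or_ge l (leTime (stopAt D ω) (Nat.find h) + 1) with h4 | h4
    · exact h1 l (by omega)
    · have : l = leTime (stopAt D ω) (Nat.find h) + 1 := by omega
      rw [this]
      apply hD
      intro i
      rw [h2] at hmem
      have h5 := adj_coord (hnn (leTime (stopAt D ω) (Nat.find h))) i
      have h6 := hmem i
      simp only [Pi.zero_apply, sub_zero] at h6 ⊢
      rw [abs_le] at *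
      push_cast; omega

end walk

lemma ivt {γ : ℕ → V d} {y : V d} {M p r : ℕ} (hpr : p ≤ r) (hadj : ∀ i, p ≤ i → i < r → adj (γ i) (γ (i+1)))
    (hp : γ p ∈ cube y M) (hr : γ r ∉ cube y M) :
    ∃ j, p ≤ j ∧ j < r ∧ γ j ∈ innerBdry (cube y M) ∧ ∀ i, p ≤ i → i ≤ j → γ i ∈ cube y M := by
  have hex : ∃ j, p ≤ j ∧ γ j ∉ cube y M := ⟨r, hpr, hr⟩
  have h1 := Nat.find_spec hex
  have h2 : Nat.find hex ≤ r := Nat.find_min' hex ⟨hpr, hr⟩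
  obtain ⟨F, hF⟩ : ∃ F, F = Nat.find hex := ⟨_, rfl⟩
  have h3 : ∀ i, p ≤ i → i < F → γ i ∈ cube y M := by
    intro i hi hi2
    rw [hF] at hi2
    have := Nat.find_min hex hi2
    push Not at this
    exact this hi
  rw [← hF] at h1 h2
  have hpF : p ≠ F := by rintro rfl; exact h1.2 hp
  have hF1 : F - 1 + 1 = F := by omega
  refine ⟨F - 1, by omega, by omega, ⟨h3 _ (by omega) (by omega), γ F, ?_, h1.2⟩, fun i a b => h3 i a (by omega)⟩
  have := hadj (F - 1) (by omega) (by omega)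
  rwa [hF1] at this

lemma inner_not {y x : V d} {M : ℕ} (hM : 1 ≤ M) (h : x ∈ cube y (M - 1)) : x ∉ innerBdry (cube y M) := by
  rintro ⟨_, z, hz, hz2⟩
  apply hz2
  intro i
  have h1 := adj_coord hz i
  have h2 := h i
  rw [Nat.cast_sub hM] at h2
  rw [abs_le] at *
  push_cast at h2
  omega

lemma hitIdx_eq {A : Set (V d)} {γ : ℕ → V d} {k : ℕ} (h : γ k ∈ A) (h' : ∀ i < k, γ i ∉ A) : hitIdx A γ = k := by
  have hex : ∃ j, γ j ∈ A := ⟨k, h⟩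
  have : Nat.find hex = k := by
    rw [Nat.find_eq_iff]; exact ⟨h, h'⟩
  unfold hitIdx hitTimeE
  rw [dif_pos hex, this]; rfl

lemma inner_coord {x : V d} {n : ℕ} (h : x ∈ innerBdry (cube 0 n)) : ∃ i, |x i| = (n:ℤ) := by
  by_contra hc
  push Not at hc
  have hn : 1 ≤ n := by
    by_contra h0
    have h0 : n = 0 := by omega
    subst h0
    obtain ⟨hx, y, hy, hy2⟩ := h
    have hsum : ∑ i, |x i - y i| = 1 := hy
    have : Nonempty (Fin d) := by
      by_contra he
      rw [not_nonempty_iff] at he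
      simp at hsum
    obtain ⟨i⟩ := this
    have := hx i
    have h2 := hc i
    simp at this h2
    exact h2 this
  refine inner_not hn ?_ h
  intro i
  have h1 := h.1 i
  have h2 := hc i
  rw [Nat.cast_sub hn]
  simp only [Pi.zero_apply, sub_zero] at h1 ⊢
  push_cast; omega

def Gam (D : Set (V d)) (b : ℕ → V d) (k s : ℕ) : Set (ℕ → V d) :=
  {ω | ω 0 = b 0 ∧ live D ω s ∧ ∃ f : ℕ → ℕ, f k = s ∧
    (∀ i ≤ k, f i ≤ s ∧ ω (f i) = b i ∧ ∀ j, f i < j → j ≤ s → ω j ≠ b i) ∧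
    ∀ i < k, f i < f (i + 1) ∧ ω (f i + 1) = b (i + 1)}

lemma Gam_dep (D : Set (V d)) (b : ℕ → V d) (k s : ℕ) : Dep s (Gam D b k s) := by
  rintro ω ω' e ⟨h0, h1, f, h2, h3, h4⟩
  refine ⟨by rw [← e 0 (Nat.zero_le _)]; exact h0, fun l hl => by rw [← e l hl]; exact h1 l hl, f, h2, fun i hi => ?_, fun i hi => ?_⟩
  · obtain ⟨a1, a2, a3⟩ := h3 i hi
    exact ⟨a1, by rw [← e _ a1]; exact a2, fun j hj hj2 => by rw [← e j hj2]; exact a3 j hj hj2⟩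
  · obtain ⟨a1, a2⟩ := h4 i hi
    refine ⟨a1, ?_⟩
    have := (h3 (i + 1) (by omega)).1
    rw [← e _ (by omega)]; exact a2

lemma Gam_end {D : Set (V d)} {b : ℕ → V d} {k s : ℕ} {ω : ℕ → V d} (h : ω ∈ Gam D b k s) : ω s = b k := by
  obtain ⟨_, _, f, h2, h3, _⟩ := h
  rw [← h2]; exact (h3 k le_rfl).2.1

def rng (b : ℕ → V d) (k : ℕ) : Set (V d) := {x | ∃ i ≤ k, x = b i}

section walk
variable {D : Set (V d)} {ω : ℕ → V d}

lemma alpha_up (hw0 : ω 0 = 0) (htr : ∀ x, ∃ k, ∀ j, k ≤ j → ω j ≠ x) (hnn : ∀ i, adj (ω i) (ω (i+1))) {n N k : ℕ}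
    (hD : cube 0 (4 * N) ⊆ D) (hnN : n < N) (hk : hitIdx (innerBdry (cube 0 n)) (lerw D ω) = k) :
    (∀ i ≤ k, lerw D ω i ∈ cube 0 n) ∧ lerw D ω k ∈ innerBdry (cube 0 n) ∧
    (∀ i < k, lerw D ω i ∉ innerBdry (cube 0 n)) ∧
    ω ∈ Gam D (lerw D ω) k (leTime (stopAt D ω) k) ∧
    ∀ j, 1 ≤ j → (∀ l < j, ω (leTime (stopAt D ω) k + l) ∈ cube 0 (3*n)) → ω (leTime (stopAt D ω) k + j) ∉ rng (lerw D ω) k := by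
  have h0 : ω 0 ∈ D := hD (by rw [hw0]; intro i; simp)
  have hl0 : live D ω 0 := by intro l hl; rw [Nat.le_zero.1 hl]; exact h0
  have hL0 : lerw D ω 0 = 0 := by
    show stopAt D ω (lastVisit (stopAt D ω) 0) = 0
    rw [(last_gen htr hl0).2.1, stopAt_live hl0, hw0]
  obtain ⟨K, hG, hKf⟩ := le_far (r := 4 * N - 1) htr hnn h0 (by rw [show 4 * N - 1 + 1 = 4 * N by omega]; exact hD)
  obtain ⟨j, -, hjK, hj, hjc⟩ := ivt (γ := lerw D ω) (y := 0) (M := n) (Nat.zero_le K)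
    (fun i _ hi => Gd_adj htr hnn h0 (Gd_mono (by omega) hG)) (by rw [hL0]; intro i; simp)
    (fun h => hKf (fun i => (h i).trans (by exact_mod_cast (by omega : n ≤ 4 * N - 1))))
  have hex : ∃ j, lerw D ω j ∈ innerBdry (cube 0 n) := ⟨j, hj⟩
  have hfk : Nat.find hex = k := by
    rw [← hk]; exact (hitIdx_eq (Nat.find_spec hex) (fun i hi => Nat.find_min hex hi)).symm
  have hkj : k ≤ j := by rw [← hfk]; exact Nat.find_min' hex hj
  have hk1 : lerw D ω k ∈ innerBdry (cube 0 n) := by rw [← hfk]; exact Nat.find_spec hex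
  have hk2 : ∀ i < k, lerw D ω i ∉ innerBdry (cube 0 n) := by rw [← hfk]; exact fun i hi => Nat.find_min hex hi
  have hGk : ∀ i ≤ k, Gd D ω i := fun i hi => Gd_mono (by omega) hG
  have hle : ∀ i ≤ k, leTime (stopAt D ω) i ≤ leTime (stopAt D ω) k := by
    intro i hi
    rcases hi.eq_or_lt with rfl | h
    · exact le_rfl
    · exact (Gd_lt htr (hGk k le_rfl) h le_rfl).le
  have hlk := (Gd_facts htr h0 (hGk k le_rfl)).1
  refine ⟨fun i hi => hjc i (Nat.zero_le _) (by omega), hk1, hk2, ⟨by rw [hL0, hw0], hlk, leTime (stopAt D ω), rfl, ?_, ?_⟩, ?_⟩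
  · intro i hi
    obtain ⟨h1, h2, h3⟩ := Gd_facts htr h0 (hGk i hi)
    refine ⟨hle i hi, h2.symm, fun j hj hj2 => ?_⟩
    rw [← stopAt_live (D := D) (ω := ω) (j := j) (fun l hl => hlk l (by omega))]
    exact h3 j hj
  · intro i hi
    obtain ⟨h1, h2⟩ := Gd_step htr (hGk k le_rfl i hi)
    exact ⟨h1, h2.symm⟩
  · rintro j hj hc ⟨i, hi, e⟩
    obtain ⟨h1, h2, h3⟩ := Gd_facts htr h0 (hGk i hi)
    refine h3 (leTime (stopAt D ω) k + j) (by have := hle i hi; omega) ?_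
    rw [← e]
    apply stopAt_eq
    intro l hl
    rcases Nat.lt_or_ge l (leTime (stopAt D ω) k) with h | h
    · exact hlk l h.le
    · have h4 := hc (l - leTime (stopAt D ω) k) (by omega)
      rw [show leTime (stopAt D ω) k + (l - leTime (stopAt D ω) k) = l by omega] at h4
      exact hD (fun i => (h4 i).trans (by exact_mod_cast (by omega : 3 * n ≤ 4 * N)))

lemma alpha_down {b : ℕ → V d} {n k s : ℕ} (hb1 : b k ∈ innerBdry (cube 0 n)) (hb2 : ∀ i < k, b i ∉ innerBdry (cube 0 n))
    (h : ω ∈ Gam D b k s) (hav : ∀ j, s < j → ω j ∉ rng b k) :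
    leTime (stopAt D ω) k = s ∧ (∀ i ≤ k, lerw D ω i = b i) ∧ hitIdx (innerBdry (cube 0 n)) (lerw D ω) = k ∧ Gd D ω k := by
  obtain ⟨h0, hl, f, h2, h3, h4⟩ := h
  have hst : ∀ j ≤ s, stopAt D ω j = ω j := fun j hj => stopAt_live fun l hl' => hl l (by omega)
  have hav' : ∀ i ≤ k, ∀ j, f i < j → stopAt D ω j ≠ b i := by
    intro i hi j hj e
    rcases le_or_gt j s with h5 | h5
    · rw [hst j h5] at e
      exact (h3 i hi).2.2 j hj h5 e
    · by_cases h6 : live D ω j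
      · rw [stopAt_live h6] at e
        exact hav j h5 ⟨i, hi, e⟩
      · obtain ⟨j', _, e', h7, _⟩ := stopAt_not h6
        rw [e'] at e
        refine hav j' ?_ ⟨i, hi, e⟩
        by_contra h8
        exact h7 (hl j' (by omega))
  have hT : ∀ i ≤ k, leTime (stopAt D ω) i = f i := by
    intro i
    induction i with
    | zero =>
      intro hi
      apply lastVisit_eq (Nat.zero_le _)
      · rw [hst 0 (Nat.zero_le _), hst _ (h3 0 hi).1, (h3 0 hi).2.1, h0]
      · intro j hj
        rw [hst 0 (Nat.zero_le _), h0]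
        exact hav' 0 hi j hj
    | succ i ih =>
      intro hi
      have e := ih (by omega)
      obtain ⟨a1, a2⟩ := h4 i (by omega)
      have a3 := (h3 (i + 1) hi).1
      show lastVisit _ (leTime (stopAt D ω) i + 1) = _
      rw [e]
      apply lastVisit_eq a1
      · rw [hst _ a3, hst _ (by omega), a2, (h3 (i+1) hi).2.1]
      · intro j hj
        rw [hst _ (by omega : f i + 1 ≤ s), a2]
        exact hav' (i+1) hi j hj
  have hL : ∀ i ≤ k, lerw D ω i = b i := by
    intro i hi
    show stopAt D ω (leTime (stopAt D ω) i) = b i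
    rw [hT i hi, hst _ (h3 i hi).1]; exact (h3 i hi).2.1
  refine ⟨by rw [hT k le_rfl, h2], hL, hitIdx_eq (by rw [hL k le_rfl]; exact hb1) (fun i hi => by rw [hL i hi.le]; exact hb2 i hi), ?_⟩
  intro i hi
  rw [hT i hi.le]
  have a1 := (h4 i hi).1
  have a3 := (h3 (i + 1) hi).1
  exact fun l hl' => hl l (by omega)

lemma hitCount_range (A : Set (V d)) (g : ℕ → V d) (M : ℕ) :
    hitCount A ((List.range M).map g) = ((Finset.range M).filter fun i => g i ∈ A).card := by
  unfold hitCount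
  rw [List.map_map, Finset.card_filter]
  induction M with
  | zero => simp
  | succ M ih => rw [List.range_succ, List.map_append, List.sum_append, ih, Finset.sum_range_succ]; simp

lemma hitIdxFrom_ge {A : Set (V d)} {γ : ℕ → V d} {t p : ℕ} (hex : ∃ j, t ≤ j ∧ γ j ∈ A) (h : ∀ j, t ≤ j → j ≤ p → γ j ∉ A) :
    p ≤ hitIdxFrom A t γ := by
  unfold hitIdxFrom
  rw [dif_pos hex]
  obtain ⟨h1, h2⟩ := Nat.find_spec hex
  by_contra h3
  exact h _ h1 (by omega) h2

lemma beta_count (hw0 : ω 0 = 0) (htr : ∀ x, ∃ k, ∀ j, k ≤ j → ω j ≠ x) (hnn : ∀ i, adj (ω i) (ω (i+1))) {n N m K k s : ℕ}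
    (hD : cube 0 (4 * N) ⊆ D) (hm : 1 ≤ m) (hK : 1 ≤ K) (hnN : n + m ≤ N) {x0 x1 : V d} (hx0 : x0 ∈ cube 0 n)
    (hk : hitIdx (innerBdry (cube 0 n)) (lerw D ω) = k) (hGk : Gd D ω k) (hs : leTime (stopAt D ω) k = s)
    (hLk : lerw D ω k = x0) (hLc : ∀ i ≤ k, lerw D ω i ∈ cube 0 n) {I : Finset ℕ} (hI : ∀ i ∈ I, CI K m x0 x1 (sh s ω) i) :
    I.card ≤ K * hitCount (cube x1 (m / 4)) (betaList D n m ω) := by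
  have h0 : ω 0 ∈ D := hD (by rw [hw0]; intro i; simp)
  obtain ⟨k', hG, hKf⟩ := le_far (r := 4 * N - 1) htr hnn h0 (by rw [show 4 * N - 1 + 1 = 4 * N by omega]; exact hD)
  have hsub : ∀ M r : ℕ, n + M ≤ r → cube x0 M ⊆ cube (0 : V d) r := by
    intro M r hM y hy i
    have h1 := hy i
    have h2 := hx0 i
    simp only [Pi.zero_apply, sub_zero] at h2 ⊢
    rw [abs_le] at *
    constructor <;> omega
  have hkk' : k < k' := by
    by_contra h
    exact hKf (fun i => (hLc k' (by omega) i).trans (by exact_mod_cast (by omega : n ≤ 4 * N - 1)))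
  have hlt : ∀ i j, i < j → j ≤ k' → leTime (stopAt D ω) i < leTime (stopAt D ω) j := fun i j => Gd_lt htr hG
  have hLk' : lerw D ω k' = ω (leTime (stopAt D ω) k') := (Gd_facts htr h0 hG).2.1
  have hkk := hlt k k' hkk' le_rfl
  rw [hs] at hkk
  obtain ⟨k2, hk2⟩ : ∃ k2, k2 = hitIdxFrom (innerBdry (cube x0 m)) k (lerw D ω) := ⟨_, rfl⟩
  have hex : ∃ j, k ≤ j ∧ lerw D ω j ∈ innerBdry (cube x0 m) := by
    obtain ⟨j, hj1, _, hj2, _⟩ := ivt (γ := lerw D ω) (y := x0) (M := m) hkk'.le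
      (fun i _ hi => Gd_adj htr hnn h0 (Gd_mono (by omega) hG)) (by rw [hLk]; intro i; simp)
      (fun h => hKf (hsub m _ (by omega) h))
    exact ⟨j, hj1, hj2⟩
  have main : ∀ i ∈ I, ∃ p, k ≤ p ∧ p ≤ k2 ∧ s + i ≤ leTime (stopAt D ω) p ∧ leTime (stopAt D ω) p < s + i + K ∧ lerw D ω p ∈ cube x1 (m / 4) := by
    intro i hi
    obtain ⟨c1, c2, c3⟩ := hI i hi
    have hk's : s + i + K ≤ leTime (stopAt D ω) k' := by
      by_contra h
      apply hKf
      have := c1 (leTime (stopAt D ω) k' - s) (by omega)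
      unfold sh at this
      rw [show s + (leTime (stopAt D ω) k' - s) = leTime (stopAt D ω) k' by omega] at this
      rw [hLk']
      exact hsub (m - 1) _ (by omega) this
    have hpe : ∃ p, k ≤ p ∧ s + i ≤ leTime (stopAt D ω) p := ⟨k', hkk'.le, by omega⟩
    obtain ⟨p, hp⟩ : ∃ p, p = Nat.find hpe := ⟨_, rfl⟩
    obtain ⟨hp1, hp2⟩ : k ≤ p ∧ s + i ≤ leTime (stopAt D ω) p := by rw [hp]; exact Nat.find_spec hpe
    have hpk' : p ≤ k' := by rw [hp]; exact Nat.find_min' hpe ⟨hkk'.le, by omega⟩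
    have hpm : ∀ j, k ≤ j → j < p → leTime (stopAt D ω) j < s + i := by
      intro j hj hj2
      rw [hp] at hj2
      have := Nat.find_min hpe hj2
      push Not at this
      exact this hj
    have hp3 : leTime (stopAt D ω) p < s + i + K := by
      rcases hp1.eq_or_lt with e | h
      · rw [← e, hs]; omega
      · have h1 := hpm (p - 1) (by omega) (by omega)
        have h1' : s ≤ leTime (stopAt D ω) (p - 1) := by
          rcases (show k ≤ p - 1 by omega).eq_or_lt with e | h
          · rw [← e, hs]
          · rw [← hs]; exact (hlt _ _ h (by omega)).le
        have h2 := (Gd_step htr (hG (p - 1) (by omega))).2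
        rw [show p - 1 + 1 = p by omega, (Gd_facts htr h0 (Gd_mono hpk' hG)).2.1] at h2
        by_contra h3
        have h4 := c3 (leTime (stopAt D ω) (p - 1) + 1 - s) (by omega) (leTime (stopAt D ω) p - s) (by omega)
        apply h4
        unfold sh
        rw [show s + (leTime (stopAt D ω) (p - 1) + 1 - s) = leTime (stopAt D ω) (p - 1) + 1 by omega,
          show s + (leTime (stopAt D ω) p - s) = leTime (stopAt D ω) p by omega, h2]
    have hL : ∀ j, k ≤ j → j ≤ p → s ≤ leTime (stopAt D ω) j ∧ leTime (stopAt D ω) j < s + i + K ∧ lerw D ω j = sh s ω (leTime (stopAt D ω) j - s) := by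
      intro j hj1 hj2
      have a1 : s ≤ leTime (stopAt D ω) j := by
        rcases hj1.eq_or_lt with e | h
        · rw [← e, hs]
        · rw [← hs]; exact (hlt _ _ h (by omega)).le
      refine ⟨a1, ?_, ?_⟩
      · rcases hj2.eq_or_lt with e | h
        · rw [e]; exact hp3
        · have := hpm j hj1 h; omega
      · unfold sh
        rw [show s + (leTime (stopAt D ω) j - s) = leTime (stopAt D ω) j by omega]
        exact (Gd_facts htr h0 (Gd_mono (by omega) hG)).2.1
    refine ⟨p, hp1, ?_, hp2, hp3, ?_⟩
    · rw [hk2]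
      apply hitIdxFrom_ge hex
      intro j hj1 hj2
      obtain ⟨a1, a2, a3⟩ := hL j hj1 hj2
      rw [a3]
      exact inner_not hm (c1 _ (by omega))
    · obtain ⟨a1, a2, a3⟩ := hL p hp1 le_rfl
      rw [a3]
      exact c2 _ (by omega) (by omega)
  choose! P hP using main
  have hcount : hitCount (cube x1 (m / 4)) (betaList D n m ω) =
      ((Finset.range (k2 - k + 1)).filter fun i => lerw D ω (k + i) ∈ cube x1 (m / 4)).card := by
    rw [← hitCount_range]
    unfold betaList
    simp only [hk, hLk, ← hk2]
  rw [hcount]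
  have hmaps : ∀ i ∈ I, P i - k ∈ (Finset.range (k2 - k + 1)).filter fun i => lerw D ω (k + i) ∈ cube x1 (m / 4) := by
    intro i hi
    obtain ⟨a1, a2, a3, a4, a5⟩ := hP i hi
    rw [Finset.mem_filter, Finset.mem_range, show k + (P i - k) = P i by omega]
    exact ⟨by omega, a5⟩
  apply Finset.card_le_mul_card_image_of_maps_to hmaps
  intro r _
  have hsubset : (I.filter fun i => P i - k = r) ⊆ Finset.Ico (leTime (stopAt D ω) (k + r) - s + 1 - K) (leTime (stopAt D ω) (k + r) - s + 1) := by
    intro i hi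
    rw [Finset.mem_filter] at hi
    obtain ⟨a1, a2, a3, a4, a5⟩ := hP i hi.1
    have : P i = k + r := by omega
    rw [this] at a3 a4
    rw [Finset.mem_Ico]; omega
  refine (Finset.card_le_card hsubset).trans ?_
  rw [Nat.card_Ico]; omega

end walk

lemma Gam_congr {D : Set (V d)} {b b' : ℕ → V d} {k s : ℕ} (e : ∀ i ≤ k, b i = b' i) : Gam D b k s ⊆ Gam D b' k s := by
  rintro ω ⟨h0, h1, f, h2, h3, h4⟩
  refine ⟨by rw [← e 0 (Nat.zero_le _)]; exact h0, h1, f, h2, fun i hi => ?_, fun i hi => ?_⟩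
  · rw [← e i hi]; exact h3 i hi
  · rw [← e (i+1) hi]; exact h4 i hi

lemma rng_congr {b b' : ℕ → V d} {k : ℕ} (e : ∀ i ≤ k, b i = b' i) : rng b k = rng b' k := by
  ext x
  constructor
  · rintro ⟨i, hi, h⟩; exact ⟨i, hi, by rw [← e i hi]; exact h⟩
  · rintro ⟨i, hi, h⟩; exact ⟨i, hi, by rw [e i hi]; exact h⟩

lemma list_eq {f g : ℕ → V d} {k l : ℕ} : (List.range (k + 1)).map f = (List.range (l + 1)).map g ↔ k = l ∧ ∀ i ≤ k, f i = g i := by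
  constructor
  · intro h
    have h1 := congrArg List.length h
    simp at h1
    subst h1
    refine ⟨rfl, fun i hi => ?_⟩
    exact List.map_inj_left.1 h i (by simp; omega)
  · rintro ⟨rfl, h⟩
    exact List.map_inj_left.2 fun i hi => h i (by simp at hi; omega)

lemma endPt_range (f : ℕ → V d) (k : ℕ) : endPt ((List.range (k + 1)).map f) = f k := by
  unfold endPt
  rw [List.range_succ]; simp

lemma face (x0 : V d) (n : ℕ) (h : ∃ i, |x0 i| = (n:ℤ)) : ∃ (i : Fin d) (σ : ℤ), (σ = 1 ∨ σ = -1) ∧ ell i σ n x0 = 0 ∧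
    faceDir x0 n = σ • ev i := by
  refine ⟨Classical.choose h, if 0 ≤ x0 (Classical.choose h) then 1 else -1, ?_, ?_, ?_⟩
  · split_ifs <;> simp
  · have := Classical.choose_spec h
    unfold ell
    split_ifs with h1
    · rw [abs_of_nonneg h1] at this; omega
    · rw [abs_of_neg (by omega)] at this; omega
  · unfold faceDir
    rw [dif_pos h]
    ext j
    by_cases hj : j = Classical.choose h
    · simp [hj, ev]
    · simp [hj, ev]

lemma GG_meas (α : Set (V d)) (K m : ℕ) (x0 x1 : V d) (a : ℝ) : MeasurableSet (GG α K m x0 x1 a) := by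
  have hpos : MeasurableSet {ω : ℕ → V d | ∀ j, 1 ≤ j → ω j ∉ α} := by
    have : {ω : ℕ → V d | ∀ j, 1 ≤ j → ω j ∉ α} = sh 1 ⁻¹' Fav α := by
      ext ω
      constructor
      · intro h j; exact h (1 + j) (by omega)
      · intro h j hj
        have := h (j - 1)
        unfold sh at this
        rwa [show 1 + (j - 1) = j by omega] at this
    rw [this]; exact sh_meas 1 (Fav_meas α)
  have hCI : ∀ i, MeasurableSet {ω : ℕ → V d | CI K m x0 x1 ω i} := by
    intro i
    have e : {ω : ℕ → V d | CI K m x0 x1 ω i} = (⋂ l, {ω | l < i + K → ω l ∈ cube x0 (m - 1)}) ∩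
        ((⋂ l, {ω | i ≤ l → l < i + K → ω l ∈ cube x1 (m / 4)}) ∩ noret K i) := by
      ext ω; simp [CI]
    rw [e]
    refine (MeasurableSet.iInter fun l => ?_).inter ((MeasurableSet.iInter fun l => ?_).inter (noret_meas _ _))
    · by_cases h : l < i + K
      · simpa [h] using meas_at l (cube x0 (m - 1))
      · simp [h]
    · by_cases h : l < i + K
      · by_cases h' : i ≤ l
        · simpa [h, h'] using meas_at l (cube x1 (m / 4))
        · simp [h']
      · simp [h]
  have e : GG α K m x0 x1 a = {ω | ∀ j, 1 ≤ j → ω j ∉ α} ∩ ⋃ I : Finset ℕ, ⋃ (_ : a ≤ I.card), ⋂ i ∈ I, {ω | CI K m x0 x1 ω i} := by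
    ext ω; simp [GG]
  rw [e]
  refine hpos.inter (MeasurableSet.iUnion fun I => MeasurableSet.iUnion fun _ => ?_)
  exact Finset.measurableSet_biInter I fun i _ => hCI i

lemma q_zero (μ : Measure (ℕ → V d)) (F : Set (ℕ → V d)) : q μ F 0 = μ.real F := by
  unfold q
  congr 1
  ext ω
  have : pth 0 ω = ω := by funext j; simp [pth]
  rw [Set.mem_preimage, this]

def Esc (n : ℕ) (α : Set (V d)) : Set (ℕ → V d) := {ω | ∀ j, 1 ≤ j → (∀ l < j, ω l ∈ cube 0 (3*n)) → ω j ∉ α}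

lemma Esc_meas (n : ℕ) (α : Set (V d)) : MeasurableSet (Esc n α) := by
  have : Esc n α = ⋂ j, {ω : ℕ → V d | 1 ≤ j → (∀ l < j, ω l ∈ cube 0 (3*n)) → ω j ∉ α} := by
    ext ω; simp [Esc]
  rw [this]
  refine MeasurableSet.iInter fun j => Dep.meas (s := j) ?_
  intro ω ω' e h hj hl
  rw [← e j le_rfl]
  exact h hj fun l hl' => by rw [e l hl'.le]; exact hl l hl'

lemma final_meas (hd : 5 ≤ d) {c C : ℝ} {n N m K K0 : ℕ} (hc : 0 < c) (hC : 0 < C)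
    (hEsc : ∀ μ : Measure (ℕ → V d), IsSRWLaw μ 0 → ∀ (n : ℕ), 16 ≤ n → ∀ α : Set (V d), α ⊆ cube 0 n →
      ∀ x0 ∈ cube (0 : V d) n, q μ (Esc n α) x0 ≤ C * PP (vv μ α) x0)
    (hK1 : 1 ≤ K) (hK0 : K ≤ K0)
    (hGG : ∀ μ : Measure (ℕ → V d), IsSRWLaw μ 0 → ∀ (i : Fin d) (σ n : ℤ), (σ = 1 ∨ σ = -1) → ∀ α : Set (V d),
      (∀ x ∈ α, ell i σ n x ≤ 0) → ∀ x0, ell i σ n x0 = 0 →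
      c * PP (vv μ α) x0 ≤ q μ (GG α K m x0 (x0 + (((m/2 : ℕ):ℤ) * σ) • ev i) (c * (m:ℝ)^2)) x0)
    (hm : 1 ≤ m) {D : Set (V d)} (hD : cube 0 (4 * N) ⊆ D) (hn : 16 ≤ n) (hnm : n + m ≤ N)
    {μ : Measure (ℕ → V d)} (hμ : IsSRWLaw μ 0) (a : List (V d)) (ha : μ { ω | alphaList D n ω = a } ≠ 0) :
    ENNReal.ofReal (c / C) * μ { ω | alphaList D n ω = a } ≤
      μ ({ω | c / K0 * (m : ℝ) ^ 2 ≤ (hitCount (boxA (endPt a) n m) (betaList D n m ω) : ℝ) } ∩ { ω | alphaList D n ω = a }) := by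
  have hprob := hμ.1
  have hae : ∀ᵐ ω ∂μ, (ω 0 = 0 ∧ ∀ i, adj (ω i) (ω (i+1))) ∧ ∀ x : V d, ∃ k, ∀ j, k ≤ j → ω j ≠ x :=
    (ae_nn hd hμ).and (ae_transient hd hμ)
  obtain ⟨ω₀, hω₀, ⟨hw0, hnn⟩, htr⟩ : ∃ ω, ω ∈ { ω | alphaList D n ω = a } ∧
      (ω 0 = 0 ∧ ∀ i, adj (ω i) (ω (i+1))) ∧ ∀ x : V d, ∃ k, ∀ j, k ≤ j → ω j ≠ x := by
    by_contra hno
    push Not at hno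
    apply ha
    refine measure_mono_null (t := {ω | ¬ ((ω 0 = 0 ∧ ∀ i, adj (ω i) (ω (i+1))) ∧ ∀ x : V d, ∃ k, ∀ j, k ≤ j → ω j ≠ x)}) ?_ hae
    intro ω hω h
    obtain ⟨x, hx⟩ := hno ω hω h.1
    obtain ⟨k, hk⟩ := h.2 x
    obtain ⟨j, hj, e⟩ := hx k
    exact hk j hj e
  obtain ⟨k, hk⟩ : ∃ k, k = hitIdx (innerBdry (cube 0 n)) (lerw D ω₀) := ⟨_, rfl⟩
  obtain ⟨b, hb⟩ : ∃ b, b = lerw D ω₀ := ⟨_, rfl⟩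
  have hab : a = (List.range (k + 1)).map b := by rw [hk, hb]; exact hω₀.symm
  obtain ⟨hb1, hb2, hb3, -, -⟩ := alpha_up hw0 htr hnn hD (by omega : n < N) hk.symm
  rw [← hb] at hb1 hb2 hb3
  have hend : endPt a = b k := by rw [hab, endPt_range]
  have hiff : ∀ ω, alphaList D n ω = a ↔ hitIdx (innerBdry (cube 0 n)) (lerw D ω) = k ∧ ∀ i ≤ k, lerw D ω i = b i := by
    intro ω
    rw [hab]
    unfold alphaList
    rw [list_eq]
    constructor
    · rintro ⟨h1, h2⟩; exact ⟨h1, fun i hi => h2 i (by omega)⟩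
    · rintro ⟨h1, h2⟩; exact ⟨h1, fun i hi => h2 i (by omega)⟩
  obtain ⟨i, σ, hσ, hell, hface⟩ := face (b k) n (inner_coord hb2)
  have hαc : rng b k ⊆ cube 0 n := by rintro x ⟨j, hj, rfl⟩; exact hb1 j hj
  have hαl : ∀ x ∈ rng b k, ell i σ n x ≤ 0 := by
    intro x hx
    have := hαc hx i
    simp only [Pi.zero_apply, sub_zero] at this
    rw [abs_le] at this
    unfold ell
    rcases hσ with rfl | rfl <;> omega
  obtain ⟨x1, hx1⟩ : ∃ x1, x1 = b k + (((m/2 : ℕ):ℤ) * σ) • ev i := ⟨_, rfl⟩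
  have hbox : boxA (endPt a) n m = cube x1 (m / 4) := by
    unfold boxA x1pt
    rw [hend, hface, hx1, smul_smul]
  obtain ⟨p, hp⟩ : ∃ p, p = PP (vv μ (rng b k)) (b k) := ⟨_, rfl⟩
  have hp0 : 0 ≤ p := by rw [hp]; exact PP_nonneg (fun x => vv_nonneg _ x) _
  have h1 := hEsc μ hμ n hn _ hαc (b k) (hb1 k le_rfl)
  have h2 := hGG μ hμ i σ n hσ _ hαl (b k) hell
  rw [← hx1] at h2
  rw [← hp] at h1 h2
  have up : ∀ s, μ (Gam D b k s ∩ sh s ⁻¹' Esc n (rng b k)) ≤ ENNReal.ofReal (C * p) * μ (Gam D b k s) := by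
    intro s
    have := q_markov_le hd hμ (Esc_meas n (rng b k)) (C * p) s _ (Gam_dep D b k s) (fun ω hω => by rw [Gam_end hω]; exact h1) 0
    rw [q_zero, q_zero] at this
    rw [← ofReal_measureReal, ← ofReal_measureReal (s := Gam D b k s), ← ENNReal.ofReal_mul (by positivity)]
    exact ENNReal.ofReal_le_ofReal this
  have lo : ∀ s, ENNReal.ofReal (c * p) * μ (Gam D b k s) ≤ μ (Gam D b k s ∩ sh s ⁻¹' GG (rng b k) K m (b k) x1 (c * (m:ℝ)^2)) := by
    intro s
    rcases hp0.eq_or_lt with h | h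
    · rw [← h]; simp
    have := q_markov_ge hd hμ (GG_meas (rng b k) K m (b k) x1 (c * (m:ℝ)^2)) (c * p) (by positivity) s _ (Gam_dep D b k s)
      (fun ω hω => by rw [Gam_end hω]; exact h2) 0
    rw [q_zero, q_zero] at this
    rw [← ofReal_measureReal, ← ofReal_measureReal (s := Gam D b k s ∩ _), ← ENNReal.ofReal_mul (by positivity)]
    exact ENNReal.ofReal_le_ofReal this
  have hE : μ { ω | alphaList D n ω = a } ≤ ENNReal.ofReal (C * p) * ∑' s, μ (Gam D b k s) := by
    rw [← ENNReal.tsum_mul_left]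
    refine le_trans ?_ ((measure_iUnion_le _).trans (ENNReal.tsum_le_tsum up))
    apply measure_mono_ae
    filter_upwards [hae] with ω hω
    intro h
    obtain ⟨e1, e2⟩ := (hiff ω).1 h
    obtain ⟨-, -, -, u4, u5⟩ := alpha_up hω.1.1 hω.2 hω.1.2 hD (by omega : n < N) e1
    refine Set.mem_iUnion.2 ⟨_, Gam_congr e2 u4, ?_⟩
    rw [rng_congr e2] at u5
    exact u5
  have hdown : ∀ ω s, ω ∈ Gam D b k s ∩ sh s ⁻¹' GG (rng b k) K m (b k) x1 (c * (m:ℝ)^2) →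
      leTime (stopAt D ω) k = s ∧ (∀ i ≤ k, lerw D ω i = b i) ∧ hitIdx (innerBdry (cube 0 n)) (lerw D ω) = k ∧ Gd D ω k := by
    rintro ω s ⟨g1, g2⟩
    apply alpha_down hb2 hb3 g1
    intro j hj
    have := g2.1 (j - s) (by omega)
    unfold sh at this
    rwa [show s + (j - s) = j by omega] at this
  have hL : ENNReal.ofReal (c * p) * ∑' s, μ (Gam D b k s) ≤
      μ ({ω | c / K0 * (m : ℝ) ^ 2 ≤ (hitCount (boxA (endPt a) n m) (betaList D n m ω) : ℝ) } ∩ { ω | alphaList D n ω = a }) := by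
    rw [← ENNReal.tsum_mul_left]
    refine (ENNReal.tsum_le_tsum lo).trans ?_
    rw [← measure_iUnion]
    · apply measure_mono_ae
      filter_upwards [hae] with ω hω
      intro h
      obtain ⟨s, hs⟩ := Set.mem_iUnion.1 h
      obtain ⟨d1, d2, d3, d4⟩ := hdown ω s hs
      refine ⟨?_, (hiff ω).2 ⟨d3, d2⟩⟩
      obtain ⟨-, I, hI1, hI2⟩ := hs.2
      have hcnt := beta_count hω.1.1 hω.2 hω.1.2 hD hm hK1 hnm (hb1 k le_rfl) d3 d4 d1 (d2 k le_rfl)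
        (fun i hi => by rw [d2 i hi]; exact hb1 i hi) hI2
      show c / K0 * (m : ℝ) ^ 2 ≤ _
      rw [hbox]
      have hK00 : (0:ℝ) < K0 := by exact_mod_cast (by omega : 0 < K0)
      rw [div_mul_eq_mul_div, div_le_iff₀ hK00]
      refine hI1.trans ?_
      have h3 : ((I.card : ℕ) : ℝ) ≤ ((K * hitCount (cube x1 (m / 4)) (betaList D n m ω) : ℕ) : ℝ) := by exact_mod_cast hcnt
      push_cast at h3
      refine h3.trans ?_
      rw [mul_comm]
      gcongr
    · intro s s' hss
      refine Set.disjoint_left.2 fun ω h3 h4 => hss ?_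
      rw [← (hdown ω s h3).1, ← (hdown ω s' h4).1]
    · intro s
      exact (Gam_dep D b k s).meas.inter (sh_meas s (GG_meas _ _ _ _ _ _))
  refine le_trans ?_ hL
  have e : c * p = c / C * (C * p) := by field_simp
  rw [e, ENNReal.ofReal_mul (by positivity), mul_assoc]
  gcongr

theorem HA_beta_lower_tail :
    ∀ d : ℕ, 5 ≤ d → ∃ c₀ : ℝ, 0 < c₀ ∧
      ∀ (N n m : ℕ) (D : Set (V d)),
        1 ≤ N → cube 0 (4 * N) ⊆ D → 16 ≤ n → n < n + m → n + m ≤ N → m ≤ n / 8 →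
        ∀ μ : Measure (ℕ → V d), IsSRWLaw μ 0 →
        ∀ a : List (V d), μ { ω | alphaList D n ω = a } ≠ 0 →
          c₀ ≤ (ProbabilityTheory.cond μ { ω | alphaList D n ω = a }
                  { ω | c₀ * (m : ℝ) ^ 2 ≤
                      (hitCount (boxA (endPt a) n m) (betaList D n m ω) : ℝ) }).toReal := by
  intro d hd
  obtain ⟨C, hC, hEsc⟩ := esc_cmp hd
  obtain ⟨c, K0, hc, hK0, hcomb⟩ := combined hd
  have hK00 : (0:ℝ) < K0 := by exact_mod_cast (by omega : 0 < K0)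
  refine ⟨min (c / K0) (c / C), lt_min (by positivity) (by positivity), ?_⟩
  intro N n m D _ hD hn hm0 hnm _ μ hμ a ha
  have hprob := hμ.1
  have hm : 1 ≤ m := by omega
  obtain ⟨K, hK1, hKK, hGG⟩ := hcomb m hm
  have key := final_meas hd hc hC hEsc hK1 hKK hGG hm hD hn hnm hμ a ha
  obtain ⟨E, hE⟩ : ∃ E, E = { ω : ℕ → V d | alphaList D n ω = a } := ⟨_, rfl⟩
  rw [← hE] at ha key ⊢
  obtain ⟨H, hH⟩ : ∃ H, H = { ω : ℕ → V d | min (c / K0) (c / C) * (m : ℝ) ^ 2 ≤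
                      (hitCount (boxA (endPt a) n m) (betaList D n m ω) : ℝ) } := ⟨_, rfl⟩
  rw [← hH]
  have hsub : {ω : ℕ → V d | c / K0 * (m : ℝ) ^ 2 ≤ (hitCount (boxA (endPt a) n m) (betaList D n m ω) : ℝ) } ⊆ H := by
    intro ω hω
    rw [hH]
    refine le_trans ?_ (show c / K0 * (m : ℝ) ^ 2 ≤ (hitCount (boxA (endPt a) n m) (betaList D n m ω) : ℝ) from hω)
    gcongr
    exact min_le_left _ _
  have k2 : ENNReal.ofReal (c / C) * μ E ≤ μ.restrict E H :=
    key.trans ((measure_mono (Set.inter_subset_inter_left E hsub)).trans (Measure.le_restrict_apply _ _))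
  have hEt : μ E ≠ ⊤ := measure_ne_top _ _
  have hcond : ProbabilityTheory.cond μ E H = (μ E)⁻¹ * μ.restrict E H := by
    unfold ProbabilityTheory.cond
    rw [Measure.smul_apply, smul_eq_mul]
  have k3 : ENNReal.ofReal (c / C) ≤ ProbabilityTheory.cond μ E H := by
    rw [hcond, mul_comm, ← div_eq_mul_inv, ENNReal.le_div_iff_mul_le (Or.inl ha) (Or.inl hEt)]
    exact k2
  have htop : ProbabilityTheory.cond μ E H ≠ ⊤ := by
    rw [hcond]
    exact ENNReal.mul_ne_top (ENNReal.inv_ne_top.2 ha) (measure_ne_top _ _)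
  refine (min_le_right _ _).trans ?_
  rw [← ENNReal.ofReal_le_iff_le_toReal htop]
  exact k3

end USFPaper
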